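/- Let 2 ≤ p ≤ ∞ and r = 2p/(p+2). Assume φ ∈ Φ² satisfies the SND condition and a ∈ L^p S^m_ρ with 0 ≤ ρ ≤ 1 and m < n(ρ−1)/2. Then the Fourier integral operator T_a f(x) = (2π)^{−n} ∫_{ℝⁿ} e^{iφ(x,ξ)} a(x,ξ) f̂(ξ) dξ is bounded from L²(ℝⁿ) to L^r(ℝⁿ): ‖T_a f‖_{L^r} ≤ C ‖f‖_{L²} for all Schwartz f. -/

import Mathlib

open MeasureTheory Real Complex
open scoped ENNReal NNReal RealInnerProductSpace SchwartzMap Classical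

noncomputable section

/-- `ℝⁿ` as a Euclidean space. -/
abbrev En (n : ℕ) : Type := EuclideanSpace ℝ (Fin n)

/-- Partial derivative in the `i`-th coordinate direction. -/
def pd {n : ℕ} {F : Type} [NormedAddCommGroup F] [NormedSpace ℝ F]
    (i : Fin n) (f : En n → F) : En n → F :=
  fun x => fderiv ℝ f x (EuclideanSpace.single i 1)

/-- Multi-index partial derivative `∂^α`. -/
def mderiv {n : ℕ} {F : Type} [NormedAddCommGroup F] [NormedSpace ℝ F]
    (α : Fin n → ℕ) (f : En n → F) : En n → F :=
  (List.finRange n).foldr (fun i g => (pd i)^[α i] g) f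

/-- The order `|α|` of a multi-index. -/
def mdeg {n : ℕ} (α : Fin n → ℕ) : ℕ := ∑ i, α i

/-- The finite set of multi-indices `α` with every entry `≤ k` and `|α| ≤ k`;
this enumerates all multi-indices of order at most `k`. -/
def multiIdx (n k : ℕ) : Finset (Fin n → ℕ) :=
  (Fintype.piFinset fun _ : Fin n => Finset.range (k + 1)).filter fun α => mdeg α ≤ k

/-- Japanese bracket `⟨ξ⟩^t = (1+|ξ|²)^{t/2}`. -/
def jb {n : ℕ} (ξ : En n) (t : ℝ) : ℝ := (1 + ‖ξ‖ ^ 2) ^ (t / 2)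

/-- The rough amplitude class `L^p S^m_ρ`. -/
def LpSm {n : ℕ} (p : ℝ≥0∞) (m ρ : ℝ) (a : En n → En n → ℂ) : Prop :=
  (∀ x, ContDiff ℝ (⊤ : ℕ∞) (a x)) ∧
  (∀ (α : Fin n → ℕ) (ξ : En n), AEStronglyMeasurable (fun x => mderiv α (a x) ξ) volume) ∧
  ∀ α : Fin n → ℕ, ∃ C : ℝ, ∀ ξ : En n,
    eLpNorm (fun x => mderiv α (a x) ξ) p volume ≤
      ENNReal.ofReal (C * jb ξ (m - ρ * (mdeg α : ℝ)))

/-- The seminorms `|a|_{p,m,s}` of an amplitude in `L^p S^m_ρ`. -/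
def aSemi {n : ℕ} (p : ℝ≥0∞) (m ρ : ℝ) (s : ℕ) (a : En n → En n → ℂ) : ℝ≥0∞ :=
  ∑ α ∈ multiIdx n s, ⨆ ξ : En n,
    ENNReal.ofReal (jb ξ (ρ * (mdeg α : ℝ) - m)) *
      eLpNorm (fun x => mderiv α (a x) ξ) p volume

/-- The mixed derivative `∂_ξ^α ∂_x^β φ(x,ξ)`. -/
def mixedD {n : ℕ} (α β : Fin n → ℕ) (φ : En n → En n → ℝ) (x ξ : En n) : ℝ :=
  mderiv α (fun ζ => mderiv β (fun y => φ y ζ) x) ξ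

/-- The phase function class `Φ^k`. -/
def PhiClass {n : ℕ} (k : ℕ) (φ : En n → En n → ℝ) : Prop :=
  ContDiffOn ℝ (⊤ : ℕ∞) (fun q : En n × En n => φ q.1 q.2) {q | q.2 ≠ 0} ∧
  (∀ (x ξ : En n) (t : ℝ), 0 < t → φ x (t • ξ) = t * φ x ξ) ∧
  ∀ α β : Fin n → ℕ, k ≤ mdeg α + mdeg β →
    ∃ C : ℝ, ∀ (x ξ : En n), ξ ≠ 0 →
      ‖ξ‖ ^ ((mdeg α : ℝ) - 1) * |mixedD α β φ x ξ| ≤ C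

/-- The mixed Hessian matrix `[∂²φ/∂x_j∂ξ_k]`. -/
def mixHess {n : ℕ} (φ : En n → En n → ℝ) (x ξ : En n) : Matrix (Fin n) (Fin n) ℝ :=
  Matrix.of fun j k => pd j (fun y => pd k (φ y) ξ) x

/-- The strong non-degeneracy (SND) condition. -/
def SNDcond {n : ℕ} (φ : En n → En n → ℝ) : Prop :=
  ∃ c : ℝ, 0 < c ∧ ∀ (x ξ : En n), ξ ≠ 0 → c ≤ |(mixHess φ x ξ).det|

/-- The Fourier transform `f̂(ξ) = ∫ e^{-i⟨y,ξ⟩} f(y) dy`. -/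
def ft {n : ℕ} (f : En n → ℂ) (ξ : En n) : ℂ :=
  ∫ y : En n, Complex.exp (-(Complex.I * Complex.ofReal ⟪y, ξ⟫)) * f y

/-- The linear Fourier integral operator
`T_a f(x) = (2π)^{-n} ∫ e^{iφ(x,ξ)} a(x,ξ) f̂(ξ) dξ`. -/
def fio {n : ℕ} (a : En n → En n → ℂ) (φ : En n → En n → ℝ) (f : En n → ℂ)
    (x : En n) : ℂ :=
  (((2 * Real.pi) ^ n)⁻¹ : ℝ) •
    ∫ ξ : En n, Complex.exp (Complex.I * Complex.ofReal (φ x ξ)) * a x ξ * ft f ξ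

/-- The conjugate exponent `p′` of `p ∈ [1,∞]`. -/
def pconj (p : ℝ≥0∞) : ℝ≥0∞ := (1 - p⁻¹)⁻¹

/-- The order `𝔪(ρ,p,q)` from Definition 4.6. -/
def frakm (n : ℕ) (ρ : ℝ) (p q : ℝ≥0∞) : ℝ :=
  if p < 2 ∨ (2 ≤ p ∧ q < pconj p) then
    (n : ℝ) * (ρ - 1) * (min p q)⁻¹.toReal -
      (((n : ℝ) - 1) / 2) * (p⁻¹.toReal + (min p q)⁻¹.toReal)
  else if 2 ≤ q then
    (n : ℝ) * (ρ - 1) / 2 - ((n : ℝ) - 1) * (1 / 2 - q⁻¹.toReal)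
  else
    (n : ℝ) * (ρ - 1) * q⁻¹.toReal -
      (((n : ℝ) - 1) / (1 - 2 * p⁻¹.toReal)) * (q⁻¹.toReal - 1 / 2)

/-- The order `ℳ(ρ,p,q)` from Definition 4.6. -/
def scrM (n : ℕ) (ρ : ℝ) (p q : ℝ≥0∞) : ℝ :=
  (n : ℝ) * (ρ - 1) * q⁻¹.toReal -
    (((n : ℝ) - 1) / (1 + p⁻¹.toReal)) * (q⁻¹.toReal - 1 / 2)

/-- The distribution function `λ_f(s) = |{x : |f(x)| > s}|`. -/
def distFn {n : ℕ} (f : En n → ℂ) (s : ℝ) : ℝ≥0∞ := volume {x : En n | s < ‖f x‖}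

/-- The decreasing rearrangement `f*`. -/
def rearr {n : ℕ} (f : En n → ℂ) (t : ℝ) : ℝ :=
  sInf {s : ℝ | 0 ≤ s ∧ distFn f s ≤ ENNReal.ofReal t}

/-- The Lorentz space quasinorm
`‖f‖_{L^{r,q}} = (∫_0^∞ (t^{1/r} f*(t))^q dt/t)^{1/q}`. -/
def lorentzNorm {n : ℕ} (r q : ℝ≥0∞) (f : En n → ℂ) : ℝ≥0∞ :=
  (∫⁻ t in Set.Ioi (0 : ℝ),
      ENNReal.ofReal ((t ^ r⁻¹.toReal * rearr f t) ^ q.toReal / t)) ^ q⁻¹.toReal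

/-- Mixed frequency derivatives `∂_ξ^{α₁} ∂_η^{α₂} a(x,ξ,η)` of a bilinear amplitude. -/
def d2 {n : ℕ} (α₁ α₂ : Fin n → ℕ) (a : En n → En n → En n → ℂ)
    (x ξ η : En n) : ℂ :=
  mderiv α₁ (fun ζ => mderiv α₂ (fun θ => a x ζ θ) η) ξ

/-- Mixed derivatives `∂_x^β ∂_ξ^{α₁} ∂_η^{α₂} a(x,ξ,η)` of a bilinear amplitude. -/
def d3 {n : ℕ} (β α₁ α₂ : Fin n → ℕ) (a : En n → En n → En n → ℂ)
    (x ξ η : En n) : ℂ :=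
  mderiv β (fun y => d2 α₁ α₂ a y ξ η) x

/-- The bilinear product-type rough amplitude class `L^p_Π S^{(m₁,m₂)}_{(ρ₁,ρ₂)}(n,2)`. -/
def LpPiSm2 {n : ℕ} (p : ℝ≥0∞) (m₁ m₂ ρ₁ ρ₂ : ℝ) (a : En n → En n → En n → ℂ) : Prop :=
  (∀ x, ContDiff ℝ (⊤ : ℕ∞) (fun q : En n × En n => a x q.1 q.2)) ∧
  (∀ (α₁ α₂ : Fin n → ℕ) (ξ η : En n),
    AEStronglyMeasurable (fun x => d2 α₁ α₂ a x ξ η) volume) ∧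
  ∀ α₁ α₂ : Fin n → ℕ, ∃ C : ℝ, ∀ ξ η : En n,
    eLpNorm (fun x => d2 α₁ α₂ a x ξ η) p volume ≤
      ENNReal.ofReal (C * jb ξ (m₁ - ρ₁ * (mdeg α₁ : ℝ)) * jb η (m₂ - ρ₂ * (mdeg α₂ : ℝ)))

/-- The bilinear rough amplitude class `L^p S^m_ρ(n,2)`. -/
def LpSm2 {n : ℕ} (p : ℝ≥0∞) (m ρ : ℝ) (a : En n → En n → En n → ℂ) : Prop :=
  (∀ x, ContDiff ℝ (⊤ : ℕ∞) (fun q : En n × En n => a x q.1 q.2)) ∧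
  (∀ (α₁ α₂ : Fin n → ℕ) (ξ η : En n),
    AEStronglyMeasurable (fun x => d2 α₁ α₂ a x ξ η) volume) ∧
  ∀ α₁ α₂ : Fin n → ℕ, ∃ C : ℝ, ∀ ξ η : En n,
    eLpNorm (fun x => d2 α₁ α₂ a x ξ η) p volume ≤
      ENNReal.ofReal (C * (1 + ‖ξ‖ + ‖η‖) ^ (m - ρ * ((mdeg α₁ : ℝ) + (mdeg α₂ : ℝ))))

/-- The bilinear Hörmander class `S^m_{ρ,δ}(n,2)`. -/
def HormS2 {n : ℕ} (m ρ δ : ℝ) (a : En n → En n → En n → ℂ) : Prop :=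
  ContDiff ℝ (⊤ : ℕ∞) (fun q : En n × En n × En n => a q.1 q.2.1 q.2.2) ∧
  ∀ β α₁ α₂ : Fin n → ℕ, ∃ C : ℝ, ∀ x ξ η : En n,
    ‖d3 β α₁ α₂ a x ξ η‖ ≤
      C * (1 + ‖ξ‖ + ‖η‖) ^ (m - ρ * ((mdeg α₁ : ℝ) + (mdeg α₂ : ℝ)) + δ * (mdeg β : ℝ))

/-- The bilinear Fourier integral operator
`T_a(f,g)(x) = ∫∫ a(x,ξ,η) e^{iφ₁(x,ξ)+iφ₂(x,η)} f̂(ξ) ĝ(η) dξ dη`. -/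
def bfio {n : ℕ} (a : En n → En n → En n → ℂ) (φ₁ φ₂ : En n → En n → ℝ)
    (f g : En n → ℂ) (x : En n) : ℂ :=
  ∫ w : En n × En n,
    a x w.1 w.2 * Complex.exp (Complex.I * Complex.ofReal (φ₁ x w.1 + φ₂ x w.2)) *
      ft f w.1 * ft g w.2

/-- Partial derivative of a function of `N` frequency variables in the `i`-th coordinate
of the `j`-th variable. -/
def pdN {n N : ℕ} (j : Fin N) (i : Fin n) (g : (Fin N → En n) → ℂ) :
    (Fin N → En n) → ℂ :=
  fun ξ => fderiv ℝ g ξ (Pi.single j (EuclideanSpace.single i 1))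

/-- Multi-index derivative `∂_{ξ₁}^{A 1} ⋯ ∂_{ξ_N}^{A N}`. -/
def mderivN {n N : ℕ} (A : Fin N → Fin n → ℕ) (g : (Fin N → En n) → ℂ) :
    (Fin N → En n) → ℂ :=
  (List.finRange N).foldr
    (fun j h => (List.finRange n).foldr (fun i h' => (pdN j i)^[A j i] h') h) g

/-- The multilinear product-type rough amplitude class `L^p_Π S^{m⃗}_{ρ⃗}(n,N)`. -/
def LpPiSmN {n N : ℕ} (p : ℝ≥0∞) (m ρ : Fin N → ℝ)
    (a : En n → (Fin N → En n) → ℂ) : Prop :=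
  (∀ x, ContDiff ℝ (⊤ : ℕ∞) (a x)) ∧
  (∀ (A : Fin N → Fin n → ℕ) (ξ : Fin N → En n),
    AEStronglyMeasurable (fun x => mderivN A (a x) ξ) volume) ∧
  ∀ A : Fin N → Fin n → ℕ, ∃ C : ℝ, ∀ ξ : Fin N → En n,
    eLpNorm (fun x => mderivN A (a x) ξ) p volume ≤
      ENNReal.ofReal (C * ∏ j, jb (ξ j) (m j - ρ j * (mdeg (A j) : ℝ)))

/-- The multilinear rough amplitude class `L^p S^m_ρ(n,N)`. -/
def LpSmN {n N : ℕ} (p : ℝ≥0∞) (m ρ : ℝ) (a : En n → (Fin N → En n) → ℂ) : Prop :=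
  (∀ x, ContDiff ℝ (⊤ : ℕ∞) (a x)) ∧
  (∀ (A : Fin N → Fin n → ℕ) (ξ : Fin N → En n),
    AEStronglyMeasurable (fun x => mderivN A (a x) ξ) volume) ∧
  ∀ A : Fin N → Fin n → ℕ, ∃ C : ℝ, ∀ ξ : Fin N → En n,
    eLpNorm (fun x => mderivN A (a x) ξ) p volume ≤
      ENNReal.ofReal (C * (1 + ∑ j, ‖ξ j‖) ^ (m - ρ * ∑ j, (mdeg (A j) : ℝ)))

/-- The multilinear Fourier integral operator. -/
def mfio {n N : ℕ} (a : En n → (Fin N → En n) → ℂ) (φ : Fin N → En n → En n → ℝ)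
    (f : Fin N → En n → ℂ) (x : En n) : ℂ :=
  ∫ ξ : Fin N → En n,
    a x ξ * Complex.exp (Complex.I * Complex.ofReal (∑ j, φ j x (ξ j))) *
      ∏ j, ft (f j) (ξ j)

/-- The Sobolev (Bessel potential) norm `‖f‖_{H^{s,q}} = ‖ℱ^{-1}(⟨ξ⟩^s f̂)‖_{L^q}`. -/
def besselNorm {n : ℕ} (s : ℝ) (q : ℝ≥0∞) (f : En n → ℂ) : ℝ≥0∞ :=
  eLpNorm (fun x : En n =>
    (((2 * Real.pi) ^ n)⁻¹ : ℝ) •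
      ∫ ξ : En n, Complex.ofReal (jb ξ s) * ft f ξ *
        Complex.exp (Complex.I * Complex.ofReal ⟪x, ξ⟫)) q volume

/-- Directional derivative. -/
def dv {n : ℕ} (v : En n) (f : En n → ℂ) : En n → ℂ := fun x => fderiv ℝ f x v

/-- Sum of norms of iterated directional derivatives. -/
def Js {n : ℕ} (v : En n) (k : ℕ) (f : En n → ℂ) (x : En n) : ℝ :=
  ∑ j ∈ Finset.range (k + 1), ‖(dv v)^[j] f x‖

section Jlemmas
variable {n : ℕ}

lemma Js_nonneg (v : En n) (k : ℕ) (f : En n → ℂ) (x : En n) : 0 ≤ Js v k f x :=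
  Finset.sum_nonneg fun _ _ => norm_nonneg _

lemma Js_zero (v : En n) (f : En n → ℂ) (x : En n) : Js v 0 f x = ‖f x‖ := by
  simp [Js]

lemma Js_succ (v : En n) (k : ℕ) (f : En n → ℂ) (x : En n) :
    Js v (k + 1) f x = ‖f x‖ + Js v k (dv v f) x := by
  unfold Js
  rw [Finset.sum_range_succ']
  simp only [Function.iterate_succ_apply, Function.iterate_zero, id]
  ring

lemma Js_mono (v : En n) {k l : ℕ} (h : k ≤ l) (f : En n → ℂ) (x : En n) :
    Js v k f x ≤ Js v l f x :=
  Finset.sum_le_sum_of_subset_of_nonneg (Finset.range_mono (by omega))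
    fun _ _ _ => norm_nonneg _

lemma norm_le_Js (v : En n) (k : ℕ) (f : En n → ℂ) (x : En n) : ‖f x‖ ≤ Js v k f x := by
  rw [← Js_zero v]; exact Js_mono v (Nat.zero_le _) f x

lemma Js_dv_le (v : En n) (k : ℕ) (f : En n → ℂ) (x : En n) :
    Js v k (dv v f) x ≤ Js v (k + 1) f x := by
  rw [Js_succ]; linarith [norm_nonneg (f x)]

lemma dv_congr {Ω : Set (En n)} (hΩ : IsOpen Ω) (v : En n) {f g : En n → ℂ}
    (h : ∀ x ∈ Ω, f x = g x) : ∀ x ∈ Ω, dv v f x = dv v g x := by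
  intro x hx
  have : f =ᶠ[nhds x] g := Filter.eventuallyEq_of_mem (hΩ.mem_nhds hx) h
  simp [dv, this.fderiv_eq]

lemma dvi_congr {Ω : Set (En n)} (hΩ : IsOpen Ω) (v : En n) (k : ℕ) :
    ∀ {f g : En n → ℂ}, (∀ x ∈ Ω, f x = g x) → ∀ x ∈ Ω, (dv v)^[k] f x = (dv v)^[k] g x := by
  induction k with
  | zero => intro f g h x hx; simpa using h x hx
  | succ k ih =>
    intro f g h x hx
    simp only [Function.iterate_succ_apply]
    exact ih (dv_congr hΩ v h) x hx

lemma Js_congr {Ω : Set (En n)} (hΩ : IsOpen Ω) (v : En n) (k : ℕ)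
    {f g : En n → ℂ} (h : ∀ x ∈ Ω, f x = g x) : ∀ x ∈ Ω, Js v k f x = Js v k g x := by
  intro x hx
  unfold Js
  exact Finset.sum_congr rfl fun j _ => by rw [dvi_congr hΩ v j h x hx]

lemma dv_contDiffOn {Ω : Set (En n)} (hΩ : IsOpen Ω) (v : En n) {f : En n → ℂ}
    (hf : ContDiffOn ℝ (⊤ : ℕ∞) f Ω) : ContDiffOn ℝ (⊤ : ℕ∞) (dv v f) Ω := by
  have := hf.fderiv_of_isOpen (m := (⊤ : ℕ∞)) hΩ (by norm_cast)
  exact this.clm_apply contDiffOn_const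

lemma dvi_contDiffOn {Ω : Set (En n)} (hΩ : IsOpen Ω) (v : En n) (k : ℕ) : ∀ {f : En n → ℂ},
    ContDiffOn ℝ (⊤ : ℕ∞) f Ω → ContDiffOn ℝ (⊤ : ℕ∞) ((dv v)^[k] f) Ω := by
  induction k with
  | zero => intro f h; simpa using h
  | succ k ih => intro f h; simp only [Function.iterate_succ_apply]; exact ih (dv_contDiffOn hΩ v h)

lemma cdo_diffAt {Ω : Set (En n)} (hΩ : IsOpen Ω) {f : En n → ℂ}
    (hf : ContDiffOn ℝ (⊤ : ℕ∞) f Ω) {x : En n} (hx : x ∈ Ω) : DifferentiableAt ℝ f x :=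
  (hf.contDiffAt (hΩ.mem_nhds hx)).differentiableAt (by simp)

lemma Js_add {Ω : Set (En n)} (hΩ : IsOpen Ω) (v : En n) (k : ℕ) :
    ∀ {f g : En n → ℂ}, ContDiffOn ℝ (⊤ : ℕ∞) f Ω → ContDiffOn ℝ (⊤ : ℕ∞) g Ω →
    ∀ x ∈ Ω, Js v k (fun y => f y + g y) x ≤ Js v k f x + Js v k g x := by
  induction k with
  | zero => intro f g hf hg x hx; simp only [Js_zero]; exact norm_add_le _ _
  | succ k ih =>
    intro f g hf hg x hx
    simp only [Js_succ]
    have h1 : ∀ y ∈ Ω, dv v (fun y => f y + g y) y = dv v f y + dv v g y := by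
      intro y hy
      simp only [dv]
      rw [fderiv_fun_add (cdo_diffAt hΩ hf hy) (cdo_diffAt hΩ hg hy)]; rfl
    rw [Js_congr hΩ v k h1 x hx]
    have := ih (dv_contDiffOn hΩ v hf) (dv_contDiffOn hΩ v hg) x hx
    have := norm_add_le (f x) (g x)
    linarith

lemma Js_mul {Ω : Set (En n)} (hΩ : IsOpen Ω) (v : En n) (k : ℕ) :
    ∀ {f g : En n → ℂ}, ContDiffOn ℝ (⊤ : ℕ∞) f Ω → ContDiffOn ℝ (⊤ : ℕ∞) g Ω →
    ∀ x ∈ Ω, Js v k (fun y => f y * g y) x ≤ 4 ^ k * (Js v k f x * Js v k g x) := by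
  induction k with
  | zero => intro f g hf hg x hx; simp [Js_zero]
  | succ k ih =>
    intro f g hf hg x hx
    rw [Js_succ]
    have h1 : ∀ y ∈ Ω, dv v (fun y => f y * g y) y
        = (fun z => f z * dv v g z) y + (fun z => dv v f z * g z) y := by
      intro y hy
      simp only [dv]
      rw [fderiv_fun_mul (cdo_diffAt hΩ hf hy) (cdo_diffAt hΩ hg hy)]
      simp [mul_comm]
    rw [Js_congr hΩ v k h1 x hx]
    have hdf := dv_contDiffOn hΩ v hf
    have hdg := dv_contDiffOn hΩ v hg
    have a1 := Js_add hΩ v k (hf.mul hdg) (hdf.mul hg) x hx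
    have a2 := ih hf hdg x hx
    have a3 := ih hdf hg x hx
    have b1 := Js_mono v (Nat.le_succ k) f x
    have b2 := Js_mono v (Nat.le_succ k) g x
    have b3 := Js_dv_le v k f x
    have b4 := Js_dv_le v k g x
    have c1 : Js v k f x * Js v k (dv v g) x ≤ Js v (k+1) f x * Js v (k+1) g x :=
      mul_le_mul b1 b4 (Js_nonneg _ _ _ _) (Js_nonneg _ _ _ _)
    have c2 : Js v k (dv v f) x * Js v k g x ≤ Js v (k+1) f x * Js v (k+1) g x :=
      mul_le_mul b3 b2 (Js_nonneg _ _ _ _) (Js_nonneg _ _ _ _)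
    have c3 : ‖f x * g x‖ ≤ Js v (k+1) f x * Js v (k+1) g x := by
      rw [norm_mul]
      exact mul_le_mul (norm_le_Js _ _ _ _) (norm_le_Js _ _ _ _) (norm_nonneg _)
        (Js_nonneg _ _ _ _)
    set P := Js v (k+1) f x * Js v (k+1) g x with hP
    have hP0 : 0 ≤ P := mul_nonneg (Js_nonneg _ _ _ _) (Js_nonneg _ _ _ _)
    have h4 : (1:ℝ) ≤ 4 ^ k := one_le_pow₀ (by norm_num)
    have d1 : (4:ℝ)^k * (Js v k f x * Js v k (dv v g) x) ≤ 4^k * P := by gcongr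
    have d2 : (4:ℝ)^k * (Js v k (dv v f) x * Js v k g x) ≤ 4^k * P := by gcongr
    have d3 : P ≤ 4^k * P := le_mul_of_one_le_left hP0 h4
    have d4 : 0 ≤ 4^k*P := by positivity
    rw [pow_succ]
    calc _ ≤ P + (4^k*P + 4^k*P) := by
          have := a1; simp only at this a2 a3 ⊢; linarith
      _ ≤ _ := by nlinarith

lemma Js_inv (k : ℕ) (c C : ℝ) (hc : 0 < c) : ∃ C' : ℝ, 0 ≤ C' ∧
    ∀ (Ω : Set (En n)) (v : En n) (q : En n → ℂ), IsOpen Ω → ContDiffOn ℝ (⊤ : ℕ∞) q Ω →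
    (∀ x ∈ Ω, c ≤ ‖q x‖) → (∀ x ∈ Ω, Js v k q x ≤ C) →
    ∀ x ∈ Ω, Js v k (fun y => (q y)⁻¹) x ≤ C' := by
  induction k with
  | zero =>
    refine ⟨c⁻¹, by positivity, fun Ω v q hΩ hq h1 h2 x hx => ?_⟩
    rw [Js_zero, norm_inv]
    exact inv_anti₀ hc (h1 x hx)
  | succ k ih =>
    obtain ⟨D, hD0, hD⟩ := ih
    refine ⟨c⁻¹ + 4^k * ((4^k * (D * D)) * |C|), by positivity, fun Ω v q hΩ hq h1 h2 x hx => ?_⟩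
    have hq0 : ∀ y ∈ Ω, q y ≠ 0 := fun y hy => by
      have := h1 y hy
      intro h; rw [h, norm_zero] at this; linarith
    have hi : ContDiffOn ℝ (⊤ : ℕ∞) (fun y => (q y)⁻¹) Ω := hq.inv hq0
    have hii := hi.mul hi
    have hdq : ContDiffOn ℝ (⊤ : ℕ∞) (fun y => - dv v q y) Ω := (dv_contDiffOn hΩ v hq).neg
    rw [Js_succ]
    have e1 : ∀ y ∈ Ω, dv v (fun y => (q y)⁻¹) y =
        (fun z => ((q z)⁻¹ * (q z)⁻¹) * dv v (fun z => - q z) z) y := by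
      intro y hy
      have hd := (cdo_diffAt hΩ hq hy)
      have h3 := (hasFDerivAt_inv' (𝕜 := ℝ) (hq0 y hy)).comp y hd.hasFDerivAt
      have h4 : (fun y => (q y)⁻¹) = Inv.inv ∘ q := rfl
      simp only [dv]
      rw [h4, h3.fderiv, fderiv_fun_neg]
      simp
      ring
    rw [Js_congr hΩ v k e1 x hx]
    have hnq : ContDiffOn ℝ (⊤ : ℕ∞) (fun z => - q z) Ω := hq.neg
    have m1 := Js_mul hΩ v k hii (dv_contDiffOn hΩ v hnq) x hx
    have m2 := Js_mul hΩ v k hi hi x hx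
    have m3 := hD Ω v q hΩ hq h1 (fun y hy => (Js_mono v (Nat.le_succ k) q y).trans (h2 y hy)) x hx
    have hneg : ∀ (j : ℕ) (f : En n → ℂ), Js v j (fun z => - f z) x = Js v j f x := by
      intro j
      induction j with
      | zero => intro f; simp [Js_zero]
      | succ j ihj =>
        intro f
        rw [Js_succ, Js_succ, norm_neg]
        congr 1
        have : dv v (fun z => - f z) = fun z => - dv v f z := by
          funext z; simp [dv, fderiv_fun_neg]
        rw [this, ihj]
    have m4 : Js v k (dv v (fun z => - q z)) x ≤ |C| := by
      refine (Js_dv_le v k _ x).trans ?_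
      rw [hneg]
      exact (h2 x hx).trans (le_abs_self C)
    have m5 : ‖(q x)⁻¹‖ ≤ c⁻¹ := by rw [norm_inv]; exact inv_anti₀ hc (h1 x hx)
    refine add_le_add m5 (m1.trans ?_)
    have z1 := Js_nonneg v k (fun y => (q y)⁻¹) x
    gcongr
    · exact Js_nonneg _ _ _ _
    · exact m2.trans (by gcongr)

lemma Js_exp (k : ℕ) (C : ℝ) : ∃ C' : ℝ, 0 ≤ C' ∧
    ∀ (Ω : Set (En n)) (v : En n) (θ : En n → ℝ) (l : ℝ), IsOpen Ω →
    ContDiffOn ℝ (⊤ : ℕ∞) (fun y => (θ y : ℂ)) Ω → 0 ≤ l → l ≤ 1 →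
    (∀ x ∈ Ω, Js v k (fun y => (θ y : ℂ)) x ≤ C) →
    ∀ x ∈ Ω, Js v k (fun y => Complex.exp (Complex.I * ((l * θ y : ℝ) : ℂ)) - 1) x ≤ C' * l := by
  induction k with
  | zero =>
    refine ⟨|C|, by positivity, fun Ω v θ l hΩ hθ l0 l1 h x hx => ?_⟩
    rw [Js_zero]
    have := h x hx
    rw [Js_zero] at this
    have h3 := Real.norm_exp_I_mul_ofReal_sub_one_le (x := l * θ x)
    refine h3.trans ?_
    rw [norm_mul, Real.norm_of_nonneg l0, mul_comm]
    gcongr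
    have h4 : ‖θ x‖ = ‖(θ x : ℂ)‖ := by simp
    rw [h4]; exact this.trans (le_abs_self C)
  | succ k ih =>
    obtain ⟨D, hD0, hD⟩ := ih
    refine ⟨|C| + 4^k * ((D + 1) * |C|), by positivity, fun Ω v θ l hΩ hθ l0 l1 h x hx => ?_⟩
    have hE0 : ContDiffOn ℝ (⊤ : ℕ∞) (fun y => Complex.exp (Complex.I * ((l * θ y : ℝ) : ℂ))) Ω := by
      have : ContDiffOn ℝ (⊤ : ℕ∞) (fun y => Complex.I * ((l * θ y : ℝ) : ℂ)) Ω := by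
        simp only [Complex.ofReal_mul]
        exact contDiffOn_const.mul (contDiffOn_const.mul hθ)
      exact this.cexp
    have hE : ContDiffOn ℝ (⊤ : ℕ∞) (fun y => Complex.exp (Complex.I * ((l * θ y : ℝ) : ℂ)) - 1) Ω :=
      hE0.sub contDiffOn_const
    rw [Js_succ]
    have e1 : ∀ y ∈ Ω, dv v (fun y => Complex.exp (Complex.I * ((l * θ y : ℝ) : ℂ)) - 1) y =
        (fun z => Complex.exp (Complex.I * ((l * θ z : ℝ) : ℂ)) *
          dv v (fun z => (Complex.I * l) * (θ z : ℂ)) z) y := by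
      intro y hy
      have hd := (cdo_diffAt hΩ hθ hy)
      have h2 : DifferentiableAt ℝ (fun z => (Complex.I * l) * (θ z : ℂ)) y :=
        hd.const_mul _
      have h3 := h2.hasFDerivAt.cexp
      have h4 : (fun y => Complex.exp (Complex.I * ((l * θ y : ℝ) : ℂ)) - 1) =
        fun y => Complex.exp ((Complex.I * l) * (θ y : ℂ)) - 1 := by
        funext z; push_cast; ring_nf
      simp only [dv]
      rw [h4, fderiv_sub_const, h3.fderiv]
      simp only [_root_.smul_apply, smul_eq_mul]
      push_cast; ring_nf
    rw [Js_congr hΩ v k e1 x hx]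
    have hcm : ∀ (j : ℕ) (f : En n → ℂ) (a : ℂ), Js v j (fun z => a * f z) x = ‖a‖ * Js v j f x := by
      intro j
      induction j with
      | zero => intro f a; simp [Js_zero]
      | succ j ihj =>
        intro f a
        rw [Js_succ, Js_succ, norm_mul, mul_add]
        congr 1
        have : dv v (fun z => a * f z) = fun z => a * dv v f z := by
          funext z
          simp only [dv]
          have := fderiv_const_smul_field (𝕜 := ℝ) (R := ℂ) a (f := f)
          have h5 := congrFun this z
          have h6 : (a • f) = fun z => a * f z := by funext z; simp
          rw [h6] at h5
          rw [h5]; simp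
        rw [this, ihj]
    have hl : ContDiffOn ℝ (⊤ : ℕ∞) (fun z => (Complex.I * l) * (θ z : ℂ)) Ω :=
      contDiffOn_const.mul hθ
    have m1 := Js_mul hΩ v k hE0 (dv_contDiffOn hΩ v hl) x hx
    have hJC := (h x hx).trans (le_abs_self C)
    have hnl : ‖Complex.I * (l:ℂ)‖ = l := by simp [abs_of_nonneg l0]
    have m2 : Js v k (dv v (fun z => (Complex.I * l) * (θ z : ℂ))) x ≤ l * |C| := by
      refine (Js_dv_le v k _ x).trans ?_
      rw [hcm, hnl]
      gcongr
    have m3 : Js v k (fun y => Complex.exp (Complex.I * ((l * θ y : ℝ) : ℂ))) x ≤ D + 1 := by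
      have e2 : ∀ y ∈ Ω, (fun y => Complex.exp (Complex.I * ((l * θ y : ℝ) : ℂ))) y =
        (fun y => (fun y => Complex.exp (Complex.I * ((l * θ y : ℝ) : ℂ)) - 1) y
          + (fun _ => (1:ℂ)) y) y := by
        intro y _; simp
      rw [Js_congr hΩ v k e2 x hx]
      refine (Js_add hΩ v k hE contDiffOn_const x hx).trans ?_
      have hone : Js v k (fun _ => (1:ℂ)) x ≤ 1 := by
        cases k with
        | zero => simp [Js_zero]
        | succ k =>
          rw [Js_succ]
          have : dv v (fun _ => (1:ℂ)) = fun _ => 0 * (0:ℂ) := by funext z; simp [dv]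
          rw [this, hcm]; simp
      have := hD Ω v θ l hΩ hθ l0 l1
        (fun y hy => (Js_mono v (Nat.le_succ k) _ y).trans (h y hy)) x hx
      have : D * l ≤ D := mul_le_of_le_one_right hD0 l1
      linarith
    have m0 : ‖Complex.exp (Complex.I * ((l * θ x : ℝ) : ℂ)) - 1‖ ≤ |C| * l := by
      have h3 := Real.norm_exp_I_mul_ofReal_sub_one_le (x := l * θ x)
      refine h3.trans ?_
      rw [norm_mul, Real.norm_of_nonneg l0, mul_comm]
      gcongr
      have h4 : ‖θ x‖ = ‖(θ x : ℂ)‖ := by simp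
      rw [h4]; exact (norm_le_Js v _ (fun y => (θ y : ℂ)) x).trans hJC
    have m5 : (4:ℝ)^k * (Js v k (fun y => Complex.exp (Complex.I * ((l * θ y : ℝ) : ℂ))) x *
        Js v k (dv v (fun z => (Complex.I * l) * (θ z : ℂ))) x) ≤ 4^k * ((D+1) * (l * |C|)) := by
      gcongr
      exact Js_nonneg _ _ _ _
    calc _ ≤ |C| * l + 4^k * ((D+1) * (l * |C|)) := add_le_add m0 (m1.trans m5)
      _ = _ := by ring

lemma Js_const_mul (v : En n) (x : En n) : ∀ (j : ℕ) (f : En n → ℂ) (a : ℂ),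
    Js v j (fun z => a * f z) x = ‖a‖ * Js v j f x := by
  intro j
  induction j with
  | zero => intro f a; simp [Js_zero]
  | succ j ihj =>
    intro f a
    rw [Js_succ, Js_succ, norm_mul, mul_add]
    congr 1
    have : dv v (fun z => a * f z) = fun z => a * dv v f z := by
      funext z
      simp only [dv]
      have := fderiv_const_smul_field (𝕜 := ℝ) (R := ℂ) a (f := f)
      have h5 := congrFun this z
      have h6 : (a • f) = fun z => a * f z := by funext z; simp
      rw [h6] at h5
      rw [h5]; simp
    rw [this, ihj]

end Jlemmas

section IBP
variable {n : ℕ}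

lemma smooth_mul_of_tsupport {Ω : Set (En n)} (hΩ : IsOpen Ω) {f w : En n → ℂ}
    (hf : ContDiff ℝ (⊤ : ℕ∞) f) (hs : tsupport f ⊆ Ω) (hw : ContDiffOn ℝ (⊤ : ℕ∞) w Ω) :
    ContDiff ℝ (⊤ : ℕ∞) (fun x => f x * w x) := by
  rw [contDiff_iff_contDiffAt]
  intro x
  by_cases hx : x ∈ tsupport f
  · exact hf.contDiffAt.mul (hw.contDiffAt (hΩ.mem_nhds (hs hx)))
  · have h1 : (fun x => f x * w x) =ᶠ[nhds x] fun _ => 0 := by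
      have := (isClosed_tsupport f).isOpen_compl.mem_nhds hx
      filter_upwards [this] with y hy
      rw [image_eq_zero_of_notMem_tsupport hy, zero_mul]
    exact contDiffAt_const.congr_of_eventuallyEq h1

lemma tsupport_mul_sub {f w : En n → ℂ} :
    tsupport (fun x => f x * w x) ⊆ tsupport f := by
  apply closure_mono
  intro x hx h
  exact hx (by simp [h])

lemma Js_zero_fun (v : En n) (k : ℕ) (x : En n) : Js v k (fun _ => (0:ℂ)) x = 0 := by
  have := Js_const_mul v x k (fun _ => (0:ℂ)) 0
  simpa using this

lemma Js_off_tsupport (v : En n) (k : ℕ) {f : En n → ℂ} {x : En n} (hx : x ∉ tsupport f) :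
    Js v k f x = 0 := by
  rw [← Js_zero_fun v k x]
  exact Js_congr (isClosed_tsupport f).isOpen_compl v k
    (fun y hy => image_eq_zero_of_notMem_tsupport hy) x hx

lemma Js_continuousOn {Ω : Set (En n)} (hΩ : IsOpen Ω) (v : En n) (k : ℕ) {f : En n → ℂ}
    (hf : ContDiffOn ℝ (⊤ : ℕ∞) f Ω) : ContinuousOn (Js v k f) Ω := by
  unfold Js
  exact continuousOn_finsetSum _ fun j _ => (dvi_contDiffOn hΩ v j hf).continuousOn.norm

lemma Js_integrable (v : En n) (k : ℕ) {f : En n → ℂ}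
    (hf : ContDiff ℝ (⊤ : ℕ∞) f) (hc : HasCompactSupport f) : Integrable (Js v k f) := by
  have h1 : Continuous (Js v k f) := by
    rw [← continuousOn_univ]
    exact Js_continuousOn isOpen_univ v k hf.contDiffOn
  refine h1.integrable_of_hasCompactSupport ?_
  refine HasCompactSupport.intro hc ?_
  intro x hx
  exact Js_off_tsupport v k hx

lemma ibp_step {Ω : Set (En n)} (hΩ : IsOpen Ω) {θ : En n → ℝ} {e : En n} {u f : En n → ℂ}
    (hθ : ContDiffOn ℝ (⊤ : ℕ∞) (fun y => (θ y : ℂ)) Ω) (hu : ContDiffOn ℝ (⊤ : ℕ∞) u Ω)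
    (hue : ∀ x ∈ Ω, u x * dv e (fun y => (θ y : ℂ)) x = 1)
    (hf : ContDiff ℝ (⊤ : ℕ∞) f) (hc : HasCompactSupport f) (hs : tsupport f ⊆ Ω)
    {κ M : ℝ} (hκ : 0 < κ) (hM : 0 < M) :
    ∫ x, Complex.exp (Complex.I * ((M * θ x : ℝ) : ℂ)) * f x =
      (Complex.I * (κ / M : ℝ)) * ∫ x, Complex.exp (Complex.I * ((M * θ x : ℝ) : ℂ)) *
        dv (κ⁻¹ • e) (fun y => f y * u y) x := by
  set E : En n → ℂ := fun x => Complex.exp (Complex.I * ((M * θ x : ℝ) : ℂ)) with hEdef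
  set v := κ⁻¹ • e with hv
  set g : En n → ℂ := fun y => f y * u y with hgdef
  have hE : ContDiffOn ℝ (⊤ : ℕ∞) E Ω := by
    have : ContDiffOn ℝ (⊤ : ℕ∞) (fun y => Complex.I * ((M * θ y : ℝ) : ℂ)) Ω := by
      simp only [Complex.ofReal_mul]
      exact contDiffOn_const.mul (contDiffOn_const.mul hθ)
    exact this.cexp
  have hg : ContDiff ℝ (⊤ : ℕ∞) g := smooth_mul_of_tsupport hΩ hf hs hu
  have hgs : tsupport g ⊆ tsupport f := tsupport_mul_sub
  have hgc : HasCompactSupport g := hc.of_isClosed_subset (isClosed_tsupport g) hgs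
  have key : ∀ x, fderiv ℝ E x v * g x = (Complex.I * (M / κ : ℝ)) * (E x * f x) := by
    intro x
    by_cases hx : x ∈ tsupport f
    · have hxΩ := hs hx
      have hd := cdo_diffAt hΩ hθ hxΩ
      have h2 : DifferentiableAt ℝ (fun z => (Complex.I * M) * (θ z : ℂ)) x := hd.const_mul _
      have h3 := h2.hasFDerivAt.cexp
      have h4 : E = fun y => Complex.exp ((Complex.I * M) * (θ y : ℂ)) := by
        funext z; simp only [hEdef]; push_cast; ring_nf
      have h5 : fderiv ℝ (fun z => (Complex.I * M) * (θ z : ℂ)) x v =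
          (Complex.I * M) * (κ⁻¹ * dv e (fun y => (θ y : ℂ)) x) := by
        rw [fderiv_const_mul hd]
        simp [hv, dv]
        ring
      rw [show fderiv ℝ E x v = E x * ((Complex.I * M) * (κ⁻¹ * dv e (fun y => (θ y : ℂ)) x)) by
        rw [h4, h3.fderiv]
        simp only [_root_.smul_apply, smul_eq_mul]
        rw [h5]]
      have h6 := hue x hxΩ
      simp only [hgdef]
      push_cast
      linear_combination (E x * Complex.I * M * (κ:ℂ)⁻¹ * f x) * h6
    · have : f x = 0 := image_eq_zero_of_notMem_tsupport hx
      simp [hgdef, this]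
  have hEf : Integrable (fun x => E x * f x) := by
    have h1 : ContDiff ℝ (⊤ : ℕ∞) (fun x => f x * E x) := smooth_mul_of_tsupport hΩ hf hs hE
    have h2 : (fun x => E x * f x) = fun x => f x * E x := by funext x; ring
    rw [h2]
    exact h1.continuous.integrable_of_hasCompactSupport
      (hc.of_isClosed_subset (isClosed_tsupport _) tsupport_mul_sub)
  have hEg : Integrable (fun x => E x * g x) := by
    have h1 : ContDiff ℝ (⊤ : ℕ∞) (fun x => g x * E x) :=
      smooth_mul_of_tsupport hΩ hg (hgs.trans hs) hE
    have h2 : (fun x => E x * g x) = fun x => g x * E x := by funext x; ring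
    rw [h2]
    exact h1.continuous.integrable_of_hasCompactSupport
      (hgc.of_isClosed_subset (isClosed_tsupport _) tsupport_mul_sub)
  have hEdg : Integrable (fun x => E x * fderiv ℝ g x v) := by
    have hdg : ContDiff ℝ (⊤ : ℕ∞) (dv v g) := by
      rw [← contDiffOn_univ]; exact dv_contDiffOn isOpen_univ v hg.contDiffOn
    have hds : tsupport (dv v g) ⊆ tsupport g := by
      refine closure_minimal ?_ (isClosed_tsupport g)
      intro x hx
      by_contra h
      have := Js_off_tsupport v 1 h
      rw [Js_succ, Js_zero] at this
      have h7 : ‖dv v g x‖ = 0 := by linarith [norm_nonneg (g x), norm_nonneg (dv v g x)]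
      exact hx (norm_eq_zero.mp h7)
    have h1 : ContDiff ℝ (⊤ : ℕ∞) (fun x => dv v g x * E x) :=
      smooth_mul_of_tsupport hΩ hdg (hds.trans (hgs.trans hs)) hE
    have h2 : (fun x => E x * fderiv ℝ g x v) = fun x => dv v g x * E x := by
      funext x; simp only [dv]; ring
    rw [h2]
    exact h1.continuous.integrable_of_hasCompactSupport
      ((hgc.of_isClosed_subset (isClosed_tsupport _) hds).of_isClosed_subset
        (isClosed_tsupport _) tsupport_mul_sub)
  have main := integral_mul_fderiv_eq_neg_fderiv_mul_of_integrable (μ := volume) (f := E) (g := g)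
    (v := v) (by simp only [key]; exact hEf.const_mul _) hEdg hEg
    (fun x hx => cdo_diffAt hΩ hE (hs (hgs hx)))
    (fun x _ => hg.differentiable (by simp) x)
  simp only [key] at main
  rw [integral_const_mul] at main
  simp only [dv]
  rw [main]
  have hM' : (M:ℂ) ≠ 0 := by exact_mod_cast hM.ne'
  have hκ' : (κ:ℂ) ≠ 0 := by exact_mod_cast hκ.ne'
  generalize (∫ a, E a * f a) = Z
  push_cast
  have h8 : (κ:ℂ) / M * (M / κ) = 1 := by field_simp
  linear_combination (-Z) * h8 + (-Z * ((κ:ℂ) / M * (M / κ))) * (-1 : ℂ) * (I_sq)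

lemma ibp_main {Ω : Set (En n)} (hΩ : IsOpen Ω) {θ : En n → ℝ} {e : En n} {u : En n → ℂ}
    (hθ : ContDiffOn ℝ (⊤ : ℕ∞) (fun y => (θ y : ℂ)) Ω) (hu : ContDiffOn ℝ (⊤ : ℕ∞) u Ω)
    (hue : ∀ x ∈ Ω, u x * dv e (fun y => (θ y : ℂ)) x = 1)
    {κ M C : ℝ} (hκ : 0 < κ) (hM : 0 < M) (N : ℕ) (hC : 0 ≤ C)
    (huC : ∀ x ∈ Ω, Js (κ⁻¹ • e) N u x ≤ C) :
    ∀ j ≤ N, ∀ f : En n → ℂ, ContDiff ℝ (⊤ : ℕ∞) f → HasCompactSupport f → tsupport f ⊆ Ω →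
    ‖∫ x, Complex.exp (Complex.I * ((M * θ x : ℝ) : ℂ)) * f x‖ ≤
      (4 ^ N * C * (κ / M)) ^ j * ∫ x, Js (κ⁻¹ • e) j f x := by
  intro j
  induction j with
  | zero =>
    intro _ f hf hc hs
    simp only [pow_zero, one_mul, Js_zero]
    refine (norm_integral_le_integral_norm _).trans (le_of_eq ?_)
    congr 1; funext x
    rw [norm_mul, mul_comm Complex.I, Complex.norm_exp_ofReal_mul_I, one_mul]
  | succ j ih =>
    intro hj f hf hc hs
    rw [ibp_step hΩ hθ hu hue hf hc hs hκ hM]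
    set v := κ⁻¹ • e with hv
    set g : En n → ℂ := fun y => f y * u y with hgdef
    have hg : ContDiff ℝ (⊤ : ℕ∞) g := smooth_mul_of_tsupport hΩ hf hs hu
    have hgs : tsupport g ⊆ tsupport f := tsupport_mul_sub
    have hgc : HasCompactSupport g := hc.of_isClosed_subset (isClosed_tsupport g) hgs
    have hdg : ContDiff ℝ (⊤ : ℕ∞) (dv v g) := by
      rw [← contDiffOn_univ]; exact dv_contDiffOn isOpen_univ v hg.contDiffOn
    have hds : tsupport (dv v g) ⊆ tsupport g := by
      refine closure_minimal ?_ (isClosed_tsupport g)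
      intro x hx
      by_contra h
      have := Js_off_tsupport v 1 h
      rw [Js_succ, Js_zero] at this
      have h7 : ‖dv v g x‖ = 0 := by linarith [norm_nonneg (g x), norm_nonneg (dv v g x)]
      exact hx (norm_eq_zero.mp h7)
    have hdc : HasCompactSupport (dv v g) := hgc.of_isClosed_subset (isClosed_tsupport _) hds
    have h1 := ih (by omega) (dv v g) hdg hdc (hds.trans (hgs.trans hs))
    rw [norm_mul]
    have h2 : ‖Complex.I * ((κ / M : ℝ):ℂ)‖ = κ / M := by
      rw [norm_mul, Complex.norm_I, one_mul, Complex.norm_real, Real.norm_of_nonneg (by positivity)]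
    rw [h2]
    have h3 : ∫ x, Js v j (dv v g) x ≤ (4 ^ N * C) * ∫ x, Js v (j+1) f x := by
      rw [← integral_const_mul]
      refine integral_mono (Js_integrable v j hdg hdc) ((Js_integrable v (j+1) hf hc).const_mul _) ?_
      intro x
      simp only
      by_cases hx : x ∈ tsupport f
      · have hxΩ := hs hx
        calc Js v j (dv v g) x ≤ Js v (j+1) g x := Js_dv_le _ _ _ _
          _ ≤ 4^(j+1) * (Js v (j+1) f x * Js v (j+1) u x) :=
            Js_mul hΩ v (j+1) hf.contDiffOn hu x hxΩ
          _ ≤ 4^N * (Js v (j+1) f x * C) := by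
            gcongr
            · exact mul_nonneg (Js_nonneg _ _ _ _) (Js_nonneg _ _ _ _)
            · norm_num
            · exact Js_nonneg _ _ _ _
            · exact (Js_mono v hj u x).trans (huC x hxΩ)
          _ = _ := by ring
      · rw [Js_off_tsupport v j (fun h => hx (hgs (hds h))), Js_off_tsupport v (j+1) hx]
        simp
    calc κ / M * _ ≤ κ / M * ((4 ^ N * C * (κ / M)) ^ j * ((4 ^ N * C) * ∫ x, Js v (j+1) f x)) := by
          refine mul_le_mul_of_nonneg_left (h1.trans ?_) (by positivity)
          refine mul_le_mul_of_nonneg_left h3 (by positivity)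
      _ = _ := by ring

end IBP

/-- Standard basis vector. -/
def eb {n : ℕ} (i : Fin n) : En n := EuclideanSpace.single i 1

/-- Hypotheses on a phase, on an open set of frequencies. -/
def PH {n : ℕ} (Ω : Set (En n)) (ψ : En n → En n → ℝ) (N : ℕ) (c C : ℝ) : Prop :=
  (∀ x, ContDiffOn ℝ (⊤ : ℕ∞) (fun ω => (ψ x ω : ℂ)) Ω) ∧
  ∀ x y, ∃ i : Fin n, ∀ ω ∈ Ω,
    c * ‖x - y‖ ≤ ‖dv (eb i) (fun ω => ((ψ x ω - ψ y ω : ℝ) : ℂ)) ω‖ ∧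
    Js (eb i) N (dv (eb i) (fun ω => ((ψ x ω - ψ y ω : ℝ) : ℂ))) ω ≤ C * ‖x - y‖

/-- Decaying weight. -/
def wt {n : ℕ} (s : ℝ) (z : En n) : ℝ := ((1 + s * ‖z‖) ^ (n + 1))⁻¹

/-- Total amplitude majorant. -/
def Jt {n : ℕ} (κ : ℝ) (N : ℕ) (f : En n → ℂ) (ω : En n) : ℝ := ∑ i : Fin n, Js (κ⁻¹ • eb i) N f ω

section kernel
variable {n : ℕ}

lemma dv_smul_iter (v : En n) (t : ℝ) (j : ℕ) : ∀ (f : En n → ℂ) (x : En n),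
    (dv (t • v))^[j] f x = (t : ℂ) ^ j * (dv v)^[j] f x := by
  induction j with
  | zero => intro f x; simp
  | succ j ih =>
    intro f x
    rw [Function.iterate_succ_apply', Function.iterate_succ_apply']
    have h1 : (dv (t • v))^[j] f = fun x => (t : ℂ) ^ j * (dv v)^[j] f x := funext (ih f)
    rw [h1]
    simp only [dv]
    have := fderiv_const_smul_field (𝕜 := ℝ) (R := ℂ) ((t:ℂ)^j) (f := (dv v)^[j] f)
    have h5 := congrFun this x
    have h6 : (((t:ℂ)^j) • (dv v)^[j] f) = fun z => (t:ℂ)^j * (dv v)^[j] f z := by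
      funext z; simp
    rw [h6] at h5
    rw [h5]; simp only [map_smul, Pi.smul_apply, _root_.smul_apply, smul_eq_mul, Complex.real_smul]
    ring

lemma Js_smul_le (v : En n) (t : ℝ) (h0 : 0 ≤ t) (h1 : t ≤ 1) (k : ℕ) (f : En n → ℂ) (x : En n) :
    Js (t • v) k f x ≤ Js v k f x := by
  unfold Js
  refine Finset.sum_le_sum fun j _ => ?_
  rw [dv_smul_iter, norm_mul]
  refine mul_le_of_le_one_left (norm_nonneg _) ?_
  rw [norm_pow, Complex.norm_real, Real.norm_of_nonneg h0]
  exact pow_le_one₀ h0 h1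

lemma Js_conj (v : En n) (k : ℕ) : ∀ (f : En n → ℂ) (x : En n),
    Js v k (fun y => (starRingEnd ℂ) (f y)) x = Js v k f x := by
  induction k with
  | zero => intro f x; simp [Js_zero]
  | succ k ih =>
    intro f x
    rw [Js_succ, Js_succ]
    have : dv v (fun y => (starRingEnd ℂ) (f y)) = fun y => (starRingEnd ℂ) (dv v f y) := by
      funext y
      simp only [dv]
      have h := (Complex.conjCLE : ℂ ≃L[ℝ] ℂ).comp_fderiv (f := f) (x := y)
      have h2 : (⇑(Complex.conjCLE : ℂ ≃L[ℝ] ℂ) ∘ f) = fun y => (starRingEnd ℂ) (f y) := rfl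
      rw [h2] at h
      rw [h]; rfl
    rw [this, ih]
    simp

lemma contDiff_conj {f : En n → ℂ} {Ω : Set (En n)} (hf : ContDiffOn ℝ (⊤ : ℕ∞) f Ω) :
    ContDiffOn ℝ (⊤ : ℕ∞) (fun y => (starRingEnd ℂ) (f y)) Ω :=
  (Complex.conjCLE : ℂ ≃L[ℝ] ℂ).contDiff.comp_contDiffOn hf

lemma Jt_nonneg (κ : ℝ) (N : ℕ) (f : En n → ℂ) (ω : En n) : 0 ≤ Jt κ N f ω :=
  Finset.sum_nonneg fun _ _ => Js_nonneg _ _ _ _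

lemma Js_le_Jt (i : Fin n) (κ : ℝ) (N : ℕ) (f : En n → ℂ) (ω : En n) :
    Js (κ⁻¹ • eb i) N f ω ≤ Jt κ N f ω :=
  Finset.single_le_sum (f := fun i => Js (κ⁻¹ • eb i) N f ω)
    (fun _ _ => Js_nonneg _ _ _ _) (Finset.mem_univ i)

lemma osc_bound {Ω : Set (En n)} (hΩ : IsOpen Ω) {ψ : En n → En n → ℝ} {c C : ℝ} (hc : 0 < c)
    (hψ : PH Ω ψ (n+1) c C) : ∃ K : ℝ, 0 ≤ K ∧ ∀ (x y : En n) (l κ : ℝ), 0 < l → 1 ≤ κ →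
    ∀ f : En n → ℂ, ContDiff ℝ (⊤ : ℕ∞) f → HasCompactSupport f → tsupport f ⊆ Ω →
    ∃ i : Fin n, ‖∫ ω, Complex.exp (Complex.I * ((l * (ψ x ω - ψ y ω) : ℝ) : ℂ)) * f ω‖ ≤
      K * wt (l / κ) (x - y) * ∫ ω, Js (κ⁻¹ • eb i) (n+1) f ω := by
  obtain ⟨D, hD0, hD⟩ := Js_inv (n := n) (n+1) c C hc
  set A := 4 ^ (n+1) * D with hA
  have hA0 : 0 ≤ A := by positivity
  refine ⟨(2 * (A + 1)) ^ (n+1), by positivity, ?_⟩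
  intro x y l κ hl hκ f hf hcs hs
  obtain ⟨i, hi⟩ := hψ.2 x y
  refine ⟨i, ?_⟩
  have hκ0 : 0 < κ := by linarith
  set d := ‖x - y‖ with hd
  have hd0 : 0 ≤ d := norm_nonneg _
  set T := l / κ * d with hT
  have hT0 : 0 ≤ T := by positivity
  have hI0 : 0 ≤ ∫ ω, Js (κ⁻¹ • eb i) (n+1) f ω := integral_nonneg fun _ => Js_nonneg _ _ _ _
  have hJint := Js_integrable (κ⁻¹ • eb i) (n+1) hf hcs
  have hw : wt (l / κ) (x - y) = ((1 + T) ^ (n+1))⁻¹ := rfl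
  rw [hw]
  by_cases hTc : T ≤ 1
  · have h1 : ‖∫ ω, Complex.exp (Complex.I * ((l * (ψ x ω - ψ y ω) : ℝ) : ℂ)) * f ω‖ ≤
        ∫ ω, Js (κ⁻¹ • eb i) (n+1) f ω := by
      refine (norm_integral_le_integral_norm _).trans ?_
      refine integral_mono_of_nonneg (Filter.Eventually.of_forall fun _ => norm_nonneg _) hJint
        (Filter.Eventually.of_forall fun ω => ?_)
      simp only
      rw [norm_mul, mul_comm Complex.I, Complex.norm_exp_ofReal_mul_I, one_mul]
      exact norm_le_Js _ _ _ _
    refine h1.trans (le_mul_of_one_le_left hI0 ?_)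
    rw [← div_eq_mul_inv, one_le_div (by positivity)]
    gcongr
    linarith
  · push Not at hTc
    have hdpos : 0 < d := by
      rcases hd0.eq_or_lt with h | h
      · rw [hT, ← h] at hTc; norm_num at hTc
      · exact h
    set θ : En n → ℝ := fun ω => d⁻¹ * (ψ x ω - ψ y ω) with hθ
    have hθ' : (fun ω => (θ ω : ℂ)) = fun ω => (d⁻¹ : ℂ) * ((ψ x ω - ψ y ω : ℝ) : ℂ) := by
      funext ω; simp [hθ]
    have hsm : ContDiffOn ℝ (⊤ : ℕ∞) (fun ω => ((ψ x ω - ψ y ω : ℝ) : ℂ)) Ω := by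
      simp only [Complex.ofReal_sub]
      exact (hψ.1 x).sub (hψ.1 y)
    have hθs : ContDiffOn ℝ (⊤ : ℕ∞) (fun ω => (θ ω : ℂ)) Ω := by
      rw [hθ']; exact contDiffOn_const.mul hsm
    set q := dv (eb i) (fun ω => (θ ω : ℂ)) with hq
    have hqd : q = fun ω => (d⁻¹ : ℂ) * dv (eb i) (fun ω => ((ψ x ω - ψ y ω : ℝ) : ℂ)) ω := by
      rw [hq, hθ']
      funext z
      have := fderiv_const_smul_field (𝕜 := ℝ) (R := ℂ) (d⁻¹ : ℂ)
        (f := fun ω => ((ψ x ω - ψ y ω : ℝ) : ℂ))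
      have h5 := congrFun this z
      simp only [dv]
      change fderiv ℝ ((d⁻¹ : ℂ) • fun ω => ((ψ x ω - ψ y ω : ℝ) : ℂ)) z _ = _
      rw [h5]; simp
    have hnd : ‖(d⁻¹ : ℂ)‖ = d⁻¹ := by
      rw [norm_inv, Complex.norm_real, Real.norm_of_nonneg hd0]
    have hqs : ContDiffOn ℝ (⊤ : ℕ∞) q Ω := dv_contDiffOn hΩ _ hθs
    have hq1 : ∀ ω ∈ Ω, c ≤ ‖q ω‖ := by
      intro ω hω
      rw [hqd]
      simp only
      rw [norm_mul, hnd]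
      have := (hi ω hω).1
      rw [inv_mul_eq_div, le_div_iff₀ hdpos]; exact this
    have hq2 : ∀ ω ∈ Ω, Js (eb i) (n+1) q ω ≤ C := by
      intro ω hω
      rw [hqd, Js_const_mul, hnd, inv_mul_eq_div, div_le_iff₀ hdpos]
      exact (hi ω hω).2
    have hu := hD Ω (eb i) q hΩ hqs hq1 hq2
    have hq0 : ∀ y ∈ Ω, q y ≠ 0 := fun y hy => by
      have := hq1 y hy
      intro h; rw [h, norm_zero] at this; linarith
    have hM : 0 < l * d := by positivity
    have main := ibp_main hΩ (θ := θ) (e := eb i) (u := fun y => (q y)⁻¹) hθs (hqs.inv hq0)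
      (fun ω hω => inv_mul_cancel₀ (hq0 ω hω)) hκ0 hM (n+1) hD0
      (fun ω hω => (Js_smul_le _ _ (by positivity) (inv_le_one_of_one_le₀ hκ) _ _ _).trans
        (hu ω hω)) (n+1) le_rfl f hf hcs hs
    have e1 : ∀ ω, l * d * θ ω = l * (ψ x ω - ψ y ω) := by
      intro ω; simp only [hθ]; field_simp
    simp only [e1] at main
    refine main.trans (mul_le_mul_of_nonneg_right ?_ hI0)
    rw [← inv_pow, ← mul_pow]
    have e2 : κ / (l * d) = T⁻¹ := by rw [hT]; field_simp
    rw [e2]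
    have hTp : 0 < T := by linarith
    refine pow_le_pow_left₀ (by positivity) ?_ _
    rw [← hA, ← div_eq_mul_inv, ← div_eq_mul_inv, div_le_div_iff₀ hTp (by linarith)]
    nlinarith

lemma kernel_bound {Ω : Set (En n)} (hΩ : IsOpen Ω) {ψ : En n → En n → ℝ} {c C : ℝ} (hc : 0 < c)
    (hψ : PH Ω ψ (n+1) c C) : ∃ K : ℝ, 0 ≤ K ∧ ∀ (x y : En n) (l κ : ℝ), 0 < l → 1 ≤ κ →
    ∀ F G : En n → ℂ, ContDiff ℝ (⊤ : ℕ∞) F → HasCompactSupport F → tsupport F ⊆ Ω →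
    ContDiff ℝ (⊤ : ℕ∞) G →
    ‖∫ ω, Complex.exp (Complex.I * ((l * (ψ x ω - ψ y ω) : ℝ) : ℂ)) *
        (F ω * (starRingEnd ℂ) (G ω))‖ₑ ≤
      ENNReal.ofReal (K * wt (l / κ) (x - y)) *
        ∫⁻ ω, ENNReal.ofReal (Jt κ (n+1) F ω) * ENNReal.ofReal (Jt κ (n+1) G ω) := by
  obtain ⟨K, hK0, hK⟩ := osc_bound hΩ hc hψ
  refine ⟨K * 4 ^ (n+1), by positivity, ?_⟩
  intro x y l κ hl hκ F G hF hFc hFs hG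
  have hGc : ContDiff ℝ (⊤ : ℕ∞) (fun y => (starRingEnd ℂ) (G y)) := by
    rw [← contDiffOn_univ]; exact contDiff_conj hG.contDiffOn
  have hf := hF.mul hGc
  have hfc : HasCompactSupport (fun ω => F ω * (starRingEnd ℂ) (G ω)) :=
    hFc.of_isClosed_subset (isClosed_tsupport _) tsupport_mul_sub
  obtain ⟨i, hi⟩ := hK x y l κ hl hκ _ hf hfc (tsupport_mul_sub.trans hFs)
  have hw : 0 ≤ wt (l / κ) (x - y) := by unfold wt; positivity
  rw [← ofReal_norm]
  refine (ENNReal.ofReal_le_ofReal hi).trans ?_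
  rw [ENNReal.ofReal_mul (by positivity)]
  rw [ofReal_integral_eq_lintegral_ofReal (Js_integrable _ _ hf hfc)
    (Filter.Eventually.of_forall fun _ => Js_nonneg _ _ _ _)]
  have e1 : K * 4 ^ (n+1) * wt (l / κ) (x - y) = (K * wt (l/κ) (x-y)) * 4 ^ (n+1) := by ring
  rw [e1, ENNReal.ofReal_mul (p := K * wt (l/κ) (x-y)) (by positivity), mul_assoc]
  refine mul_le_mul_right ?_ _
  rw [← lintegral_const_mul' _ _ ENNReal.ofReal_ne_top]
  refine lintegral_mono fun ω => ?_
  simp only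
  rw [← ENNReal.ofReal_mul (Jt_nonneg _ _ _ _), ← ENNReal.ofReal_mul (by positivity)]
  refine ENNReal.ofReal_le_ofReal ?_
  refine (Js_mul isOpen_univ _ _ hF.contDiffOn hGc.contDiffOn ω (Set.mem_univ _)).trans ?_
  rw [Js_conj]
  gcongr
  · exact Js_nonneg _ _ _ _
  · exact Jt_nonneg _ _ _ _
  · exact Js_le_Jt _ _ _ _ _
  · exact Js_le_Jt _ _ _ _ _

end kernel

section SS
variable {n : ℕ}

lemma wt_cont (s : ℝ) (hs : 0 ≤ s) : Continuous (wt (n := n) s) := by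
  unfold wt
  refine Continuous.inv₀ (by fun_prop) fun x => ?_
  positivity

lemma wt_lintegral : ∃ K0 : ℝ, 0 ≤ K0 ∧ ∀ s : ℝ, 0 < s →
    ∫⁻ z : En n, ENNReal.ofReal (wt s z) ≤ ENNReal.ofReal (K0 * (s⁻¹) ^ n) := by
  have h1 : Integrable (fun z : En n => (1 + ‖z‖) ^ (-((n:ℝ)+1))) :=
    integrable_one_add_norm (by simp)
  have h2 : (fun z : En n => (1 + ‖z‖) ^ (-((n:ℝ)+1))) = wt 1 := by
    funext z
    unfold wt
    rw [Real.rpow_neg (by positivity), one_mul]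
    congr 1
    exact_mod_cast Real.rpow_natCast (1 + ‖z‖) (n+1)
  rw [h2] at h1
  refine ⟨∫ z : En n, wt 1 z, integral_nonneg fun z => by unfold wt; positivity, ?_⟩
  intro s hs
  have h3 : ∀ z : En n, wt s z = wt 1 (s • z) := by
    intro z; unfold wt; rw [norm_smul, Real.norm_of_nonneg hs.le, one_mul]
  have h4 : Integrable (fun z : En n => wt 1 (s • z)) := (integrable_comp_smul_iff volume _ hs.ne').2 h1
  simp only [h3]
  rw [← ofReal_integral_eq_lintegral_ofReal h4
    (Filter.Eventually.of_forall fun z => by simp only [wt, Pi.zero_apply]; positivity)]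
  apply ENNReal.ofReal_le_ofReal
  rw [Measure.integral_comp_smul]
  simp only [finrank_euclideanSpace, Fintype.card_fin, smul_eq_mul]
  rw [abs_of_nonneg (by positivity), inv_pow, mul_comm]

lemma schur_conv (w b : En n → ℝ≥0∞) (hw : Measurable w) (hb : Measurable b) :
    ∫⁻ x, ∫⁻ y, w (x - y) * (b x * b y) ≤ 2 * (∫⁻ z, w z) * ∫⁻ x, b x ^ 2 := by
  have h1 : ∀ x y, w (x - y) * (b x * b y) ≤ w (x-y) * b x ^ 2 + w (x-y) * b y ^ 2 := by
    intro x y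
    rw [← mul_add]
    gcongr
    rcases le_total (b x) (b y) with h | h
    · refine le_trans ?_ le_add_self
      rw [sq]; gcongr
    · refine le_trans ?_ le_self_add
      rw [sq]; gcongr
  have hm1 : Measurable (fun p : En n × En n => w (p.1 - p.2) * b p.1 ^ 2) := by fun_prop
  have hm2 : Measurable (fun p : En n × En n => w (p.1 - p.2) * b p.2 ^ 2) := by fun_prop
  calc ∫⁻ x, ∫⁻ y, w (x - y) * (b x * b y)
      ≤ ∫⁻ x, ∫⁻ y, (w (x-y) * b x ^ 2 + w (x-y) * b y ^ 2) :=
        lintegral_mono fun x => lintegral_mono fun y => h1 x y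
    _ = (∫⁻ x, ∫⁻ y, w (x-y) * b x ^ 2) + ∫⁻ x, ∫⁻ y, w (x-y) * b y ^ 2 := by
        rw [← lintegral_add_left hm1.lintegral_prod_right']
        refine lintegral_congr fun x => ?_
        exact lintegral_add_left (hm1.comp measurable_prodMk_left) _
    _ = (∫⁻ x, ∫⁻ y, w (x-y) * b x ^ 2) + ∫⁻ y, ∫⁻ x, w (x-y) * b y ^ 2 := by
        congr 1
        exact lintegral_lintegral_swap hm2.aemeasurable
    _ = (∫⁻ x, (∫⁻ z, w z) * b x ^ 2) + ∫⁻ y, (∫⁻ z, w z) * b y ^ 2 := by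
        congr 1
        · refine lintegral_congr fun x => ?_
          rw [lintegral_mul_const _ (by fun_prop), lintegral_sub_left_eq_self w x]
        · refine lintegral_congr fun y => ?_
          rw [lintegral_mul_const _ (by fun_prop), lintegral_sub_right_eq_self w y]
    _ = 2 * (∫⁻ z, w z) * ∫⁻ x, b x ^ 2 := by
        rw [lintegral_const_mul _ (by fun_prop)]; ring

lemma TT_abs (P : En n → En n → ℂ) (hPm : Measurable (fun q : En n × En n => P q.1 q.2))
    (hfin : ∫⁻ ω, (∫⁻ x, ‖P x ω‖ₑ) ^ 2 ≠ ∞) :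
    ∫⁻ ω, ‖∫ x, P x ω‖ₑ ^ 2 ≤
      ∫⁻ q : En n × En n, ‖∫ ω, P q.1 ω * (starRingEnd ℂ) (P q.2 ω)‖ₑ
        ∂((volume : Measure (En n)).prod volume) := by
  have hm1 : Measurable (fun q : En n × En n × En n => P q.2.1 q.1) :=
    hPm.comp (measurable_snd.fst.prodMk measurable_fst)
  have hm2 : Measurable (fun q : En n × En n × En n => P q.2.2 q.1) :=
    hPm.comp (measurable_snd.snd.prodMk measurable_fst)
  have hQm : Measurable (fun q : En n × En n × En n => P q.2.1 q.1 * (starRingEnd ℂ) (P q.2.2 q.1)) :=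
    hm1.mul (Complex.continuous_conj.measurable.comp hm2)
  have hQi : Integrable (fun q : En n × En n × En n => P q.2.1 q.1 * (starRingEnd ℂ) (P q.2.2 q.1))
      ((volume : Measure (En n)).prod ((volume : Measure (En n)).prod volume)) := by
    refine ⟨hQm.aestronglyMeasurable, ?_⟩
    rw [hasFiniteIntegral_iff_enorm]
    rw [lintegral_prod _ hQm.enorm.aemeasurable]
    refine lt_of_le_of_lt (le_of_eq ?_) (lt_top_iff_ne_top.2 hfin)
    refine lintegral_congr fun ω => ?_
    simp only [enorm_mul, RCLike.enorm_conj]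
    rw [lintegral_prod_mul (f := fun x => ‖P x ω‖ₑ) (g := fun x => ‖P x ω‖ₑ)]
    · rw [sq]
    · exact (hPm.comp measurable_prodMk_right).enorm.aemeasurable
    · exact (hPm.comp measurable_prodMk_right).enorm.aemeasurable
  have hV : ∀ ω, ∫ q : En n × En n, P q.1 ω * (starRingEnd ℂ) (P q.2 ω)
      ∂((volume : Measure (En n)).prod volume) = ((‖∫ x, P x ω‖ ^ 2 : ℝ) : ℂ) := by
    intro ω
    rw [integral_prod_mul (fun x => P x ω) (fun x => (starRingEnd ℂ) (P x ω)), integral_conj,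
      Complex.mul_conj, Complex.normSq_eq_norm_sq]
  have hVi : Integrable (fun ω => ((‖∫ x, P x ω‖ ^ 2 : ℝ) : ℂ)) := by
    have := hQi.integral_prod_left
    simp only [hV] at this
    exact this
  have hVr : Integrable (fun ω => (‖∫ x, P x ω‖ ^ 2 : ℝ)) := by
    have := hVi.norm
    refine this.congr (Filter.Eventually.of_forall fun ω => ?_)
    simp only [Complex.norm_real]
    exact Real.norm_of_nonneg (by positivity)
  have step1 : ∫⁻ ω, ‖∫ x, P x ω‖ₑ ^ 2 = ‖∫ ω, ((‖∫ x, P x ω‖ ^ 2 : ℝ) : ℂ)‖ₑ := by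
    have e0 : ∫ ω, ((‖∫ x, P x ω‖ ^ 2 : ℝ) : ℂ) = ((∫ ω, ‖∫ x, P x ω‖ ^ 2 : ℝ) : ℂ) := integral_ofReal
    rw [e0, ← ofReal_norm, Complex.norm_real, Real.norm_eq_abs, abs_of_nonneg
      (integral_nonneg fun ω => by positivity),
      ofReal_integral_eq_lintegral_ofReal hVr (Filter.Eventually.of_forall fun ω => by
        simp only [Pi.zero_apply]; positivity)]
    refine lintegral_congr fun ω => ?_
    rw [ENNReal.ofReal_pow (norm_nonneg _), ofReal_norm]
  have step2 : ∫ ω, ((‖∫ x, P x ω‖ ^ 2 : ℝ) : ℂ) =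
      ∫ q : En n × En n, ∫ ω, P q.1 ω * (starRingEnd ℂ) (P q.2 ω) ∂volume
        ∂((volume : Measure (En n)).prod volume) := by
    rw [← integral_integral_swap hQi]
    simp only [hV]
  rw [step1, step2]
  exact enorm_integral_le_lintegral_enorm _

lemma schur_big (w : En n → ℝ≥0∞) (hwm : Measurable w) (b : En n → En n → ℝ≥0∞)
    (hbm : Measurable (fun q : En n × En n => b q.1 q.2)) :
    ∫⁻ q : En n × En n, ∫⁻ ω, w (q.1 - q.2) * (b ω q.1 * b ω q.2) ∂volume
      ∂((volume : Measure (En n)).prod volume) ≤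
      2 * (∫⁻ z, w z) * ∫⁻ x, ∫⁻ ω, b ω x ^ 2 := by
  have hbig : Measurable (fun p : (En n × En n) × En n =>
      w (p.1.1 - p.1.2) * (b p.2 p.1.1 * b p.2 p.1.2)) := by
    refine (hwm.comp (measurable_fst.fst.sub measurable_fst.snd)).mul ?_
    exact (hbm.comp (measurable_snd.prodMk measurable_fst.fst)).mul
      (hbm.comp (measurable_snd.prodMk measurable_fst.snd))
  have hb2 : Measurable (fun q : En n × En n => b q.1 q.2 ^ 2) := hbm.pow_const 2
  rw [lintegral_lintegral_swap hbig.aemeasurable]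
  calc _ ≤ ∫⁻ ω, (2 * (∫⁻ z, w z)) * ∫⁻ x, b ω x ^ 2 := by
        refine lintegral_mono fun ω => ?_
        have hh : Measurable (fun p : En n × En n => w (p.1 - p.2) * (b ω p.1 * b ω p.2)) :=
          hbig.comp measurable_prodMk_right
        rw [lintegral_prod _ hh.aemeasurable]
        exact schur_conv w (b ω) hwm (hbm.comp measurable_prodMk_left)
    _ = _ := by
        rw [lintegral_const_mul _ hb2.lintegral_prod_right', lintegral_lintegral_swap hb2.aemeasurable]

lemma SS {Ω : Set (En n)} (hΩ : IsOpen Ω) {ψ : En n → En n → ℝ} {c C : ℝ} (hc : 0 < c)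
    (hψ : PH Ω ψ (n+1) c C) (hψm : Measurable (fun q : En n × En n => ψ q.1 q.2)) :
    ∃ K : ℝ, 0 ≤ K ∧ ∀ (l κ : ℝ), 0 < l → 1 ≤ κ →
    ∀ (F : En n → En n → ℂ) (B : En n → En n → ℝ≥0∞) (g : En n → ℂ),
    Measurable (fun q : En n × En n => F q.1 q.2) →
    Measurable (fun q : En n × En n => B q.1 q.2) → Measurable g →
    (∀ x, ContDiff ℝ (⊤ : ℕ∞) (F x)) → (∀ x, HasCompactSupport (F x)) →
    (∀ x, tsupport (F x) ⊆ Ω) → (∀ x ω, ENNReal.ofReal (Jt κ (n+1) (F x) ω) ≤ B x ω) →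
    (∫⁻ ω, (∫⁻ x, ‖F x ω‖ₑ * ‖g x‖ₑ) ^ 2 ≠ ∞) →
    ∫⁻ ω, ‖∫ x, Complex.exp (Complex.I * ((l * ψ x ω : ℝ) : ℂ)) * F x ω * g x‖ₑ ^ 2 ≤
      ENNReal.ofReal (K * (κ / l) ^ n) * ∫⁻ x, (∫⁻ ω, B x ω ^ 2) * ‖g x‖ₑ ^ 2 := by
  obtain ⟨K, hK0, hK⟩ := kernel_bound hΩ hc hψ
  obtain ⟨K1, hK10, hK1⟩ := wt_lintegral (n := n)
  refine ⟨K * (2 * K1), by positivity, ?_⟩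
  intro l κ hl hκ F B g hF hB hg hFs hFc hFt hFB hfin
  have hκ0 : 0 < κ := by linarith
  have hPm : Measurable (fun q : En n × En n =>
      Complex.exp (Complex.I * ((l * ψ q.1 q.2 : ℝ) : ℂ)) * F q.1 q.2 * g q.1) := by
    refine ((Measurable.cexp ?_).mul hF).mul (hg.comp measurable_fst)
    refine measurable_const.mul ?_
    exact Complex.measurable_ofReal.comp (measurable_const.mul hψm)
  have hPn : ∀ x ω, ‖Complex.exp (Complex.I * ((l * ψ x ω : ℝ) : ℂ)) * F x ω * g x‖ₑ =
      ‖F x ω‖ₑ * ‖g x‖ₑ := by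
    intro x ω
    rw [enorm_mul, enorm_mul]
    have : ‖Complex.exp (Complex.I * ((l * ψ x ω : ℝ) : ℂ))‖ₑ = 1 := by
      rw [← ofReal_norm, mul_comm Complex.I, Complex.norm_exp_ofReal_mul_I]; simp
    rw [this, one_mul]
  have hs0 : 0 < l / κ := by positivity
  have hwm : Measurable (fun z : En n => ENNReal.ofReal (wt (l/κ) z)) :=
    ENNReal.measurable_ofReal.comp (wt_cont _ hs0.le).measurable
  have hbm : Measurable (fun q : En n × En n => B q.2 q.1 * ‖g q.2‖ₑ) :=
    (hB.comp measurable_swap).mul (hg.comp measurable_snd).enorm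
  have h1 := TT_abs (fun x ω => Complex.exp (Complex.I * ((l * ψ x ω : ℝ) : ℂ)) * F x ω * g x)
    hPm (by simp only [hPn]; exact hfin)
  have h2 := schur_big (fun z : En n => ENNReal.ofReal (wt (l/κ) z)) hwm
    (fun ω x => B x ω * ‖g x‖ₑ) hbm
  refine h1.trans ?_
  have step3 : ∀ q : En n × En n, ‖∫ ω, Complex.exp (Complex.I * ((l * ψ q.1 ω : ℝ) : ℂ)) *
        F q.1 ω * g q.1 * (starRingEnd ℂ) (Complex.exp (Complex.I * ((l * ψ q.2 ω : ℝ) : ℂ)) *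
        F q.2 ω * g q.2)‖ₑ ≤
      ENNReal.ofReal K * ∫⁻ ω, ENNReal.ofReal (wt (l/κ) (q.1 - q.2)) *
        ((B q.1 ω * ‖g q.1‖ₑ) * (B q.2 ω * ‖g q.2‖ₑ)) := by
    rintro ⟨x, y⟩
    have e1 : ∀ ω, Complex.exp (Complex.I * ((l * ψ x ω : ℝ) : ℂ)) *
        F x ω * g x * (starRingEnd ℂ) (Complex.exp (Complex.I * ((l * ψ y ω : ℝ) : ℂ)) *
        F y ω * g y) = (g x * (starRingEnd ℂ) (g y)) *
        (Complex.exp (Complex.I * ((l * (ψ x ω - ψ y ω) : ℝ) : ℂ)) *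
          (F x ω * (starRingEnd ℂ) (F y ω))) := by
      intro ω
      have e2 : Complex.exp (Complex.I * ((l * (ψ x ω - ψ y ω) : ℝ) : ℂ)) =
        Complex.exp (Complex.I * ((l * ψ x ω : ℝ) : ℂ)) *
          (starRingEnd ℂ) (Complex.exp (Complex.I * ((l * ψ y ω : ℝ) : ℂ))) := by
        rw [← Complex.exp_conj, ← Complex.exp_add]
        congr 1
        simp only [map_mul, Complex.conj_I, Complex.conj_ofReal]
        push_cast; ring
      rw [e2]
      simp only [map_mul]; ring
    simp only [e1]
    rw [integral_const_mul, enorm_mul, enorm_mul, RCLike.enorm_conj]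
    refine (mul_le_mul_right (hK x y l κ hl hκ _ _ (hFs _) (hFc _) (hFt _) (hFs _)) _).trans ?_
    rw [ENNReal.ofReal_mul hK0]
    have e3 : ∫⁻ ω, ENNReal.ofReal (Jt κ (n+1) (F x) ω) * ENNReal.ofReal (Jt κ (n+1) (F y) ω) ≤
        ∫⁻ ω, B x ω * B y ω := lintegral_mono fun ω => mul_le_mul' (hFB _ _) (hFB _ _)
    have hmB : Measurable (fun ω => B x ω * B y ω) :=
      (hB.comp measurable_prodMk_left).mul (hB.comp measurable_prodMk_left)
    have e4 : ∫⁻ ω, ENNReal.ofReal (wt (l/κ) (x - y)) *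
        ((B x ω * ‖g x‖ₑ) * (B y ω * ‖g y‖ₑ)) =
        (ENNReal.ofReal (wt (l/κ) (x - y)) * (‖g x‖ₑ * ‖g y‖ₑ)) * ∫⁻ ω, B x ω * B y ω := by
      rw [← lintegral_const_mul _ hmB]
      refine lintegral_congr fun ω => ?_
      ring
    rw [e4]
    calc _ ≤ ‖g x‖ₑ * ‖g y‖ₑ * (ENNReal.ofReal K * ENNReal.ofReal (wt (l / κ) (x - y)) *
          ∫⁻ ω, B x ω * B y ω) := by gcongr
      _ = _ := by ring
  refine (lintegral_mono step3).trans ?_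
  rw [lintegral_const_mul' _ _ ENNReal.ofReal_ne_top]
  refine (mul_le_mul_right h2 _).trans ?_
  have e5 : ∀ x, ∫⁻ ω, (B x ω * ‖g x‖ₑ) ^ 2 = (∫⁻ ω, B x ω ^ 2) * ‖g x‖ₑ ^ 2 := by
    intro x
    simp only [mul_pow]
    have hh : Measurable (fun ω => B x ω ^ 2) := (hB.comp measurable_prodMk_left).pow_const 2
    rw [lintegral_mul_const _ hh]
  simp only [e5]
  rw [← mul_assoc]
  refine mul_le_mul_left ?_ _
  calc _ ≤ ENNReal.ofReal K * (2 * ENNReal.ofReal (K1 * ((l/κ)⁻¹) ^ n)) := by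
        gcongr; exact hK1 _ hs0
    _ = _ := by
        rw [inv_div, show (2:ℝ≥0∞) = ENNReal.ofReal 2 by simp, ← ENNReal.ofReal_mul (by norm_num),
          ← ENNReal.ofReal_mul hK0]
        congr 1; ring

end SS

section Dual
variable {n : ℕ}

lemma CS_sq (μ : Measure (En n)) (f g : En n → ℝ≥0∞) (hf : AEMeasurable f μ) (hg : AEMeasurable g μ) :
    (∫⁻ x, f x * g x ∂μ) ^ 2 ≤ (∫⁻ x, f x ^ 2 ∂μ) * ∫⁻ x, g x ^ 2 ∂μ := by
  have h := ENNReal.lintegral_mul_le_Lp_mul_Lq μ (p := 2) (q := 2) Real.HolderConjugate.two_two hf hg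
  have h2 := pow_le_pow_left' h 2
  refine h2.trans (le_of_eq ?_)
  rw [mul_pow]
  congr 1 <;>
  · rw [← ENNReal.rpow_natCast, ← ENNReal.rpow_mul]
    norm_num

lemma self_bound {X Y : ℝ≥0∞} (hX : X ≠ ∞) (h : X ^ 2 ≤ Y * X) : X ≤ Y := by
  by_cases h0 : X = 0
  · simp [h0]
  · rw [sq] at h
    exact (ENNReal.mul_le_mul_iff_left h0 hX).1 h

lemma dual_est (G : En n → En n → ℂ) (B : En n → En n → ℝ≥0∞)
    (hG : Measurable (fun q : En n × En n => G q.1 q.2))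
    (hB : Measurable (fun q : En n × En n => B q.1 q.2))
    (hGB : ∀ x ω, ‖G x ω‖ₑ ≤ B x ω) (K : ℝ≥0∞)
    (hK : ∀ g : En n → ℂ, Measurable g → (∫⁻ ω, (∫⁻ x, ‖G x ω‖ₑ * ‖g x‖ₑ) ^ 2 ≠ ∞) →
      ∫⁻ ω, ‖∫ x, G x ω * g x‖ₑ ^ 2 ≤ K * ∫⁻ x, (∫⁻ ω, B x ω ^ 2) * ‖g x‖ₑ ^ 2)
    (h : En n → ℂ) (hh : Measurable h) (hH : ∫⁻ ω, ‖h ω‖ₑ ^ 2 ≠ ∞) :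
    ∫⁻ x, ‖∫ ω, G x ω * h ω‖ₑ ^ 2 * (∫⁻ ω, B x ω ^ 2)⁻¹ ≤ K * ∫⁻ ω, ‖h ω‖ₑ ^ 2 := by
  set H := ∫⁻ ω, ‖h ω‖ₑ ^ 2 with hHd
  set A2 : En n → ℝ≥0∞ := fun x => ∫⁻ ω, B x ω ^ 2 with hA2
  set T : En n → ℂ := fun x => ∫ ω, G x ω * h ω with hT
  have hA2m : Measurable A2 := (hB.pow_const 2).lintegral_prod_right'
  have hGh : Measurable (fun q : En n × En n => G q.1 q.2 * h q.2) := hG.mul (hh.comp measurable_snd)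
  have hTm : Measurable T :=
    (StronglyMeasurable.integral_prod_right' (f := fun q : En n × En n => G q.1 q.2 * h q.2)
      hGh.stronglyMeasurable).measurable
  have hBh : ∀ x, (∫⁻ ω, B x ω * ‖h ω‖ₑ) ^ 2 ≤ A2 x * H := fun x =>
    CS_sq _ _ _ (hB.comp measurable_prodMk_left).aemeasurable hh.enorm.aemeasurable
  have hTb : ∀ x, ‖T x‖ₑ ^ 2 ≤ A2 x * H := by
    intro x
    refine le_trans (pow_le_pow_left' ?_ 2) (hBh x)
    refine (enorm_integral_le_lintegral_enorm _).trans (lintegral_mono fun ω => ?_)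
    rw [enorm_mul]
    exact mul_le_mul_left (hGB _ _) _
  -- truncated sets
  set D : ℕ → Set (En n) := fun k => Metric.closedBall 0 k ∩ {x | ((k : ℝ≥0∞) + 1)⁻¹ ≤ A2 x} ∩
    {x | A2 x ≤ k} with hD
  have hDm : ∀ k, MeasurableSet (D k) := fun k =>
    (measurableSet_closedBall.inter (measurableSet_le measurable_const hA2m)).inter
      (measurableSet_le hA2m measurable_const)
  have hDv : ∀ k, volume (D k) < ∞ := fun k =>
    lt_of_le_of_lt (measure_mono (Set.inter_subset_left.trans Set.inter_subset_left))
      measure_closedBall_lt_top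
  have hA20 : ∀ k, ∀ x ∈ D k, A2 x ≠ 0 := by
    intro k x hx h0
    have := hx.1.2
    simp only [Set.mem_setOf_eq, h0, nonpos_iff_eq_zero] at this
    exact ENNReal.inv_ne_zero.2 (by finiteness) this
  have hA2t : ∀ k, ∀ x ∈ D k, A2 x ≠ ∞ := by
    intro k x hx h0
    have := hx.2
    simp only [Set.mem_setOf_eq, h0] at this
    simp at this
  have main : ∀ k, ∫⁻ x in D k, ‖T x‖ₑ ^ 2 * (A2 x)⁻¹ ≤ K * H := by
    intro k
    set g : En n → ℂ := (D k).indicator fun x => ((A2 x).toReal⁻¹ : ℂ) * (starRingEnd ℂ) (T x) with hg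
    have hgm : Measurable g := by
      refine Measurable.indicator ?_ (hDm k)
      exact (Complex.measurable_ofReal.comp hA2m.ennreal_toReal).inv.mul
        (Complex.continuous_conj.measurable.comp hTm)
    have hgn : ∀ x, ‖g x‖ₑ = (D k).indicator (fun x => (A2 x)⁻¹ * ‖T x‖ₑ) x := by
      intro x
      by_cases hx : x ∈ D k
      · simp only [hg, Set.indicator_of_mem hx]
        rw [enorm_mul, RCLike.enorm_conj]
        congr 1
        rw [← Complex.ofReal_inv, ← ofReal_norm, Complex.norm_real, Real.norm_of_nonneg (by positivity),
          ENNReal.ofReal_inv_of_pos (ENNReal.toReal_pos (hA20 k x hx) (hA2t k x hx)),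
          ENNReal.ofReal_toReal (hA2t k x hx)]
      · simp [hg, hx]
    set X := ∫⁻ x in D k, ‖T x‖ₑ ^ 2 * (A2 x)⁻¹ with hX
    have hXt : X ≠ ∞ := by
      refine ne_of_lt (lt_of_le_of_lt (b := ∫⁻ x in D k, H) ?_ ?_)
      · refine setLIntegral_mono' (hDm k) fun x hx => ?_
        rw [← div_eq_mul_inv]
        refine ENNReal.div_le_of_le_mul ?_
        rw [mul_comm]; exact hTb x
      · rw [setLIntegral_const]; exact ENNReal.mul_lt_top (lt_top_iff_ne_top.2 hH) (hDv k)
    have hXg : ∫⁻ x, A2 x * ‖g x‖ₑ ^ 2 = X := by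
      rw [hX, ← lintegral_indicator (hDm k)]
      refine lintegral_congr fun x => ?_
      rw [hgn]
      by_cases hx : x ∈ D k
      · simp only [Set.indicator_of_mem hx]
        have := ENNReal.mul_inv_cancel (hA20 k x hx) (hA2t k x hx)
        calc A2 x * ((A2 x)⁻¹ * ‖T x‖ₑ) ^ 2 = (A2 x * (A2 x)⁻¹) * (‖T x‖ₑ ^ 2 * (A2 x)⁻¹) := by ring
          _ = _ := by rw [this, one_mul]
      · simp [hx]
    have hinvk : ∀ x ∈ D k, (A2 x)⁻¹ ≤ (k : ℝ≥0∞) + 1 := by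
      intro x hx
      rw [ENNReal.inv_le_iff_inv_le]; exact hx.1.2
    -- L2 norm of g
    have hg2 : ∫⁻ x, ‖g x‖ₑ ^ 2 ≠ ∞ := by
      refine ne_of_lt (lt_of_le_of_lt (b := ∫⁻ x, ((k : ℝ≥0∞) + 1) * (A2 x * ‖g x‖ₑ ^ 2)) ?_ ?_)
      · refine lintegral_mono fun x => ?_
        by_cases hx : x ∈ D k
        · calc ‖g x‖ₑ ^ 2 = ((A2 x)⁻¹ * A2 x) * ‖g x‖ₑ ^ 2 := by
                rw [ENNReal.inv_mul_cancel (hA20 k x hx) (hA2t k x hx), one_mul]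
            _ ≤ (((k : ℝ≥0∞) + 1) * A2 x) * ‖g x‖ₑ ^ 2 := by gcongr; exact hinvk x hx
            _ = _ := by ring
        · simp [hgn, hx]
      · rw [lintegral_const_mul' _ _ (by finiteness), hXg]
        exact ENNReal.mul_lt_top (by finiteness) (lt_top_iff_ne_top.2 hXt)
    have hA2int : ∫⁻ x in D k, A2 x < ∞ := by
      refine lt_of_le_of_lt (b := ∫⁻ x in D k, (k : ℝ≥0∞)) ?_ ?_
      · exact setLIntegral_mono' (hDm k) fun x hx => hx.2
      · rw [setLIntegral_const]; exact ENNReal.mul_lt_top (by finiteness) (hDv k)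
    have hfin : ∫⁻ ω, (∫⁻ x, ‖G x ω‖ₑ * ‖g x‖ₑ) ^ 2 ≠ ∞ := by
      refine ne_of_lt (lt_of_le_of_lt
        (b := ∫⁻ ω, (∫⁻ x in D k, B x ω ^ 2) * ∫⁻ x, ‖g x‖ₑ ^ 2) ?_ ?_)
      · refine lintegral_mono fun ω => ?_
        have e1 : ∫⁻ x, ‖G x ω‖ₑ * ‖g x‖ₑ ≤ ∫⁻ x in D k, B x ω * ‖g x‖ₑ := by
          rw [← lintegral_indicator (hDm k)]
          refine lintegral_mono fun x => ?_
          by_cases hx : x ∈ D k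
          · simp only [Set.indicator_of_mem hx]; exact mul_le_mul_left (hGB _ _) _
          · simp [hgn, hx]
        refine (pow_le_pow_left' e1 2).trans ?_
        refine (CS_sq _ _ _ (hB.comp measurable_prodMk_right).aemeasurable
          hgm.enorm.aemeasurable).trans ?_
        exact mul_le_mul_right (setLIntegral_le_lintegral _ _) _
      · rw [lintegral_mul_const' _ _ hg2]
        refine ENNReal.mul_lt_top ?_ (lt_top_iff_ne_top.2 hg2)
        have hm : Measurable (fun q : En n × En n => B q.2 q.1 ^ 2) :=
          (hB.comp measurable_swap).pow_const 2
        rw [lintegral_lintegral_swap (f := fun ω x => B x ω ^ 2) hm.aemeasurable]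
        exact hA2int
    have hS := hK g hgm hfin
    rw [hXg] at hS
    have hFub : Integrable (fun q : En n × En n => G q.1 q.2 * h q.2 * g q.1)
        ((volume : Measure (En n)).prod volume) := by
      have hm : Measurable (fun q : En n × En n => G q.1 q.2 * h q.2 * g q.1) :=
        hGh.mul (hgm.comp measurable_fst)
      refine ⟨hm.aestronglyMeasurable, ?_⟩
      rw [hasFiniteIntegral_iff_enorm, lintegral_prod _ hm.enorm.aemeasurable]
      refine lt_of_le_of_lt (b := ∫⁻ x in D k, (A2 x * H + ‖g x‖ₑ ^ 2)) ?_ ?_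
      · rw [← lintegral_indicator (hDm k)]
        refine lintegral_mono fun x => ?_
        by_cases hx : x ∈ D k
        · simp only [Set.indicator_of_mem hx]
          have e1 : ∫⁻ y, ‖G x y * h y * g x‖ₑ ≤ (∫⁻ ω, B x ω * ‖h ω‖ₑ) * ‖g x‖ₑ := by
            have hm' : Measurable (fun ω => B x ω * ‖h ω‖ₑ) :=
              (hB.comp measurable_prodMk_left).mul hh.enorm
            rw [← lintegral_mul_const _ hm']
            refine lintegral_mono fun ω => ?_
            simp only [enorm_mul]
            gcongr
            exact hGB _ _
          refine e1.trans ?_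
          rcases le_total (∫⁻ ω, B x ω * ‖h ω‖ₑ) ‖g x‖ₑ with hle | hle
          · refine le_trans ?_ le_add_self
            rw [sq]; gcongr
          · refine le_trans ?_ (le_trans (hBh x) le_self_add)
            rw [sq]; gcongr
        · simp [hx, hg]
      · rw [lintegral_add_left (hA2m.mul_const H), lintegral_mul_const _ hA2m]
        refine ENNReal.add_lt_top.2 ⟨ENNReal.mul_lt_top hA2int (lt_top_iff_ne_top.2 hH), ?_⟩
        exact lt_of_le_of_lt (setLIntegral_le_lintegral _ _) (lt_top_iff_ne_top.2 hg2)
    -- pairing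
    have hpair : X ≤ ∫⁻ ω, ‖h ω‖ₑ * ‖∫ x, G x ω * g x‖ₑ := by
      have e1 : ∀ x, T x * g x = ((((‖T x‖ₑ ^ 2 * (A2 x)⁻¹).toReal) : ℝ) : ℂ) *
          (D k).indicator 1 x := by
        intro x
        by_cases hx : x ∈ D k
        · simp only [hg, Set.indicator_of_mem hx, Pi.one_apply, mul_one, ENNReal.toReal_mul,
            ENNReal.toReal_pow, ENNReal.toReal_inv, toReal_enorm]
          rw [mul_left_comm, Complex.mul_conj, Complex.normSq_eq_norm_sq]
          push_cast; ring
        · simp [hg, hx]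
      have e2 : X = ‖∫ x, T x * g x‖ₑ := by
        simp only [e1]
        have e3 : ∀ x, ((((‖T x‖ₑ ^ 2 * (A2 x)⁻¹).toReal) : ℝ) : ℂ) * (D k).indicator 1 x =
            (D k).indicator (fun x => ((((‖T x‖ₑ ^ 2 * (A2 x)⁻¹).toReal) : ℝ) : ℂ)) x := by
          intro x; by_cases hx : x ∈ D k <;> simp [hx]
        simp only [e3]
        rw [integral_indicator (hDm k)]
        have e4 : ∫ x in D k, (((‖T x‖ₑ ^ 2 * (A2 x)⁻¹).toReal : ℝ) : ℂ) =
          ((∫ x in D k, (‖T x‖ₑ ^ 2 * (A2 x)⁻¹).toReal : ℝ) : ℂ) := integral_ofReal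
        have hmT : AEMeasurable (fun x => ‖T x‖ₑ ^ 2 * (A2 x)⁻¹) (volume.restrict (D k)) :=
          ((hTm.enorm.pow_const 2).mul hA2m.inv).aemeasurable
        rw [e4, integral_toReal hmT (ae_lt_top' hmT hXt), ← ofReal_norm, Complex.norm_real,
          Real.norm_of_nonneg ENNReal.toReal_nonneg, ENNReal.ofReal_toReal hXt]
      rw [e2]
      have e5 : ∫ x, T x * g x = ∫ ω, h ω * ∫ x, G x ω * g x := by
        have : ∀ x, T x * g x = ∫ ω, G x ω * h ω * g x := fun x => (integral_mul_const _ _).symm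
        simp only [this]
        rw [integral_integral_swap hFub]
        refine integral_congr_ae (Filter.Eventually.of_forall fun ω => ?_)
        simp only
        rw [← integral_const_mul]
        congr 1; funext x; ring
      rw [e5]
      refine (enorm_integral_le_lintegral_enorm _).trans (le_of_eq ?_)
      simp only [enorm_mul]
    have hSm : Measurable (fun ω => ∫ x, G x ω * g x) :=
      (StronglyMeasurable.integral_prod_right' (f := fun q : En n × En n => G q.2 q.1 * g q.2)
        ((hG.comp measurable_swap).mul (hgm.comp measurable_snd)).stronglyMeasurable).measurable
    apply self_bound hXt
    calc X ^ 2 ≤ (∫⁻ ω, ‖h ω‖ₑ * ‖∫ x, G x ω * g x‖ₑ) ^ 2 := pow_le_pow_left' hpair 2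
      _ ≤ H * ∫⁻ ω, ‖∫ x, G x ω * g x‖ₑ ^ 2 := CS_sq _ _ _ hh.enorm.aemeasurable hSm.enorm.aemeasurable
      _ ≤ H * (K * X) := mul_le_mul_right hS _
      _ = K * H * X := by ring
  have hmono : Monotone D := by
    intro j k hjk x hx
    have hjk' : (j : ℝ≥0∞) ≤ k := by exact_mod_cast hjk
    refine ⟨⟨Metric.closedBall_subset_closedBall (by exact_mod_cast hjk) hx.1.1, ?_⟩, ?_⟩
    · exact le_trans (ENNReal.inv_le_inv.2 (by gcongr)) hx.1.2
    · exact le_trans hx.2 hjk'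
  have hsub : ∫⁻ x, ‖T x‖ₑ ^ 2 * (A2 x)⁻¹ = ∫⁻ x in ⋃ k, D k, ‖T x‖ₑ ^ 2 * (A2 x)⁻¹ := by
    rw [← lintegral_indicator (MeasurableSet.iUnion hDm)]
    refine lintegral_congr fun x => ?_
    by_cases hx : x ∈ ⋃ k, D k
    · simp only [Set.indicator_of_mem hx]
    · simp only [Set.indicator_of_notMem hx]
      by_cases h0 : A2 x = 0
      · have := hTb x
        rw [h0, zero_mul, nonpos_iff_eq_zero] at this
        rw [this, zero_mul]
      by_cases ht : A2 x = ∞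
      · simp [ht]
      exfalso
      apply hx
      obtain ⟨k1, hk1⟩ := exists_nat_ge ‖x‖
      obtain ⟨k2, hk2⟩ := ENNReal.exists_nat_gt ht
      obtain ⟨k3, hk3⟩ := ENNReal.exists_nat_gt (ENNReal.inv_ne_top.2 h0)
      refine Set.mem_iUnion.2 ⟨k1 + k2 + k3, ⟨⟨?_, ?_⟩, ?_⟩⟩
      · simp only [mem_closedBall_zero_iff]; push_cast
        have : (0:ℝ) ≤ k2 := by positivity
        have : (0:ℝ) ≤ k3 := by positivity
        linarith
      · simp only [Set.mem_setOf_eq]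
        rw [ENNReal.inv_le_iff_inv_le]
        refine hk3.le.trans ?_
        push_cast
        exact le_add_self.trans le_self_add
      · simp only [Set.mem_setOf_eq]
        refine hk2.le.trans ?_
        exact_mod_cast (by omega : k2 ≤ k1 + k2 + k3)
  rw [hsub, setLIntegral_iUnion_of_directed _ hmono.directed_le]
  exact iSup_le main

end Dual

section TPsec
variable {n : ℕ}

lemma mink (b : En n → En n → ℝ≥0∞) (hb : Measurable (fun q : En n × En n => b q.1 q.2))
    (ν : Measure (En n)) [IsFiniteMeasure ν] (q : ℝ) (hq : 0 < q) (p : ℝ≥0∞)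
    (hqp : ENNReal.ofReal q ≤ p) (M : ℝ≥0∞)
    (hM : ∀ᵐ ω ∂ν, eLpNorm (fun x => b x ω) p volume ≤ M) :
    eLpNorm (fun x => (∫⁻ ω, b x ω ^ q ∂ν) ^ (1 / q)) p volume ≤ M * ν Set.univ ^ (1 / q) := by
  by_cases hp : p = ∞
  · subst hp
    have h1 : ∀ᵐ ω ∂ν, ∀ᵐ x ∂(volume : Measure (En n)), b x ω ≤ M := by
      filter_upwards [hM] with ω hω
      rw [eLpNorm_exponent_top] at hω
      filter_upwards [enorm_ae_le_eLpNormEssSup (fun x => b x ω) volume] with x hx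
      exact le_trans hx hω
    have hms : MeasurableSet {z : En n × En n | b z.2 z.1 ≤ M} :=
      measurableSet_le (hb.comp measurable_swap) measurable_const
    have h2 : ∀ᵐ x ∂(volume : Measure (En n)), ∀ᵐ ω ∂ν, b x ω ≤ M := by
      have := (Measure.ae_prod_iff_ae_ae (μ := ν) (ν := (volume : Measure (En n)))
        (p := fun z : En n × En n => b z.2 z.1 ≤ M) hms).2 h1
      have h3 := Measure.ae_ae_of_ae_prod ((Measure.measurePreserving_swap
        (μ := (volume : Measure (En n))) (ν := ν)).quasiMeasurePreserving.ae this)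
      exact h3
    rw [eLpNorm_exponent_top]
    refine essSup_le_of_ae_le _ ?_
    filter_upwards [h2] with x hx
    simp only [enorm_eq_self]
    calc (∫⁻ ω, b x ω ^ q ∂ν) ^ (1 / q) ≤ (∫⁻ ω, M ^ q ∂ν) ^ (1 / q) := by
          refine ENNReal.rpow_le_rpow (lintegral_mono_ae ?_) (by positivity)
          filter_upwards [hx] with ω hω
          exact ENNReal.rpow_le_rpow hω hq.le
      _ = _ := by
          rw [lintegral_const, ENNReal.mul_rpow_of_nonneg _ _ (by positivity), ← ENNReal.rpow_mul,
            mul_one_div_cancel hq.ne', ENNReal.rpow_one]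
  · have hqp' : q ≤ p.toReal := by
      have := ENNReal.toReal_mono hp hqp
      rwa [ENNReal.toReal_ofReal hq.le] at this
    have hpp : 0 < p.toReal := by linarith
    have hp0 : p ≠ 0 := fun h => by simp [h] at hpp
    set P := p.toReal with hP
    have h1 : ∀ x, (∫⁻ ω, b x ω ^ q ∂ν) ^ (1 / q) ≤
        (∫⁻ ω, b x ω ^ P ∂ν) ^ (1 / P) * ν Set.univ ^ (1 / q - 1 / P) := by
      intro x
      have := eLpNorm'_le_eLpNorm'_mul_rpow_measure_univ (μ := ν) hq hqp'
        (f := fun ω => b x ω) (hb.comp measurable_prodMk_left).aestronglyMeasurable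
      simpa [eLpNorm'] using this
    have hbP : Measurable (fun z : En n × En n => b z.1 z.2 ^ P) := hb.pow_const P
    have h2 : ∫⁻ x, ∫⁻ ω, b x ω ^ P ∂ν ≤ M ^ P * ν Set.univ := by
      rw [lintegral_lintegral_swap hbP.aemeasurable, ← lintegral_const]
      refine lintegral_mono_ae ?_
      filter_upwards [hM] with ω hω
      rw [eLpNorm_eq_lintegral_rpow_enorm_toReal hp0 hp] at hω
      simp only [enorm_eq_self] at hω
      rw [one_div, ← hP] at hω
      exact (ENNReal.rpow_inv_le_iff hpp).1 hω
    rw [eLpNorm_eq_lintegral_rpow_enorm_toReal hp0 hp]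
    simp only [enorm_eq_self]
    rw [← hP, one_div, one_div, ENNReal.rpow_inv_le_iff hpp]
    calc ∫⁻ x, ((∫⁻ ω, b x ω ^ q ∂ν) ^ q⁻¹) ^ P
        ≤ ∫⁻ x, ((∫⁻ ω, b x ω ^ P ∂ν) * (ν Set.univ ^ (1 / q - 1 / P)) ^ P) := by
          refine lintegral_mono fun x => ?_
          refine (ENNReal.rpow_le_rpow (by simpa using h1 x) hpp.le).trans (le_of_eq ?_)
          rw [ENNReal.mul_rpow_of_nonneg _ _ hpp.le, ← ENNReal.rpow_mul, inv_mul_cancel₀ hpp.ne',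
            ENNReal.rpow_one, one_div, one_div]
      _ = (∫⁻ x, ∫⁻ ω, b x ω ^ P ∂ν) * (ν Set.univ ^ (1 / q - 1 / P)) ^ P :=
          lintegral_mul_const _ hbP.lintegral_prod_right'
      _ ≤ (M ^ P * ν Set.univ) * (ν Set.univ ^ (1 / q - 1 / P)) ^ P := by gcongr
      _ = (M * ν Set.univ ^ q⁻¹) ^ P := by
          rw [ENNReal.mul_rpow_of_nonneg _ _ hpp.le, mul_assoc, ← ENNReal.rpow_mul, ← ENNReal.rpow_mul]
          congr 1
          have he : (1 / q - 1 / P) * P = q⁻¹ * P - 1 := by field_simp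
          have hn : 0 ≤ q⁻¹ * P - 1 := by
            rw [sub_nonneg, inv_mul_eq_div, le_div_iff₀ hq]; linarith
          rw [he]
          calc ν Set.univ * ν Set.univ ^ (q⁻¹ * P - 1)
              = ν Set.univ ^ (1:ℝ) * ν Set.univ ^ (q⁻¹ * P - 1) := by rw [ENNReal.rpow_one]
            _ = ν Set.univ ^ (1 + (q⁻¹ * P - 1)) := (ENNReal.rpow_add_of_nonneg _ _ (by norm_num) hn).symm
            _ = _ := by congr 1; ring

lemma TP {Ω : Set (En n)} (hΩ : IsOpen Ω) {ψ : En n → En n → ℝ} {c C : ℝ} (hc : 0 < c)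
    (hψ : PH Ω ψ (n+1) c C) (hψm : Measurable (fun q : En n × En n => ψ q.1 q.2))
    (p : ℝ≥0∞) (hp : 2 ≤ p) (r : ℝ≥0∞) (hr : r⁻¹ = p⁻¹ + 2⁻¹)
    (S : Set (En n)) (hS : MeasurableSet S) (hSv : volume S ≠ ∞) :
    ∃ K : ℝ, 0 ≤ K ∧ ∀ (l κ : ℝ), 0 < l → 1 ≤ κ →
    ∀ (F : En n → En n → ℂ) (B : En n → En n → ℝ≥0∞) (h : En n → ℂ) (M : ℝ), 0 ≤ M →
    Measurable (fun q : En n × En n => F q.1 q.2) →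
    Measurable (fun q : En n × En n => B q.1 q.2) → Measurable h →
    (∀ x, ContDiff ℝ (⊤ : ℕ∞) (F x)) → (∀ x, HasCompactSupport (F x)) →
    (∀ x, tsupport (F x) ⊆ Ω) → (∀ x ω, ENNReal.ofReal (Jt κ (n+1) (F x) ω) ≤ B x ω) →
    (∀ x, ∀ ω ∉ S, B x ω = 0) →
    (∀ ω ∈ S, eLpNorm (fun x => B x ω) p volume ≤ ENNReal.ofReal M) →
    ∫⁻ ω, ‖h ω‖ₑ ^ 2 ≠ ∞ →
    eLpNorm (fun x => ∫ ω, Complex.exp (Complex.I * ((l * ψ x ω : ℝ) : ℂ)) * F x ω * h ω) r volume ≤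
      ENNReal.ofReal (K * (κ / l) ^ ((n:ℝ)/2) * M) * (∫⁻ ω, ‖h ω‖ₑ ^ 2) ^ (1/2 : ℝ) := by
  obtain ⟨K, hK0, hK⟩ := SS hΩ hc hψ hψm
  refine ⟨√K * (volume S).toReal ^ (1/2:ℝ), by positivity, ?_⟩
  intro l κ hl hκ F B h M hM0 hF hB hh hFs hFc hFt hFB hBS hBM hH
  obtain ⟨i0, -⟩ := hψ.2 0 0
  set G : En n → En n → ℂ := fun x ω => Complex.exp (Complex.I * ((l * ψ x ω : ℝ) : ℂ)) * F x ω with hG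
  have hGm : Measurable (fun q : En n × En n => G q.1 q.2) := by
    refine (Measurable.cexp ?_).mul hF
    refine measurable_const.mul ?_
    exact Complex.measurable_ofReal.comp (measurable_const.mul hψm)
  have hGn : ∀ x ω, ‖G x ω‖ₑ = ‖F x ω‖ₑ := by
    intro x ω
    simp only [hG]
    rw [enorm_mul]
    have : ‖Complex.exp (Complex.I * ((l * ψ x ω : ℝ) : ℂ))‖ₑ = 1 := by
      rw [← ofReal_norm, mul_comm Complex.I, Complex.norm_exp_ofReal_mul_I]; simp
    rw [this, one_mul]
  have hGB : ∀ x ω, ‖G x ω‖ₑ ≤ B x ω := by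
    intro x ω
    rw [hGn, ← ofReal_norm]
    refine (ENNReal.ofReal_le_ofReal ?_).trans (hFB x ω)
    exact (norm_le_Js _ _ _ _).trans (Js_le_Jt i0 _ _ _ _)
  have hd := dual_est G B hGm hB hGB (ENNReal.ofReal (K * (κ / l) ^ n)) (by
    intro g hg hfin
    simp only [hGn] at hfin
    exact hK l κ hl hκ F B g hF hB hg hFs hFc hFt hFB hfin) h hh hH
  set H := ∫⁻ ω, ‖h ω‖ₑ ^ 2 with hHd
  set A2 : En n → ℝ≥0∞ := fun x => ∫⁻ ω, B x ω ^ 2 with hA2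
  set T : En n → ℂ := fun x => ∫ ω, G x ω * h ω with hT
  change eLpNorm T r volume ≤ _
  have hA2m : Measurable A2 := (hB.pow_const 2).lintegral_prod_right'
  have hTm : Measurable T :=
    (StronglyMeasurable.integral_prod_right' (f := fun q : En n × En n => G q.1 q.2 * h q.2)
      (hGm.mul (hh.comp measurable_snd)).stronglyMeasurable).measurable
  have hTb : ∀ x, ‖T x‖ₑ ^ 2 ≤ A2 x * H := by
    intro x
    refine le_trans (pow_le_pow_left' ?_ 2) (CS_sq _ _ _
      (hB.comp measurable_prodMk_left).aemeasurable hh.enorm.aemeasurable)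
    refine (enorm_integral_le_lintegral_enorm _).trans (lintegral_mono fun ω => ?_)
    rw [enorm_mul]
    exact mul_le_mul_left (hGB _ _) _
  -- bound on A
  have hA : eLpNorm (fun x => (A2 x) ^ (1/2:ℝ)) p volume ≤
      ENNReal.ofReal M * volume S ^ (1/2:ℝ) := by
    have : IsFiniteMeasure (volume.restrict S) := ⟨by simpa using lt_top_iff_ne_top.2 hSv⟩
    have := mink B hB (volume.restrict S) 2 (by norm_num) p (by simpa using hp) (ENNReal.ofReal M)
      (by
        rw [ae_restrict_iff' hS]
        exact Filter.Eventually.of_forall hBM)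
    rw [Measure.restrict_apply_univ] at this
    refine le_trans (le_of_eq ?_) this
    congr 1
    funext x
    congr 1
    simp only [hA2]
    rw [← lintegral_indicator hS]
    refine lintegral_congr fun ω => ?_
    by_cases hω : ω ∈ S
    · simp [hω]
    · simp [hω, hBS x ω hω]
  have hAfin : ENNReal.ofReal M * volume S ^ (1/2:ℝ) ≠ ∞ := by finiteness
  have hp0 : p ≠ 0 := by rintro rfl; simp at hp
  have hAae : ∀ᵐ x ∂(volume : Measure (En n)), A2 x ≠ ∞ := by
    have hAm : AEStronglyMeasurable (fun x => (A2 x) ^ (1/2:ℝ)) (volume : Measure (En n)) :=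
      (hA2m.pow_const _).aestronglyMeasurable
    have : ∀ᵐ x ∂(volume : Measure (En n)), (A2 x) ^ (1/2:ℝ) < ∞ := by
      have h1 : eLpNorm (fun x => (A2 x) ^ (1/2:ℝ)) p volume < ∞ :=
        lt_of_le_of_lt hA (lt_top_iff_ne_top.2 hAfin)
      by_cases hpt : p = ∞
      · subst hpt
        rw [eLpNorm_exponent_top] at h1
        filter_upwards [enorm_ae_le_eLpNormEssSup (fun x => (A2 x) ^ (1/2:ℝ)) volume] with x hx
        exact lt_of_le_of_lt hx h1
      · have h2 := lintegral_rpow_enorm_lt_top_of_eLpNorm_lt_top hp0 hpt h1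
        have h3 := ae_lt_top' ((hA2m.pow_const (1/2:ℝ)).pow_const p.toReal).aemeasurable
          (by simpa using h2.ne)
        filter_upwards [h3] with x hx
        have hpp := ENNReal.toReal_pos hp0 hpt
        exact (ENNReal.rpow_lt_top_iff_of_pos hpp).1 hx
    filter_upwards [this] with x hx h0
    rw [h0] at hx
    simp at hx
  -- Hoelder
  set A : En n → ℝ := fun x => ((A2 x) ^ (1/2:ℝ)).toReal with hAr
  have hAme : Measurable A := (hA2m.pow_const _).ennreal_toReal
  have : ENNReal.HolderTriple p 2 r := ⟨hr.symm⟩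
  have hTe : T =ᵐ[volume] A • (fun x => (A x)⁻¹ • T x) := by
    filter_upwards [hAae] with x hx
    simp only [Pi.smul_apply', smul_smul]
    by_cases h0 : A x = 0
    · have h1 : A2 x = 0 := by
        simp only [hAr, ENNReal.toReal_eq_zero_iff] at h0
        rcases h0 with h0 | h0
        · exact (ENNReal.rpow_eq_zero_iff_of_pos (by norm_num)).1 h0
        · exact absurd ((ENNReal.rpow_eq_top_iff_of_pos (by norm_num)).1 h0) hx
      have := hTb x
      rw [h1, zero_mul, nonpos_iff_eq_zero] at this
      simp at this
      simp [this]
    · rw [mul_inv_cancel₀ h0, one_smul]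
  rw [eLpNorm_congr_ae hTe]
  have hHol := eLpNorm_smul_le_mul_eLpNorm (p := p) (q := 2) (r := r) (μ := (volume : Measure (En n)))
    (f := fun x => (A x)⁻¹ • T x) (φ := A)
    ((hAme.inv.smul hTm).aestronglyMeasurable) hAme.aestronglyMeasurable
  refine hHol.trans ?_
  have e1 : eLpNorm A p volume ≤ ENNReal.ofReal M * volume S ^ (1/2:ℝ) := by
    refine le_trans (eLpNorm_mono_enorm fun x => ?_) hA
    simp only [hAr, enorm_eq_self]
    rw [← ofReal_norm, Real.norm_of_nonneg ENNReal.toReal_nonneg]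
    exact ENNReal.ofReal_toReal_le
  have e2 : eLpNorm (fun x => (A x)⁻¹ • T x) 2 volume ≤
      (ENNReal.ofReal (K * (κ / l) ^ n) * H) ^ (1/2:ℝ) := by
    rw [eLpNorm_eq_lintegral_rpow_enorm_toReal (by norm_num) (by norm_num)]
    simp only [ENNReal.toReal_ofNat]
    refine ENNReal.rpow_le_rpow (le_trans (lintegral_mono fun x => ?_) hd) (by norm_num)
    simp only [enorm_smul]
    have h2 : (2:ℝ) = ((2:ℕ):ℝ) := by norm_num
    rw [h2, ENNReal.rpow_natCast, mul_pow, mul_comm]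
    gcongr
    by_cases h0 : A x = 0
    · simp [h0]
    · rw [enorm_inv h0, ← ENNReal.inv_pow]
      refine ENNReal.inv_le_inv.2 (le_of_eq ?_)
      have hne : (A2 x) ^ (1/2:ℝ) ≠ ∞ := by
        intro ht; apply h0; simp only [hAr, ht, ENNReal.toReal_top]
      change A2 x = _
      simp only [hAr]
      rw [← ofReal_norm, Real.norm_of_nonneg ENNReal.toReal_nonneg, ENNReal.ofReal_toReal hne,
        ← ENNReal.rpow_natCast, ← ENNReal.rpow_mul]
      norm_num
  refine (mul_le_mul' e1 e2).trans (le_of_eq ?_)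
  rw [ENNReal.mul_rpow_of_nonneg _ _ (by norm_num), ← mul_assoc]
  congr 1
  have hκl : 0 < κ / l := by have : 0 < κ := by linarith
                             positivity
  rw [ENNReal.ofReal_rpow_of_nonneg (by positivity) (by norm_num)]
  have e3 : volume S ^ (1/2:ℝ) = ENNReal.ofReal ((volume S).toReal ^ (1/2:ℝ)) := by
    rw [← ENNReal.ofReal_rpow_of_nonneg ENNReal.toReal_nonneg (by norm_num), ENNReal.ofReal_toReal hSv]
  rw [e3, ← ENNReal.ofReal_mul hM0, ← ENNReal.ofReal_mul (by positivity)]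
  congr 1
  rw [Real.mul_rpow hK0 (by positivity), ← Real.sqrt_eq_rpow K, ← Real.rpow_natCast,
    ← Real.rpow_mul hκl.le]
  rw [show (n:ℝ) * (1/2) = n/2 by ring]
  ring

end TPsec

section Hadamard
variable {n : ℕ}

/-- Abstract global injectivity estimate from a uniform local inverse. -/
lemma hadamard_abs (Y : En n → En n) (hY : Continuous Y) (B R : ℝ) (hB : 0 < B) (hR : 0 < R)
    (hinj : ∀ x, ∀ u ∈ Metric.closedBall x R, ∀ v ∈ Metric.closedBall x R,
      ‖u - v‖ ≤ B * ‖Y u - Y v‖)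
    (hsur : ∀ x w, ‖w - Y x‖ ≤ R / B → ∃ z ∈ Metric.closedBall x R, Y z = w) (x y : En n) :
    ‖x - y‖ ≤ B * ‖Y x - Y y‖ := by
  set w := Y y with hw
  set r := R / (4 * B) with hr
  have hr0 : 0 < r := by positivity
  have hrB : B * r = R / 4 := by rw [hr]; field_simp
  set g : En n → En n := fun v => v + (r / max r ‖w - v‖) • (w - v) with hg
  have hmax : ∀ v, 0 < max r ‖w - v‖ := fun v => lt_max_of_lt_left hr0
  have hgc : Continuous g := by
    have h1 : Continuous (fun v => r / max r ‖w - v‖) :=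
      Continuous.div continuous_const (by fun_prop) fun v => (hmax v).ne'
    exact continuous_id.add (h1.smul (by fun_prop))
  have hgstep : ∀ v, ‖g v - v‖ = ‖w - v‖ - ‖w - g v‖ := by
    intro v
    have e1 : g v - v = (r / max r ‖w - v‖) • (w - v) := by simp [hg]
    have e2 : w - g v = (1 - r / max r ‖w - v‖) • (w - v) := by
      simp only [hg, sub_smul, one_smul]; abel
    have h1 : r / max r ‖w - v‖ ≤ 1 := by rw [div_le_one (hmax v)]; exact le_max_left _ _
    have h0 : 0 ≤ r / max r ‖w - v‖ := by positivity
    rw [e1, e2, norm_smul, norm_smul, Real.norm_of_nonneg h0, Real.norm_of_nonneg (by linarith)]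
    ring
  have hgr : ∀ v, ‖g v - v‖ = min r ‖w - v‖ := by
    intro v
    have e1 : g v - v = (r / max r ‖w - v‖) • (w - v) := by simp [hg]
    rw [e1, norm_smul, Real.norm_of_nonneg (by positivity)]
    rcases le_total r ‖w - v‖ with h | h
    · rw [max_eq_right h, min_eq_left h, div_mul_cancel₀]
      exact (lt_of_lt_of_le hr0 h).ne'
    · rw [max_eq_left h, min_eq_right h, div_self hr0.ne', one_mul]
  have hex : ∀ x, ∃ z ∈ Metric.closedBall x R, Y z = g (Y x) := by
    intro x
    apply hsur
    rw [hgr]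
    refine (min_le_left _ _).trans ?_
    rw [hr]
    gcongr
    linarith
  choose N hNb hNY using hex
  have hNd : ∀ x, ‖N x - x‖ ≤ B * ‖g (Y x) - Y x‖ := by
    intro x
    have := hinj x (N x) (hNb x) x (Metric.mem_closedBall_self hR.le)
    rwa [hNY] at this
  have hNR : ∀ x, ‖N x - x‖ ≤ R / 4 := by
    intro x
    refine (hNd x).trans ?_
    rw [← hrB, hgr]
    gcongr
    exact min_le_left _ _
  have hNc : Continuous N := by
    rw [continuous_iff_continuousAt]
    intro x
    have hG : Filter.Tendsto (fun x' => B * ‖g (Y x') - g (Y x)‖) (nhds x) (nhds 0) := by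
      have : Continuous (fun x' => B * ‖g (Y x') - g (Y x)‖) := by fun_prop
      have := this.tendsto x
      simpa using this
    rw [ContinuousAt, tendsto_iff_norm_sub_tendsto_zero]
    refine squeeze_zero' (Filter.Eventually.of_forall fun _ => norm_nonneg _) ?_ hG
    filter_upwards [Metric.ball_mem_nhds x (by positivity : 0 < R / 4)] with x' hx'
    rw [← hNY, ← hNY]
    refine hinj x _ ?_ _ (hNb x)
    rw [Metric.mem_ball, dist_eq_norm] at hx'
    rw [Metric.mem_closedBall, dist_eq_norm]
    calc ‖N x' - x‖ = ‖(N x' - x') + (x' - x)‖ := by congr 1; abel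
      _ ≤ ‖N x' - x'‖ + ‖x' - x‖ := norm_add_le _ _
      _ ≤ R := by have := hNR x'; linarith
  have hNfix : ∀ x, Y x = w → N x = x := by
    intro x hx
    have := hNd x
    rw [hgr, hx] at this
    simp only [sub_self, norm_zero, min_eq_right hr0.le, mul_zero] at this
    exact sub_eq_zero.1 (norm_le_zero_iff.1 this)
  -- iterates
  have hit1 : ∀ k x, ‖N^[k] x - x‖ ≤ B * (‖w - Y x‖ - ‖w - Y (N^[k] x)‖) := by
    intro k
    induction k with
    | zero => intro x; simp
    | succ k ih =>
      intro x
      rw [Function.iterate_succ_apply']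
      set z := N^[k] x
      have h1 := hNd z
      rw [hgstep, ← hNY] at h1
      calc ‖N z - x‖ = ‖(N z - z) + (z - x)‖ := by congr 1; abel
        _ ≤ ‖N z - z‖ + ‖z - x‖ := norm_add_le _ _
        _ ≤ _ := by have := ih x; linarith
  have hit2 : ∀ k x, ‖w - Y (N^[k] x)‖ ≤ max 0 (‖w - Y x‖ - k * r) := by
    intro k
    induction k with
    | zero => intro x; simp
    | succ k ih =>
      intro x
      rw [Function.iterate_succ_apply']
      set z := N^[k] x
      have h1 := hgstep (Y z)
      rw [hgr, ← hNY] at h1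
      have h2 := ih x
      push_cast
      rcases le_total r ‖w - Y z‖ with h | h
      · rw [min_eq_left h] at h1
        rcases le_max_iff.1 h2 with h3 | h3
        · linarith
        · refine le_max_of_le_right ?_
          linarith
      · rw [min_eq_right h] at h1
        refine le_max_of_le_left ?_
        linarith
  have hhit : ∀ (k : ℕ) x, ‖w - Y x‖ ≤ k * r → Y (N^[k] x) = w := by
    intro k x h
    have := hit2 k x
    rw [max_eq_left (by linarith)] at this
    exact (sub_eq_zero.1 (norm_le_zero_iff.1 this)).symm
  have hstab : ∀ k j x, Y (N^[k] x) = w → N^[k + j] x = N^[k] x := by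
    intro k j x h
    rw [add_comm, Function.iterate_add_apply]
    exact Function.iterate_fixed (hNfix _ h) j
  set K : En n → ℕ := fun x => ⌈‖w - Y x‖ / r⌉₊ with hK
  have hKx : ∀ x, ‖w - Y x‖ ≤ K x * r := by
    intro x
    rw [← div_le_iff₀ hr0]
    exact Nat.le_ceil _
  set F : En n → En n := fun x => N^[K x] x with hF
  have hFk : ∀ x k, K x ≤ k → N^[k] x = F x := by
    intro x k hk
    obtain ⟨j, rfl⟩ := Nat.exists_eq_add_of_le hk
    exact hstab _ _ _ (hhit _ _ (hKx x))
  have hFw : ∀ x, Y (F x) = w := fun x => hhit _ _ (hKx x)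
  have hloc : IsLocallyConstant F := by
    rw [IsLocallyConstant.iff_eventually_eq]
    intro x
    set k := ⌈(‖w - Y x‖ + 1) / r⌉₊ with hk
    have hc : Continuous (N^[k]) := hNc.iterate k
    have h1 : ∀ᶠ x' in nhds x, ‖w - Y x'‖ < ‖w - Y x‖ + 1 := by
      have : Continuous (fun x' => ‖w - Y x'‖) := by fun_prop
      exact this.tendsto x |>.eventually (gt_mem_nhds (by linarith))
    have h2 : ∀ᶠ x' in nhds x, N^[k] x' ∈ Metric.ball (N^[k] x) R :=
      hc.tendsto x |>.eventually (Metric.ball_mem_nhds _ hR)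
    filter_upwards [h1, h2] with x' h1 h2
    have hKk : K x' ≤ k := Nat.ceil_le_ceil (by gcongr)
    have hKk' : K x ≤ k := Nat.ceil_le_ceil (by gcongr; linarith)
    rw [hFk x' k hKk, hFk x k hKk'] at h2
    have := hinj (F x) (F x') (Metric.ball_subset_closedBall h2) (F x) (Metric.mem_closedBall_self hR.le)
    rw [hFw, hFw] at this
    simp only [sub_self, norm_zero, mul_zero] at this
    exact sub_eq_zero.1 (norm_le_zero_iff.1 this)
  have hFy : F y = y := by
    have : K y = 0 := by simp [hK, hw]
    simp only [hF, this, Function.iterate_zero, id]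
  have hFx : F x = y := by rw [← hFy]; exact hloc.apply_eq_of_preconnectedSpace x y
  have := hit1 (K x) x
  have hFx' : N^[K x] x = y := hFx
  rw [hFx'] at this
  rw [norm_sub_rev x y, norm_sub_rev (Y x)]
  simpa [hw] using this

lemma hadamard (Y : En n → En n) (Y' : En n → En n →L[ℝ] En n) (hY : ∀ x, HasFDerivAt Y (Y' x) x)
    (L : En n → En n ≃L[ℝ] En n) (hL : ∀ x, (L x : En n →L[ℝ] En n) = Y' x)
    (B Λ : ℝ) (hB : 0 < B) (hΛ : 0 ≤ Λ) (hLB : ∀ x v, ‖(L x).symm v‖ ≤ B * ‖v‖)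
    (hLip : ∀ x y, ‖Y' x - Y' y‖ ≤ Λ * ‖x - y‖) (x y : En n) :
    ‖x - y‖ ≤ 2 * B * ‖Y x - Y y‖ := by
  have hYc : Continuous Y := continuous_iff_continuousAt.2 fun x => (hY x).continuousAt
  set R : ℝ := 1 / (2 * B * (Λ + 1)) with hR
  have hR0 : 0 < R := by positivity
  have hRΛ : Λ * R ≤ 1 / (2 * B) := by
    rw [hR, mul_one_div, div_le_div_iff₀ (by positivity) (by positivity)]
    nlinarith
  have happ : ∀ x, ∀ u ∈ Metric.closedBall x R, ∀ v ∈ Metric.closedBall x R,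
      ‖Y u - Y v - Y' x (u - v)‖ ≤ 1 / (2 * B) * ‖u - v‖ := by
    intro x u hu v hv
    refine (convex_closedBall x R).norm_image_sub_le_of_norm_hasFDerivWithin_le' (f' := Y')
      (fun z _ => (hY z).hasFDerivWithinAt) (fun z hz => ?_) hv hu
    refine (hLip z x).trans (le_trans ?_ hRΛ)
    gcongr
    rwa [Metric.mem_closedBall, dist_eq_norm] at hz
  refine hadamard_abs Y hYc (2 * B) R (by positivity) hR0 ?_ ?_ x y
  · intro x u hu v hv
    have h1 := happ x u hu v hv
    have h2 : ‖u - v‖ ≤ B * ‖Y' x (u - v)‖ := by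
      have := hLB x (Y' x (u - v))
      rw [← hL] at this ⊢
      simpa using this
    have h3 : ‖Y' x (u - v)‖ ≤ ‖Y u - Y v‖ + 1 / (2 * B) * ‖u - v‖ := by
      calc ‖Y' x (u - v)‖ = ‖(Y u - Y v) - (Y u - Y v - Y' x (u - v))‖ := by congr 1; abel
        _ ≤ _ := norm_sub_le _ _
        _ ≤ _ := by gcongr
    have h4 : B * ‖Y' x (u - v)‖ ≤ B * ‖Y u - Y v‖ + 1/2 * ‖u - v‖ := by
      calc _ ≤ B * (‖Y u - Y v‖ + 1 / (2 * B) * ‖u - v‖) := by gcongr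
        _ = _ := by field_simp
    linarith
  · intro x w hw
    have hAL : ApproximatesLinearOn Y (L x : En n →L[ℝ] En n) (Metric.closedBall x R)
        (1 / (2 * B)).toNNReal := by
      intro u hu v hv
      rw [hL, Real.coe_toNNReal _ (by positivity)]
      exact happ x u hu v hv
    set I : ContinuousLinearMap.NonlinearRightInverse (L x : En n →L[ℝ] En n) :=
      { toFun := (L x).symm
        nnnorm := B.toNNReal
        bound' := fun v => by rw [Real.coe_toNNReal _ hB.le]; exact hLB x v
        right_inv' := fun v => (L x).apply_symm_apply v } with hI
    have hs := hAL.surjOn_closedBall_of_nonlinearRightInverse I (ε := R) (b := x) hR0.le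
      (subset_refl _)
    have hIn : (I.nnnorm : ℝ) = B := Real.coe_toNNReal _ hB.le
    have hw' : w ∈ Metric.closedBall (Y x) (((I.nnnorm : ℝ)⁻¹ - (1 / (2 * B)).toNNReal) * R) := by
      rw [Metric.mem_closedBall, dist_eq_norm, hIn, Real.coe_toNNReal _ (by positivity)]
      refine hw.trans (le_of_eq ?_)
      field_simp
      norm_num
    obtain ⟨z, hz, hzw⟩ := hs hw'
    exact ⟨z, hz, hzw⟩

end Hadamard

section Words
variable {n : ℕ}

/-- Iterated directional derivatives along a word of vectors. -/
def DL {V : Type} [NormedAddCommGroup V] [NormedSpace ℝ V] (l : List V) (Φ : V → ℝ) : V → ℝ :=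
  l.foldr (fun v g q => fderiv ℝ g q v) Φ

/-- Iterated coordinate derivatives along a word of indices. -/
def pl (I : List (Fin n)) (f : En n → ℝ) : En n → ℝ := I.foldr (fun i g => pd i g) f

/-- First-slot vector. -/
def vl (j : Fin n) : En n × En n := (EuclideanSpace.single j 1, 0)
/-- Second-slot vector. -/
def vr (j : Fin n) : En n × En n := (0, EuclideanSpace.single j 1)

/-- The word of a multi-index. -/
def word (α : Fin n → ℕ) : List (Fin n) := (List.finRange n).flatMap fun i => List.replicate (α i) i

lemma pl_replicate (k : ℕ) (i : Fin n) (l : List (Fin n)) (f : En n → ℝ) :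
    pl (List.replicate k i ++ l) f = (pd i)^[k] (pl l f) := by
  induction k with
  | zero => simp
  | succ k ih =>
    rw [Function.iterate_succ_apply', List.replicate_succ, List.cons_append, ← ih]
    rfl

lemma mderiv_eq_pl (α : Fin n → ℕ) (f : En n → ℝ) : mderiv α f = pl (word α) f := by
  unfold mderiv word
  generalize List.finRange n = L
  induction L with
  | nil => rfl
  | cons i L ih =>
    rw [List.foldr_cons, ih, List.flatMap_cons, pl_replicate]

lemma word_perm (I : List (Fin n)) : (word fun i => I.count i).Perm I := by
  rw [List.perm_iff_count]
  intro a
  unfold word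
  rw [List.count_flatMap]
  simp only [Function.comp_def, List.count_replicate]
  rw [← List.ofFn_eq_map, List.sum_ofFn]
  simp

lemma mdeg_count (I : List (Fin n)) : mdeg (fun i => I.count i) = I.length := by
  unfold mdeg
  rw [← Multiset.coe_card, ← Multiset.sum_count_eq_card (s := Finset.univ) (fun _ _ => Finset.mem_univ _)]
  simp

section gen
variable {V : Type} [NormedAddCommGroup V] [NormedSpace ℝ V] {U : Set V}

lemma fderiv_dir_smooth (hU : IsOpen U) {Φ : V → ℝ} (h : ContDiffOn ℝ (⊤ : ℕ∞) Φ U) (v : V) :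
    ContDiffOn ℝ (⊤ : ℕ∞) (fun q => fderiv ℝ Φ q v) U :=
  (h.fderiv_of_isOpen hU (by simp)).clm_apply contDiffOn_const

lemma DL_smooth (hU : IsOpen U) {Φ : V → ℝ} (h : ContDiffOn ℝ (⊤ : ℕ∞) Φ U) (l : List V) :
    ContDiffOn ℝ (⊤ : ℕ∞) (DL l Φ) U := by
  induction l with
  | nil => exact h
  | cons v l ih => exact fderiv_dir_smooth hU ih v

lemma DL_congr (hU : IsOpen U) {Φ Ψ : V → ℝ} (h : ∀ q ∈ U, Φ q = Ψ q) (l : List V) :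
    ∀ q ∈ U, DL l Φ q = DL l Ψ q := by
  induction l with
  | nil => exact h
  | cons v l ih =>
    intro q hq
    have : DL l Φ =ᶠ[nhds q] DL l Ψ := by
      filter_upwards [hU.mem_nhds hq] with z hz using ih z hz
    change fderiv ℝ (DL l Φ) q v = fderiv ℝ (DL l Ψ) q v
    rw [this.fderiv_eq]

lemma DL_append (l l' : List V) (Φ : V → ℝ) : DL (l ++ l') Φ = DL l (DL l' Φ) := by
  simp [DL, List.foldr_append]

lemma DL_swap (hU : IsOpen U) {Φ : V → ℝ} (h : ContDiffOn ℝ (⊤ : ℕ∞) Φ U) (v w : V) :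
    ∀ q ∈ U, fderiv ℝ (fun z => fderiv ℝ Φ z v) q w = fderiv ℝ (fun z => fderiv ℝ Φ z w) q v := by
  intro q hq
  have hc : ContDiffAt ℝ (⊤ : ℕ∞) Φ q := h.contDiffAt (hU.mem_nhds hq)
  have hs : IsSymmSndFDerivAt ℝ Φ q := hc.isSymmSndFDerivAt (by simp; exact WithTop.coe_le_coe.2 le_top)
  have hd : DifferentiableAt ℝ (fderiv ℝ Φ) q :=
    (hc.fderiv_right (m := 1) (by rw [one_add_one_eq_two]; exact WithTop.coe_le_coe.2 le_top)).differentiableAt (by simp)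
  rw [fderiv_clm_apply hd (by fun_prop), fderiv_clm_apply hd (by fun_prop)]
  simpa using hs w v

lemma DL_perm (hU : IsOpen U) {Φ : V → ℝ} (h : ContDiffOn ℝ (⊤ : ℕ∞) Φ U) {l l' : List V}
    (hl : l.Perm l') : ∀ q ∈ U, DL l Φ q = DL l' Φ q := by
  induction hl with
  | nil => intro q _; rfl
  | cons v _ ih =>
    rename_i l1 l2 _
    exact DL_congr hU ih [v]
  | swap v w l => intro q hq; exact DL_swap hU (DL_smooth hU h l) v w q hq
  | trans _ _ ih1 ih2 => intro q hq; rw [ih1 q hq, ih2 q hq]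

end gen

/-- The open set of nonzero frequencies. -/
def Uo (n : ℕ) : Set (En n × En n) := {q | q.2 ≠ 0}

lemma Uo_open : IsOpen (Uo n) := isOpen_ne_fun continuous_snd continuous_const

lemma pl_slice_r {G : En n × En n → ℝ} (hG : ContDiffOn ℝ (⊤ : ℕ∞) G (Uo n)) (x : En n)
    (f : En n → ℝ) (hf : ∀ ζ, ζ ≠ 0 → f ζ = G (x, ζ)) (I : List (Fin n)) :
    ∀ ξ, ξ ≠ 0 → pl I f ξ = DL (I.map vr) G (x, ξ) := by
  induction I with
  | nil => exact hf
  | cons i I ih =>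
    intro ξ hξ
    have he : pl I f =ᶠ[nhds ξ] fun ζ => DL (I.map vr) G (x, ζ) := by
      filter_upwards [isOpen_ne.mem_nhds hξ] with z hz using ih z hz
    change fderiv ℝ (pl I f) ξ (EuclideanSpace.single i 1) = fderiv ℝ (DL (I.map vr) G) (x, ξ) (vr i)
    rw [he.fderiv_eq]
    have hd : HasFDerivAt (DL (I.map vr) G) (fderiv ℝ (DL (I.map vr) G) (x, ξ)) (x, ξ) :=
      (((DL_smooth Uo_open hG _).contDiffAt (Uo_open.mem_nhds (show (x, ξ) ∈ Uo n from hξ))).differentiableAt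
        (by simp)).hasFDerivAt
    have h2 := hd.comp ξ (hasFDerivAt_prodMk_right x ξ)
    change fderiv ℝ (DL (I.map vr) G ∘ fun ζ => (x, ζ)) ξ _ = _
    rw [h2.fderiv]
    simp [vr]

lemma pl_slice_l {G : En n × En n → ℝ} (hG : ContDiffOn ℝ (⊤ : ℕ∞) G (Uo n)) (ξ : En n) (hξ : ξ ≠ 0)
    (f : En n → ℝ) (hf : ∀ y, f y = G (y, ξ)) (I : List (Fin n)) :
    ∀ x, pl I f x = DL (I.map vl) G (x, ξ) := by
  induction I with
  | nil => exact hf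
  | cons i I ih =>
    intro x
    have he : pl I f = fun y => DL (I.map vl) G (y, ξ) := funext ih
    change fderiv ℝ (pl I f) x (EuclideanSpace.single i 1) = fderiv ℝ (DL (I.map vl) G) (x, ξ) (vl i)
    rw [he]
    have hd : HasFDerivAt (DL (I.map vl) G) (fderiv ℝ (DL (I.map vl) G) (x, ξ)) (x, ξ) :=
      (((DL_smooth Uo_open hG _).contDiffAt (Uo_open.mem_nhds (show (x, ξ) ∈ Uo n from hξ))).differentiableAt
        (by simp)).hasFDerivAt
    have h2 := HasFDerivAt.comp (g := DL (I.map vl) G) x hd (hasFDerivAt_prodMk_left (𝕜 := ℝ) x ξ)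
    change fderiv ℝ (DL (I.map vl) G ∘ fun y => (y, ξ)) x _ = _
    rw [h2.fderiv]
    simp [vl]

/-- Uncurried phase. -/
def unc (φ : En n → En n → ℝ) : En n × En n → ℝ := fun q => φ q.1 q.2

lemma mixedD_eq {φ : En n → En n → ℝ} (hφ : PhiClass 2 φ) (α β : Fin n → ℕ) (x ξ : En n)
    (hξ : ξ ≠ 0) : mixedD α β φ x ξ = DL ((word α).map vr ++ (word β).map vl) (unc φ) (x, ξ) := by
  have hs : ContDiffOn ℝ (⊤ : ℕ∞) (unc φ) (Uo n) := hφ.1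
  unfold mixedD
  rw [mderiv_eq_pl, DL_append]
  refine pl_slice_r (DL_smooth Uo_open hs _) x _ (fun ζ hζ => ?_) _ ξ hξ
  rw [mderiv_eq_pl]
  exact pl_slice_l hs ζ hζ _ (fun y => rfl) _ x

lemma phase_bound {φ : En n → En n → ℝ} (hφ : PhiClass 2 φ) (I J : List (Fin n))
    (h : 2 ≤ I.length + J.length) : ∃ C : ℝ, 0 ≤ C ∧ ∀ x ξ : En n, ξ ≠ 0 →
      ‖ξ‖ ^ ((I.length : ℝ) - 1) * |DL (I.map vr ++ J.map vl) (unc φ) (x, ξ)| ≤ C := by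
  obtain ⟨C, hC⟩ := hφ.2.2 (fun i => I.count i) (fun i => J.count i) (by simpa [mdeg_count] using h)
  refine ⟨|C|, abs_nonneg _, fun x ξ hξ => ?_⟩
  have := hC x ξ hξ
  rw [mixedD_eq hφ _ _ x ξ hξ, mdeg_count] at this
  have hp : ((word fun i => I.count i).map vr ++ (word fun i => J.count i).map vl).Perm
      (I.map vr ++ J.map vl) := ((word_perm I).map _).append ((word_perm J).map _)
  rw [DL_perm (Φ := unc φ) Uo_open hφ.1 hp (x, ξ) hξ] at this
  exact this.trans (le_abs_self C)

/-- Bound on the annulus for any word. -/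
lemma phase_bound_ann {φ : En n → En n → ℝ} (hφ : PhiClass 2 φ) (I J : List (Fin n))
    (h : 2 ≤ I.length + J.length) (l : List (En n × En n)) (hl : (I.map vr ++ J.map vl).Perm l) :
    ∃ C : ℝ, 0 ≤ C ∧ ∀ x ξ : En n, 1/2 ≤ ‖ξ‖ → ‖ξ‖ ≤ 2 → |DL l (unc φ) (x, ξ)| ≤ C := by
  obtain ⟨C, hC0, hC⟩ := phase_bound hφ I J h
  refine ⟨2 ^ |(I.length : ℝ) - 1| * C, by positivity, fun x ξ h1 h2 => ?_⟩
  have hξ0 : 0 < ‖ξ‖ := by linarith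
  have hξ : ξ ≠ 0 := norm_pos_iff.1 hξ0
  have := hC x ξ hξ
  rw [DL_perm (Φ := unc φ) Uo_open hφ.1 hl (x, ξ) hξ] at this
  set s := (I.length : ℝ) - 1
  have hlow : (2 ^ |s|)⁻¹ ≤ ‖ξ‖ ^ s := by
    rcases le_total 0 s with hs | hs
    · rw [abs_of_nonneg hs, ← Real.inv_rpow (by norm_num)]
      exact Real.rpow_le_rpow (by norm_num) (by linarith) hs
    · rw [abs_of_nonpos hs, Real.rpow_neg (by norm_num), inv_inv]
      exact Real.rpow_le_rpow_of_nonpos hξ0 h2 hs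
  have h3 : (2 ^ |s|)⁻¹ * |DL l (unc φ) (x, ξ)| ≤ C := le_trans (by gcongr) this
  rwa [inv_mul_le_iff₀ (by positivity)] at h3

end Words

section Slices
variable {n : ℕ}

lemma clm_coord (L : En n →L[ℝ] ℝ) (v : En n) : L v = ∑ j, v j * L (eb j) := by
  have : v = ∑ j, v j • eb j := by
    ext i
    simp [eb, Finset.sum_apply, Pi.single_apply]
  conv_lhs => rw [this]
  simp

lemma clm_bound (L : En n →L[ℝ] ℝ) (C : ℝ) (hC : ∀ j, |L (eb j)| ≤ C) (hC0 : 0 ≤ C) :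
    ‖L‖ ≤ n * C := by
  refine L.opNorm_le_bound (by positivity) fun v => ?_
  rw [clm_coord, Real.norm_eq_abs]
  refine (Finset.abs_sum_le_sum_abs _ _).trans ?_
  calc ∑ j, |v j * L (eb j)| ≤ ∑ _j : Fin n, ‖v‖ * C := by
        refine Finset.sum_le_sum fun j _ => ?_
        rw [abs_mul]
        exact mul_le_mul (PiLp.norm_apply_le v j) (hC j) (abs_nonneg _) (norm_nonneg _)
    _ = n * C * ‖v‖ := by simp; ring

lemma mv_lemma {s : Set (En n)} (hs : Convex ℝ s) (hso : IsOpen s) (f : En n → ℝ) (hf : ∀ x ∈ s, DifferentiableAt ℝ f x)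
    (C : ℝ) (hC0 : 0 ≤ C) (hC : ∀ x ∈ s, ∀ j, |fderiv ℝ f x (eb j)| ≤ C) {x y : En n} (hx : x ∈ s) (hy : y ∈ s) :
    |f x - f y| ≤ n * C * ‖x - y‖ :=
  hs.norm_image_sub_le_of_norm_fderiv_le hf (fun z hz => clm_bound _ C (hC z hz) hC0) hy hx

variable {G : En n × En n → ℝ}

lemma slice_l_hasFDeriv (hG : ContDiffOn ℝ (⊤ : ℕ∞) G (Uo n)) (l : List (En n × En n)) (x ξ : En n) (hξ : ξ ≠ 0) :
    DifferentiableAt ℝ (fun y => DL l G (y, ξ)) x ∧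
    ∀ j, fderiv ℝ (fun y => DL l G (y, ξ)) x (eb j) = DL (vl j :: l) G (x, ξ) := by
  have hd : HasFDerivAt (DL l G) (fderiv ℝ (DL l G) (x, ξ)) (x, ξ) :=
      (((DL_smooth Uo_open hG _).contDiffAt (Uo_open.mem_nhds (show (x, ξ) ∈ Uo n from hξ))).differentiableAt
        (by simp)).hasFDerivAt
  have h2 := HasFDerivAt.comp (g := DL l G) x hd (hasFDerivAt_prodMk_left (𝕜 := ℝ) x ξ)
  refine ⟨h2.differentiableAt, fun j => ?_⟩
  change fderiv ℝ (DL l G ∘ fun y => (y, ξ)) x _ = fderiv ℝ (DL l G) (x, ξ) (vl j)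
  rw [h2.fderiv]
  simp [vl, eb]

lemma slice_r_hasFDeriv (hG : ContDiffOn ℝ (⊤ : ℕ∞) G (Uo n)) (l : List (En n × En n)) (x ξ : En n) (hξ : ξ ≠ 0) :
    DifferentiableAt ℝ (fun y => DL l G (x, y)) ξ ∧
    ∀ j, fderiv ℝ (fun y => DL l G (x, y)) ξ (eb j) = DL (vr j :: l) G (x, ξ) := by
  have hd : HasFDerivAt (DL l G) (fderiv ℝ (DL l G) (x, ξ)) (x, ξ) :=
      (((DL_smooth Uo_open hG _).contDiffAt (Uo_open.mem_nhds (show (x, ξ) ∈ Uo n from hξ))).differentiableAt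
        (by simp)).hasFDerivAt
  have h2 := HasFDerivAt.comp (g := DL l G) ξ hd (hasFDerivAt_prodMk_right (𝕜 := ℝ) x ξ)
  refine ⟨h2.differentiableAt, fun j => ?_⟩
  change fderiv ℝ (DL l G ∘ fun y => (x, y)) ξ _ = fderiv ℝ (DL l G) (x, ξ) (vr j)
  rw [h2.fderiv]
  simp [vr, eb]

lemma lip_x (hG : ContDiffOn ℝ (⊤ : ℕ∞) G (Uo n)) (l : List (En n × En n)) (ξ : En n) (hξ : ξ ≠ 0)
    (C : ℝ) (hC0 : 0 ≤ C) (hC : ∀ j x, |DL (vl j :: l) G (x, ξ)| ≤ C) (x y : En n) :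
    |DL l G (x, ξ) - DL l G (y, ξ)| ≤ n * C * ‖x - y‖ :=
  mv_lemma convex_univ isOpen_univ (fun y => DL l G (y, ξ))
    (fun x _ => (slice_l_hasFDeriv hG l x ξ hξ).1) C hC0
    (fun x _ j => by rw [(slice_l_hasFDeriv hG l x ξ hξ).2]; exact hC j x) (Set.mem_univ _) (Set.mem_univ _)

lemma lip_w (hG : ContDiffOn ℝ (⊤ : ℕ∞) G (Uo n)) (l : List (En n × En n)) {s : Set (En n)} (hs : Convex ℝ s)
    (hso : IsOpen s) (h0 : ∀ ξ ∈ s, ξ ≠ 0) (x : En n)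
    (C : ℝ) (hC0 : 0 ≤ C) (hC : ∀ j, ∀ ξ ∈ s, |DL (vr j :: l) G (x, ξ)| ≤ C) {ξ η : En n} (hξ : ξ ∈ s) (hη : η ∈ s) :
    |DL l G (x, ξ) - DL l G (x, η)| ≤ n * C * ‖ξ - η‖ :=
  mv_lemma hs hso (fun y => DL l G (x, y))
    (fun ξ h => (slice_r_hasFDeriv hG l x ξ (h0 ξ h)).1) C hC0
    (fun ξ h j => by rw [(slice_r_hasFDeriv hG l x ξ (h0 ξ h)).2]; exact hC j ξ h) hξ hη

lemma lip_xw (hG : ContDiffOn ℝ (⊤ : ℕ∞) G (Uo n)) (l : List (En n × En n)) {s : Set (En n)} (hs : Convex ℝ s)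
    (hso : IsOpen s) (h0 : ∀ ξ ∈ s, ξ ≠ 0)
    (C : ℝ) (hC0 : 0 ≤ C) (hC : ∀ k j x, ∀ ξ ∈ s, |DL (vl k :: vr j :: l) G (x, ξ)| ≤ C) (x y : En n)
    {ξ η : En n} (hξ : ξ ∈ s) (hη : η ∈ s) :
    |(DL l G (x, ξ) - DL l G (y, ξ)) - (DL l G (x, η) - DL l G (y, η))| ≤ n * (n * C * ‖x - y‖) * ‖ξ - η‖ := by
  refine mv_lemma hs hso (fun z => DL l G (x, z) - DL l G (y, z))
    (fun ξ h => (slice_r_hasFDeriv hG l x ξ (h0 ξ h)).1.sub (slice_r_hasFDeriv hG l y ξ (h0 ξ h)).1) _ (by positivity)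
    (fun ξ h j => ?_) hξ hη
  rw [fderiv_fun_sub (slice_r_hasFDeriv hG l x ξ (h0 ξ h)).1 (slice_r_hasFDeriv hG l y ξ (h0 ξ h)).1]
  rw [_root_.sub_apply, (slice_r_hasFDeriv hG l x ξ (h0 ξ h)).2, (slice_r_hasFDeriv hG l y ξ (h0 ξ h)).2]
  exact lip_x hG _ ξ (h0 ξ h) C hC0 (fun k x => hC k j x ξ h) x y

/-- Link of complex iterated derivatives with real words. -/
lemma dv_ofReal {Ω : Set (En n)} (hΩ : IsOpen Ω) {g : En n → ℝ} (hg : ContDiffOn ℝ (⊤ : ℕ∞) g Ω) (v : En n) (k : ℕ) :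
    ∀ ω ∈ Ω, (dv v)^[k] (fun ω => (g ω : ℂ)) ω = ((DL (List.replicate k v) g ω : ℝ) : ℂ) := by
  induction k with
  | zero => intro ω _; rfl
  | succ k ih =>
    intro ω hω
    rw [Function.iterate_succ_apply', List.replicate_succ]
    rw [dv_congr hΩ v ih ω hω]
    have hd : DifferentiableAt ℝ (DL (List.replicate k v) g) ω :=
      ((DL_smooth hΩ hg _).contDiffAt (hΩ.mem_nhds hω)).differentiableAt (by simp)
    have := (Complex.ofRealCLM.hasFDerivAt (x := DL (List.replicate k v) g ω)).comp ω hd.hasFDerivAt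
    change fderiv ℝ (Complex.ofRealCLM ∘ DL (List.replicate k v) g) ω v = ((fderiv ℝ (DL (List.replicate k v) g) ω v : ℝ) : ℂ)
    rw [this.fderiv]
    simp

lemma DL_sub {V : Type} [NormedAddCommGroup V] [NormedSpace ℝ V] {Ω : Set V} (hΩ : IsOpen Ω) {g h : V → ℝ}
    (hg : ContDiffOn ℝ (⊤ : ℕ∞) g Ω) (hh : ContDiffOn ℝ (⊤ : ℕ∞) h Ω) (l : List V) :
    ∀ ω ∈ Ω, DL l (fun ω => g ω - h ω) ω = DL l g ω - DL l h ω := by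
  induction l with
  | nil => intro ω _; rfl
  | cons v l ih =>
    intro ω hω
    change fderiv ℝ (DL l _) ω v = fderiv ℝ (DL l g) ω v - fderiv ℝ (DL l h) ω v
    have he : DL l (fun ω => g ω - h ω) =ᶠ[nhds ω] fun ω => DL l g ω - DL l h ω := by
      filter_upwards [hΩ.mem_nhds hω] with z hz using ih z hz
    rw [he.fderiv_eq, fderiv_fun_sub]
    · rfl
    · exact ((DL_smooth hΩ hg _).contDiffAt (hΩ.mem_nhds hω)).differentiableAt (by simp)
    · exact ((DL_smooth hΩ hh _).contDiffAt (hΩ.mem_nhds hω)).differentiableAt (by simp)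

lemma DL_slice (hG : ContDiffOn ℝ (⊤ : ℕ∞) G (Uo n)) (x : En n) (k : ℕ) (i : Fin n) (ξ : En n) (hξ : ξ ≠ 0) :
    DL (List.replicate k (eb i)) (fun ζ => G (x, ζ)) ξ = DL (List.replicate k (vr i)) G (x, ξ) := by
  have h := pl_slice_r hG x (fun ζ => G (x, ζ)) (fun ζ _ => rfl) (List.replicate k i) ξ hξ
  rw [List.map_replicate] at h
  rw [← h]
  refine congrFun ?_ ξ
  clear h
  induction k with
  | zero => rfl
  | succ k ih =>
    rw [List.replicate_succ, List.replicate_succ]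
    change (fun q => fderiv ℝ (DL (List.replicate k (eb i)) fun ζ => G (x, ζ)) q (eb i)) = pd i (pl (List.replicate k i) _)
    rw [ih]
    rfl

lemma slice_smooth (hG : ContDiffOn ℝ (⊤ : ℕ∞) G (Uo n)) (x : En n) :
    ContDiffOn ℝ (⊤ : ℕ∞) (fun ζ => G (x, ζ)) {ζ | ζ ≠ 0} :=
  hG.comp (contDiff_const.prodMk contDiff_id).contDiffOn (fun _ h => h)

lemma dv_diff (hG : ContDiffOn ℝ (⊤ : ℕ∞) G (Uo n)) (x y : En n) (k : ℕ) (i : Fin n) (ξ : En n) (hξ : ξ ≠ 0) :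
    (dv (eb i))^[k] (fun ω => ((G (x, ω) - G (y, ω) : ℝ) : ℂ)) ξ =
      ((DL (List.replicate k (vr i)) G (x, ξ) - DL (List.replicate k (vr i)) G (y, ξ) : ℝ) : ℂ) := by
  have ho : IsOpen {ζ : En n | ζ ≠ 0} := isOpen_ne
  rw [dv_ofReal ho ((slice_smooth hG x).sub (slice_smooth hG y)) (eb i) k ξ hξ,
    DL_sub ho (slice_smooth hG x) (slice_smooth hG y) _ ξ hξ, DL_slice hG x k i ξ hξ, DL_slice hG y k i ξ hξ]

lemma ph_unif {φ : En n → En n → ℝ} (hφ : PhiClass 2 φ) {ι : Type} [Fintype ι] (l : ι → List (En n × En n))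
    (hl : ∀ a, ∃ I J : List (Fin n), 2 ≤ I.length + J.length ∧ (I.map vr ++ J.map vl).Perm (l a)) :
    ∃ C : ℝ, 0 ≤ C ∧ ∀ a, ∀ x ξ : En n, 1/2 ≤ ‖ξ‖ → ‖ξ‖ ≤ 2 → |DL (l a) (unc φ) (x, ξ)| ≤ C := by
  have : ∀ a, ∃ C : ℝ, 0 ≤ C ∧ ∀ x ξ : En n, 1/2 ≤ ‖ξ‖ → ‖ξ‖ ≤ 2 → |DL (l a) (unc φ) (x, ξ)| ≤ C := by
    intro a
    obtain ⟨I, J, h, hp⟩ := hl a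
    exact phase_bound_ann hφ I J h _ hp
  choose C h0 h using this
  refine ⟨∑ a, C a, Finset.sum_nonneg fun a _ => h0 a, fun a x ξ h1 h2 => (h a x ξ h1 h2).trans ?_⟩
  exact Finset.single_le_sum (f := C) (fun a _ => h0 a) (Finset.mem_univ a)

end Slices

section HadamardMatrix
variable {n : ℕ}

lemma norm_le_sum_coord (v : En n) (b : ℝ) (hb : ∀ i, |v i| ≤ b) : ‖v‖ ≤ n * b := by
  have h : v = ∑ j, v j • eb j := by
    ext i
    simp [eb, Finset.sum_apply, Pi.single_apply]
  rw [h]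
  refine (norm_sum_le _ _).trans ?_
  calc ∑ j, ‖v j • eb j‖ ≤ ∑ _j : Fin n, b := by
        refine Finset.sum_le_sum fun j _ => ?_
        rw [norm_smul]
        simpa [eb] using hb j
    _ = n * b := by simp

lemma mat_norm (N : Matrix (Fin n) (Fin n) ℝ) (b : ℝ) (hb : ∀ i j, |N i j| ≤ b) (v : En n) :
    ‖Matrix.toEuclideanCLM (𝕜 := ℝ) N v‖ ≤ n * (n * b) * ‖v‖ := by
  have : ‖Matrix.toEuclideanCLM (𝕜 := ℝ) N v‖ ≤ n * (n * b * ‖v‖) := by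
    refine norm_le_sum_coord _ _ fun i => ?_
    rw [Matrix.ofLp_toEuclideanCLM]
    unfold Matrix.mulVec dotProduct
    refine (Finset.abs_sum_le_sum_abs _ _).trans ?_
    calc ∑ j, |N i j * v j| ≤ ∑ _j : Fin n, b * ‖v‖ := by
          refine Finset.sum_le_sum fun j _ => ?_
          rw [abs_mul]
          exact mul_le_mul (hb i j) (PiLp.norm_apply_le v j) (abs_nonneg _) ((abs_nonneg _).trans (hb i j))
      _ = n * b * ‖v‖ := by simp; ring
  linarith

lemma inv_entry (M : Matrix (Fin n) (Fin n) ℝ) (C c : ℝ) (hc : 0 < c) (hM : ∀ i j, |M i j| ≤ C)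
    (hd : c ≤ |M.det|) (i j : Fin n) : |M⁻¹ i j| ≤ c⁻¹ * ((n.factorial : ℝ) * (max C 1) ^ n) := by
  rw [Matrix.inv_def, Matrix.smul_apply, Ring.inverse_eq_inv', smul_eq_mul, abs_mul, abs_inv]
  refine mul_le_mul (inv_anti₀ hc hd) ?_ (abs_nonneg _) (by positivity)
  rw [Matrix.adjugate_apply]
  have := Matrix.det_le (A := M.updateRow j (Pi.single i 1)) (abv := AbsoluteValue.abs) (x := max C 1) ?_
  · simpa using this
  · intro a b
    simp only [AbsoluteValue.abs_apply, Matrix.updateRow_apply, Pi.single_apply]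
    split_ifs
    · simp
    · simp
    · exact (hM a b).trans (le_max_left _ _)

lemma had_coord (y : Fin n → En n → ℝ) (hy : ∀ i x, DifferentiableAt ℝ (y i) x) (C Λ c : ℝ)
    (hΛ : 0 ≤ Λ) (hc : 0 < c) (hC : ∀ x i j, |fderiv ℝ (y i) x (eb j)| ≤ C)
    (hL : ∀ x x' i j, |fderiv ℝ (y i) x (eb j) - fderiv ℝ (y i) x' (eb j)| ≤ Λ * ‖x - x'‖)
    (hd : ∀ x, c ≤ |(Matrix.of fun i j => fderiv ℝ (y i) x (eb j)).det|) :
    ∃ B : ℝ, 0 < B ∧ ∀ x x', ‖x - x'‖ ≤ B * ‖(WithLp.toLp 2 fun i => y i x : En n) - WithLp.toLp 2 fun i => y i x'‖ := by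
  set M : En n → Matrix (Fin n) (Fin n) ℝ := fun x => Matrix.of fun i j => fderiv ℝ (y i) x (eb j) with hMd
  have hu : ∀ x, IsUnit (M x).det := fun x => by
    rw [isUnit_iff_ne_zero]; intro h0
    have := hd x
    rw [h0, abs_zero] at this; linarith
  set b := c⁻¹ * ((n.factorial : ℝ) * (max C 1) ^ n)
  have hb : 0 < b := by positivity
  let Lc : En n → En n ≃L[ℝ] En n := fun x =>
    ContinuousLinearEquiv.equivOfInverse (Matrix.toEuclideanCLM (𝕜 := ℝ) (M x)) (Matrix.toEuclideanCLM (𝕜 := ℝ) (M x)⁻¹)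
      (fun v => by
        rw [← mul_apply_eq_comp, ← map_mul, Matrix.nonsing_inv_mul _ (hu x), map_one]; rfl)
      (fun v => by
        rw [← mul_apply_eq_comp, ← map_mul, Matrix.mul_nonsing_inv _ (hu x), map_one]; rfl)
  refine ⟨2 * (n * (n * b) + 1), by positivity, fun x x' => ?_⟩
  refine hadamard (fun x => WithLp.toLp 2 fun i => y i x) (fun x => Matrix.toEuclideanCLM (𝕜 := ℝ) (M x)) ?_ Lc
    (fun x => by ext v; rfl) (n * (n * b) + 1) (n * (n * Λ)) (by positivity) (by positivity) ?_ ?_ x x'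
  · intro x
    rw [← hasFDerivWithinAt_univ, hasFDerivWithinAt_euclidean]
    intro i
    rw [hasFDerivWithinAt_univ]
    refine (hy i x).hasFDerivAt.congr_fderiv ?_
    refine ContinuousLinearMap.ext fun v => ?_
    rw [clm_coord (fderiv ℝ (y i) x) v]
    simp only [ContinuousLinearMap.comp_apply]
    change _ = (Matrix.toEuclideanCLM (𝕜 := ℝ) (M x) v) i
    rw [Matrix.ofLp_toEuclideanCLM]
    simp only [Matrix.mulVec, dotProduct, hMd, Matrix.of_apply]
    exact Finset.sum_congr rfl fun j _ => mul_comm _ _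
  · intro x v
    refine (mat_norm (M x)⁻¹ b (fun i j => inv_entry (M x) C c hc (hC x) (hd x) i j) v).trans ?_
    nlinarith [norm_nonneg v]
  · intro x z
    rw [← map_sub]
    refine ContinuousLinearMap.opNorm_le_bound _ (by positivity) fun v => ?_
    refine (mat_norm (M x - M z) (Λ * ‖x - z‖) (fun i j => ?_) v).trans (le_of_eq (by ring))
    simpa [hMd] using hL x z i j

end HadamardMatrix

section PhaseFacts
variable {n : ℕ}

lemma inner_eb (y : En n) (i : Fin n) : ⟪y, eb i⟫ = y i := by
  simp [eb, EuclideanSpace.inner_single_right]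

lemma DL_const_zero {V : Type} [NormedAddCommGroup V] [NormedSpace ℝ V] (l : List V) :
    DL l (fun _ : V => (0 : ℝ)) = fun _ => 0 := by
  induction l with
  | nil => rfl
  | cons v l ih =>
    change (fun q => fderiv ℝ (DL l fun _ => (0 : ℝ)) q v) = _
    rw [ih]; ext q; simp

lemma DL_inner_one (y : En n) (i : Fin n) : DL [eb i] (fun ω => ⟪y, ω⟫) = fun _ => y i := by
  ext ω
  change fderiv ℝ (fun ω : En n => ⟪y, ω⟫) ω (eb i) = _
  have : HasFDerivAt (fun ω : En n => ⟪y, ω⟫) (innerSL ℝ y) ω := (innerSL ℝ y).hasFDerivAt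
  rw [this.fderiv, innerSL_apply_apply, inner_eb]

lemma DL_inner_two (y : En n) (i : Fin n) (k : ℕ) :
    DL (List.replicate (k + 2) (eb i)) (fun ω => ⟪y, ω⟫) = fun _ => 0 := by
  have : List.replicate (k + 2) (eb i) = List.replicate k (eb i) ++ [eb i] ++ [eb i] := by
    rw [List.append_assoc]
    exact (List.replicate_append_replicate (n := k) (m := 2)).symm
  rw [this, DL_append, DL_append, DL_inner_one]
  have h2 : DL [eb i] (fun _ : En n => y i) = fun _ => 0 := by
    ext ω
    change fderiv ℝ (fun _ : En n => y i) ω (eb i) = 0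
    simp
  rw [h2, DL_const_zero]

lemma inner_smooth (y : En n) : ContDiff ℝ (⊤ : ℕ∞) (fun ω : En n => ⟪y, ω⟫) := (innerSL ℝ y).contDiff

lemma max_coord [NeZero n] (v : En n) : ∃ i, ‖v‖ ≤ n * |v i| := by
  obtain ⟨i, _, hi⟩ := Finset.exists_max_image Finset.univ (fun i => |v i|) ⟨0, Finset.mem_univ _⟩
  exact ⟨i, norm_le_sum_coord v _ fun j => hi j (Finset.mem_univ _)⟩

lemma Js_le_of {v : En n} {N : ℕ} {f : En n → ℂ} {ω : En n} {C : ℝ} (h : ∀ k ≤ N, ‖(dv v)^[k] f ω‖ ≤ C) :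
    Js v N f ω ≤ (N + 1) * C := by
  unfold Js
  calc _ ≤ ∑ _j ∈ Finset.range (N + 1), C :=
        Finset.sum_le_sum fun j hj => h j (by simpa [Nat.lt_succ_iff] using hj)
    _ = _ := by simp

/-- Linear phases are admissible. -/
lemma PH_linear [NeZero n] (Y : En n → En n) (B C : ℝ) (hB : 0 < B) (hC0 : 0 ≤ C) (hY : ∀ x y, ‖x - y‖ ≤ B * ‖Y x - Y y‖)
    (hY2 : ∀ x y, ‖Y x - Y y‖ ≤ C * ‖x - y‖) (Ω : Set (En n)) (N : ℕ) :
    PH Ω (fun x ω => ⟪Y x, ω⟫) N (1 / (B * n)) ((N + 1) * C) := by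
  have hn : (0 : ℝ) < n := by exact_mod_cast Nat.pos_of_ne_zero (NeZero.ne n)
  refine ⟨fun x => (Complex.ofRealCLM.contDiff.comp (inner_smooth (Y x))).contDiffOn, fun x y => ?_⟩
  obtain ⟨i, hi⟩ := max_coord (Y x - Y y)
  have he : (fun ω : En n => ((⟪Y x, ω⟫ - ⟪Y y, ω⟫ : ℝ) : ℂ)) = fun ω => ((⟪Y x - Y y, ω⟫ : ℝ) : ℂ) := by
    ext ω; rw [inner_sub_left]
  have hk : ∀ k ω, (dv (eb i))^[k] (fun ω : En n => ((⟪Y x - Y y, ω⟫ : ℝ) : ℂ)) ω =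
      ((DL (List.replicate k (eb i)) (fun ω => ⟪Y x - Y y, ω⟫) ω : ℝ) : ℂ) := fun k ω =>
    dv_ofReal isOpen_univ (inner_smooth _).contDiffOn (eb i) k ω (Set.mem_univ _)
  have h1 : ∀ ω, dv (eb i) (fun ω : En n => ((⟪Y x - Y y, ω⟫ : ℝ) : ℂ)) ω = (((Y x - Y y) i : ℝ) : ℂ) := by
    intro ω
    have := hk 1 ω
    rw [show List.replicate 1 (eb i) = [eb i] from rfl, DL_inner_one] at this
    simpa using this
  refine ⟨i, fun ω _ => ?_⟩
  rw [he]
  constructor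
  · rw [h1 ω, Complex.norm_real, Real.norm_eq_abs, one_div, inv_mul_le_iff₀ (by positivity)]
    calc _ ≤ _ := hY x y
      _ ≤ B * (n * |(Y x - Y y) i|) := by gcongr
      _ = _ := by ring
  · rw [mul_assoc]
    refine Js_le_of fun k _ => ?_
    rw [← Function.iterate_succ_apply]
    cases k with
    | zero =>
      change ‖dv (eb i) _ ω‖ ≤ _
      rw [h1 ω, Complex.norm_real]
      exact (PiLp.norm_apply_le (Y x - Y y) i).trans (hY2 x y)
    | succ k =>
      rw [hk, DL_inner_two]
      simp
      positivity

lemma euler {φ : En n → En n → ℝ} (hφ : PhiClass 2 φ) (x ω : En n) (hω : ω ≠ 0) :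
    φ x ω = ∑ j, ω j * DL [vr j] (unc φ) (x, ω) := by
  have hd := slice_r_hasFDeriv (G := unc φ) hφ.1 [] x ω hω
  change DifferentiableAt ℝ (φ x) ω ∧ ∀ j, fderiv ℝ (φ x) ω (eb j) = _ at hd
  have h1 : HasDerivAt (fun t : ℝ => φ x (t • ω)) (fderiv ℝ (φ x) ω ω) 1 := by
    have hl : HasDerivAt (fun t : ℝ => t • ω) ω 1 := by
      simpa using (hasDerivAt_id (1 : ℝ)).smul_const ω
    have hd' : HasFDerivAt (φ x) (fderiv ℝ (φ x) ω) ((1 : ℝ) • ω) := by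
      rw [one_smul]; exact hd.1.hasFDerivAt
    exact hd'.comp_hasDerivAt 1 hl
  have h2 : HasDerivAt (fun t : ℝ => φ x (t • ω)) (φ x ω) 1 := by
    have : HasDerivAt (fun t : ℝ => t * φ x ω) (φ x ω) 1 := by
      simpa using (hasDerivAt_id (1 : ℝ)).mul_const (φ x ω)
    refine this.congr_of_eventuallyEq ?_
    filter_upwards [lt_mem_nhds (show (0 : ℝ) < 1 by norm_num)] with t ht using hφ.2.1 x ω t ht
  rw [h2.unique h1, clm_coord]
  exact Finset.sum_congr rfl fun j _ => by rw [hd.2 j]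

end PhaseFacts

section PhaseMain
variable {n : ℕ}

/-- Frequency gradient of the phase at a fixed direction. -/
def Yg (φ : En n → En n → ℝ) (ω0 x : En n) : En n := WithLp.toLp 2 fun i => DL [vr i] (unc φ) (x, ω0)

lemma ball_ann {ω0 ω : En n} (h0 : ‖ω0‖ = 1) {δ : ℝ} (hδ : δ ≤ 1/2) (h : ω ∈ Metric.ball ω0 δ) :
    1/2 ≤ ‖ω‖ ∧ ‖ω‖ ≤ 2 ∧ ω ≠ 0 := by
  rw [Metric.mem_ball, dist_eq_norm] at h
  have h1 := norm_sub_norm_le ω ω0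
  have h2 := norm_sub_norm_le ω0 ω
  rw [norm_sub_rev] at h2
  have h4 : 1/2 ≤ ‖ω‖ := by linarith
  refine ⟨h4, by linarith, fun h3 => ?_⟩
  rw [h3, norm_zero] at h4
  linarith

lemma Yg_bilip {φ : En n → En n → ℝ} (hφ : PhiClass 2 φ) (hsnd : SNDcond φ) (ω0 : En n) (h0 : ‖ω0‖ = 1) :
    ∃ B C : ℝ, 0 < B ∧ 0 ≤ C ∧ (∀ x y, ‖x - y‖ ≤ B * ‖Yg φ ω0 x - Yg φ ω0 y‖) ∧
      ∀ x y, ‖Yg φ ω0 x - Yg φ ω0 y‖ ≤ C * ‖x - y‖ := by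
  have hG : ContDiffOn ℝ (⊤ : ℕ∞) (unc φ) (Uo n) := hφ.1
  have hω : ω0 ≠ 0 := by rw [← norm_pos_iff]; linarith
  obtain ⟨C2, hC20, hC2⟩ := ph_unif hφ (ι := Fin n × Fin n) (fun a => [vl a.1, vr a.2])
    (fun a => ⟨[a.2], [a.1], by simp, by simpa using List.Perm.swap _ _ _⟩)
  obtain ⟨C3, hC30, hC3⟩ := ph_unif hφ (ι := Fin n × Fin n × Fin n) (fun a => [vl a.1, vl a.2.1, vr a.2.2])
    (fun a => ⟨[a.2.2], [a.1, a.2.1], by simp, by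
      simpa using (List.perm_append_comm (l₁ := [vr a.2.2]) (l₂ := [vl a.1, vl a.2.1]))⟩)
  obtain ⟨c, hc, hcd⟩ := hsnd
  have hsl := fun i x => slice_l_hasFDeriv hG [vr i] x ω0 hω
  obtain ⟨B, hB, hBx⟩ := had_coord (fun i x => DL [vr i] (unc φ) (x, ω0)) (fun i x => (hsl i x).1) C2 (n * C3) c
    (by positivity) hc (fun x i j => by
      rw [(hsl i x).2]; exact hC2 (j, i) x ω0 (by linarith) (by linarith))
    (fun x x' i j => by
      rw [(hsl i x).2, (hsl i x').2]
      exact lip_x hG _ ω0 hω C3 hC30 (fun k x => hC3 (k, j, i) x ω0 (by linarith) (by linarith)) x x')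
    (fun x => by
      have := hcd x ω0 hω
      convert this using 2
      rw [← Matrix.det_transpose]
      congr 1
      ext j i
      simp only [Matrix.transpose_apply, Matrix.of_apply, mixHess]
      have he : (fun y => pd i (φ y) ω0) = fun y => DL [vr i] (unc φ) (y, ω0) := by
        ext y
        exact pl_slice_r hG y (φ y) (fun _ _ => rfl) [i] ω0 hω
      rw [he]
      rfl)
  refine ⟨B, n * (n * C2), hB, by positivity, hBx, fun x y => ?_⟩
  rw [mul_assoc]
  refine norm_le_sum_coord _ _ fun i => ?_
  exact lip_x hG [vr i] ω0 hω C2 hC20 (fun j x => hC2 (j, i) x ω0 (by linarith) (by linarith)) x y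

lemma phase_PH {φ : En n → En n → ℝ} (hφ : PhiClass 2 φ) (hsnd : SNDcond φ) [NeZero n] (ω0 : En n) (h0 : ‖ω0‖ = 1) (N : ℕ) :
    ∃ δ c C : ℝ, 0 < δ ∧ δ ≤ 1/2 ∧ 0 < c ∧ PH (Metric.ball ω0 δ) φ N c C := by
  have hn : (0 : ℝ) < n := by exact_mod_cast Nat.pos_of_ne_zero (NeZero.ne n)
  have hG : ContDiffOn ℝ (⊤ : ℕ∞) (unc φ) (Uo n) := hφ.1
  obtain ⟨B, -, hB, -, hBx, -⟩ := Yg_bilip hφ hsnd ω0 h0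
  obtain ⟨C1, hC10, hC1⟩ := ph_unif hφ (ι := Fin n × Fin n × Fin (N + 1))
    (fun a => vl a.1 :: List.replicate (a.2.2 + 1) (vr a.2.1))
    (fun a => ⟨List.replicate (a.2.2 + 1) a.2.1, [a.1], by simp, by
      rw [List.map_replicate]
      exact (List.perm_append_comm (l₂ := [vl a.1]))⟩)
  obtain ⟨C4, hC40, hC4⟩ := ph_unif hφ (ι := Fin n × Fin n × Fin n) (fun a => [vl a.1, vr a.2.1, vr a.2.2])
    (fun a => ⟨[a.2.1, a.2.2], [a.1], by simp, by
      simpa using (List.perm_append_comm (l₁ := [vr a.2.1, vr a.2.2]) (l₂ := [vl a.1]))⟩)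
  set δ : ℝ := min (1/2) (1 / (2 * B * n * (n * (n * C4) + 1))) with hδ
  have hδ0 : 0 < δ := by positivity
  have hδ2 : δ ≤ 1/2 := min_le_left _ _
  have hδ3 : n * (n * C4) * δ ≤ 1 / (2 * B * n) := by
    have : δ ≤ 1 / (2 * B * n * (n * (n * C4) + 1)) := min_le_right _ _
    calc n * (n * C4) * δ ≤ (n * (n * C4) + 1) * (1 / (2 * B * n * (n * (n * C4) + 1))) := by gcongr; linarith
      _ = _ := by field_simp
  refine ⟨δ, 1 / (2 * B * n), (N + 1) * (n * C1), hδ0, hδ2, by positivity, ?_, ?_⟩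
  · intro x
    exact Complex.ofRealCLM.contDiff.comp_contDiffOn
      ((slice_smooth hG x).mono fun ω hω => (ball_ann h0 hδ2 hω).2.2)
  intro x y
  obtain ⟨i, hi⟩ := max_coord (Yg φ ω0 x - Yg φ ω0 y)
  refine ⟨i, fun ω hω => ?_⟩
  obtain ⟨ha1, ha2, ha3⟩ := ball_ann h0 hδ2 hω
  have hk := fun k => dv_diff hG x y k i ω ha3
  change ∀ k, (dv (eb i))^[k] (fun ω => ((φ x ω - φ y ω : ℝ) : ℂ)) ω = _ at hk
  constructor
  · have h1 := hk 1
    rw [Function.iterate_one] at h1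
    rw [h1, Complex.norm_real, Real.norm_eq_abs]
    have hv := lip_xw hG [vr i] (convex_ball ω0 δ) Metric.isOpen_ball (fun ξ hξ => (ball_ann h0 hδ2 hξ).2.2) C4 hC40
      (fun k j x ξ hξ => hC4 (k, j, i) x ξ (ball_ann h0 hδ2 hξ).1 (ball_ann h0 hδ2 hξ).2.1) x y hω (Metric.mem_ball_self hδ0)
    have hw : ‖ω - ω0‖ ≤ δ := by rw [← dist_eq_norm]; exact (Metric.mem_ball.1 hω).le
    have h3 : n * (n * C4 * ‖x - y‖) * ‖ω - ω0‖ ≤ 1 / (2 * B * n) * ‖x - y‖ := by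
      calc _ ≤ n * (n * C4 * ‖x - y‖) * δ := by gcongr
        _ = n * (n * C4) * δ * ‖x - y‖ := by ring
        _ ≤ _ := by gcongr
    have h4 : ‖x - y‖ ≤ B * (n * |(Yg φ ω0 x - Yg φ ω0 y) i|) := (hBx x y).trans (by gcongr)
    have h5 : 1 / (B * n) * ‖x - y‖ ≤ |(Yg φ ω0 x - Yg φ ω0 y) i| := by
      rw [one_div, inv_mul_le_iff₀ (by positivity)]
      linarith
    have h6 : (Yg φ ω0 x - Yg φ ω0 y) i = DL [vr i] (unc φ) (x, ω0) - DL [vr i] (unc φ) (y, ω0) := rfl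
    rw [h6] at h5
    have h7 : 1 / (B * n) * ‖x - y‖ = 1 / (2 * B * n) * ‖x - y‖ + 1 / (2 * B * n) * ‖x - y‖ := by
      field_simp; ring
    have h8 := abs_sub_abs_le_abs_sub (DL [vr i] (unc φ) (x, ω0) - DL [vr i] (unc φ) (y, ω0))
      (DL [vr i] (unc φ) (x, ω) - DL [vr i] (unc φ) (y, ω))
    rw [abs_sub_comm (DL [vr i] (unc φ) (x, ω0) - DL [vr i] (unc φ) (y, ω0))] at h8
    change _ ≤ |DL [vr i] (unc φ) (x, ω) - DL [vr i] (unc φ) (y, ω)|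
    linarith
  · rw [mul_assoc]
    refine Js_le_of fun k hkN => ?_
    rw [← Function.iterate_succ_apply, hk, Complex.norm_real]
    exact lip_x hG _ ω ha3 C1 hC10 (fun j x => hC1 (j, i, ⟨k, by omega⟩) x ω ha1 ha2) x y

lemma phase_theta {φ : En n → En n → ℝ} (hφ : PhiClass 2 φ) (ω0 : En n) (h0 : ‖ω0‖ = 1) (N : ℕ) :
    ∃ C : ℝ, 0 ≤ C ∧ ∀ x, ∀ ω ∈ Metric.ball ω0 (1/2), ∀ i,
      Js (eb i) N (fun ω => ((φ x ω - ⟪Yg φ ω0 x, ω⟫ : ℝ) : ℂ)) ω ≤ C := by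
  have hG : ContDiffOn ℝ (⊤ : ℕ∞) (unc φ) (Uo n) := hφ.1
  obtain ⟨C5, hC50, hC5⟩ := ph_unif hφ (ι := Fin n × Fin (N + 1))
    (fun a => List.replicate (a.2 + 2) (vr a.1))
    (fun a => ⟨List.replicate (a.2 + 2) a.1, [], by simp, by simp⟩)
  obtain ⟨C6, hC60, hC6⟩ := ph_unif hφ (ι := Fin n × Fin n) (fun a => [vr a.1, vr a.2])
    (fun a => ⟨[a.1, a.2], [], by simp, by simp⟩)
  have hω0 : ω0 ≠ 0 := by rw [← norm_pos_iff]; linarith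
  have hne : ∀ ξ ∈ Metric.ball ω0 (1/2), ξ ≠ 0 := fun ξ hξ => (ball_ann h0 le_rfl hξ).2.2
  have hself : ω0 ∈ Metric.ball ω0 (1/2) := Metric.mem_ball_self (by norm_num)
  have hdist : ∀ ω ∈ Metric.ball ω0 (1/2), ‖ω - ω0‖ ≤ 1 := fun ω hω => by
    rw [← dist_eq_norm]; have := Metric.mem_ball.1 hω; linarith
  have hone : ∀ x, ∀ ω ∈ Metric.ball ω0 (1/2), ∀ i,
      |DL [vr i] (unc φ) (x, ω) - DL [vr i] (unc φ) (x, ω0)| ≤ n * C6 := fun x ω hω i => by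
    have := lip_w hG [vr i] (convex_ball ω0 (1/2)) Metric.isOpen_ball hne x C6 hC60
      (fun j ξ hξ => hC6 (j, i) x ξ (ball_ann h0 le_rfl hξ).1 (ball_ann h0 le_rfl hξ).2.1) hω hself
    exact this.trans (mul_le_of_le_one_right (by positivity) (hdist ω hω))
  refine ⟨(N + 1) * (C5 + n * C6 + n * (n * C6)), by positivity, fun x ω hω i => Js_le_of fun k hk => ?_⟩
  change ‖(dv (eb i))^[k] (fun ω => ((unc φ (x, ω) - ⟪Yg φ ω0 x, ω⟫ : ℝ) : ℂ)) ω‖ ≤ _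
  rw [dv_ofReal Metric.isOpen_ball (((slice_smooth hG x).mono hne).sub (inner_smooth _).contDiffOn) (eb i) k ω hω,
    Complex.norm_real, Real.norm_eq_abs, DL_sub Metric.isOpen_ball ((slice_smooth hG x).mono hne) (inner_smooth _).contDiffOn _ ω hω]
  have hp1 : 0 ≤ n * C6 := by positivity
  have hp2 : 0 ≤ n * (n * C6) := by positivity
  obtain ⟨ha1, ha2, ha3⟩ := ball_ann h0 le_rfl hω
  match k, hk with
  | 0, _ =>
    change |φ x ω - ⟪Yg φ ω0 x, ω⟫| ≤ _
    have hz : φ x ω0 - ⟪Yg φ ω0 x, ω0⟫ = 0 := by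
      rw [euler hφ x ω0 hω0, sub_eq_zero, PiLp.inner_apply]
      exact Finset.sum_congr rfl fun j _ => by simp [Yg]
    have hd := fun ξ (hξ : ξ ∈ Metric.ball ω0 (1/2)) => slice_r_hasFDeriv (G := unc φ) hφ.1 [] x ξ (hne ξ hξ)
    change ∀ ξ, ξ ∈ _ → DifferentiableAt ℝ (φ x) ξ ∧ ∀ j, fderiv ℝ (φ x) ξ (eb j) = _ at hd
    have hi : ∀ ξ, HasFDerivAt (fun ω : En n => ⟪Yg φ ω0 x, ω⟫) (innerSL ℝ (Yg φ ω0 x)) ξ := fun ξ => (innerSL ℝ _).hasFDerivAt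
    have := mv_lemma (convex_ball ω0 (1/2)) Metric.isOpen_ball (fun ω => φ x ω - ⟪Yg φ ω0 x, ω⟫)
      (fun ξ hξ => (hd ξ hξ).1.sub (hi ξ).differentiableAt) (n * C6) hp1
      (fun ξ hξ j => by
        rw [fderiv_fun_sub (hd ξ hξ).1 (hi ξ).differentiableAt, _root_.sub_apply, (hd ξ hξ).2, (hi ξ).fderiv,
          innerSL_apply_apply, inner_eb]
        exact hone x ξ hξ j) hω hself
    rw [hz, sub_zero] at this
    have h2 := this.trans (mul_le_of_le_one_right hp2 (hdist ω hω))
    linarith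
  | 1, _ =>
    have h1 := DL_slice hG x 1 i ω ha3
    rw [h1, show List.replicate 1 (eb i) = [eb i] from rfl, DL_inner_one]
    have := hone x ω hω i
    change |DL [vr i] (unc φ) (x, ω) - DL [vr i] (unc φ) (x, ω0)| ≤ _
    linarith
  | k + 2, hk =>
    have h1 := DL_slice hG x (k + 2) i ω ha3
    rw [h1, DL_inner_two, sub_zero]
    have := hC5 (i, ⟨k, by omega⟩) x ω ha1 ha2
    simp only at this
    linarith

end PhaseMain

section Piece
variable {n : ℕ}

lemma eta_bound (v : En n) (N : ℕ) {η : En n → ℂ} (hη : ContDiff ℝ (⊤ : ℕ∞) η) (hc : HasCompactSupport η) :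
    ∃ C : ℝ, 0 ≤ C ∧ ∀ ω, Js v N η ω ≤ C := by
  have h1 : Continuous (Js v N η) := by
    rw [← continuousOn_univ]
    exact Js_continuousOn isOpen_univ v N hη.contDiffOn
  have h2 : HasCompactSupport (Js v N η) := by
    refine HasCompactSupport.intro hc fun x hx => Js_off_tsupport v N hx
  obtain ⟨C, hC⟩ := h1.bounded_above_of_compact_support h2
  exact ⟨max C 0, le_max_right _ _, fun ω => (le_abs_self _).trans ((hC ω).trans (le_max_left _ _))⟩

lemma piece0 {u : En n} {δ : ℝ} (hδ : 0 < δ) {ψ : En n → En n → ℝ} {c C : ℝ} (hc : 0 < c)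
    (hψ : PH (Metric.ball u δ) ψ (n+1) c C) (hψm : Measurable (fun q : En n × En n => ψ q.1 q.2))
    (p : ℝ≥0∞) (hp : 2 ≤ p) (r : ℝ≥0∞) (hr : r⁻¹ = p⁻¹ + 2⁻¹) {η : En n → ℂ}
    (hη : ContDiff ℝ (⊤ : ℕ∞) η) (hηc : HasCompactSupport η) (hηs : tsupport η ⊆ Metric.ball u δ) :
    ∃ K : ℝ, 0 ≤ K ∧ ∀ (l κ : ℝ), 0 < l → 1 ≤ κ →
    ∀ (A : En n → En n → ℂ) (b : En n → En n → ℝ≥0∞) (h : En n → ℂ) (M : ℝ), 0 ≤ M →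
    Measurable (fun q : En n × En n => A q.1 q.2) →
    Measurable (fun q : En n × En n => b q.1 q.2) → Measurable h →
    (∀ x, ContDiffOn ℝ (⊤ : ℕ∞) (A x) (Metric.ball u δ)) →
    (∀ x, ∀ ω ∈ Metric.ball u δ, ∀ i, ENNReal.ofReal (Js (κ⁻¹ • eb i) (n+1) (A x) ω) ≤ b x ω) →
    (∀ ω ∈ Metric.ball u δ, eLpNorm (fun x => b x ω) p volume ≤ ENNReal.ofReal M) →
    ∫⁻ ω, ‖h ω‖ₑ ^ 2 ≠ ∞ →
    eLpNorm (fun x => ∫ ω, Complex.exp (Complex.I * ((l * ψ x ω : ℝ) : ℂ)) * (η ω * A x ω) * h ω) r volume ≤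
      ENNReal.ofReal (K * (κ / l) ^ ((n:ℝ)/2) * M) * (∫⁻ ω, ‖h ω‖ₑ ^ 2) ^ (1/2 : ℝ) := by
  have hbo : IsOpen (Metric.ball u δ) := Metric.isOpen_ball
  obtain ⟨K, hK0, hK⟩ := TP hbo hc hψ hψm p hp r hr (Metric.ball u δ) hbo.measurableSet
    (measure_ball_lt_top).ne
  choose Cη hCη0 hCη using fun i : Fin n => eta_bound (eb i) (n+1) hη hηc
  set D : ℝ := ∑ i, 4 ^ (n+1) * Cη i with hD
  have hD0 : 0 ≤ D := Finset.sum_nonneg fun i _ => by have := hCη0 i; positivity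
  refine ⟨K * D, by positivity, ?_⟩
  intro l κ hl hκ A b h M hM0 hA hb hh hAs hAb hbM hH
  have hκ0 : 0 < κ := by linarith
  have hts : ∀ x, tsupport (fun ω => η ω * A x ω) ⊆ tsupport η := fun x => tsupport_mul_sub
  have main := hK l κ hl hκ (fun x ω => η ω * A x ω)
    (fun x ω => (Metric.ball u δ).indicator (fun ω => ENNReal.ofReal D * b x ω) ω) h (D * M) (by positivity)
    ((hη.continuous.measurable.comp measurable_snd).mul hA) ?_ hh
    (fun x => smooth_mul_of_tsupport hbo hη hηs (hAs x))
    (fun x => hηc.of_isClosed_subset (isClosed_tsupport _) (hts x))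
    (fun x => (hts x).trans hηs) ?_ ?_ ?_ hH
  · refine main.trans (le_of_eq ?_)
    congr 2
    ring
  · have : (fun q : En n × En n => (Metric.ball u δ).indicator (fun ω => ENNReal.ofReal D * b q.1 ω) q.2) =
        (Prod.snd ⁻¹' Metric.ball u δ).indicator fun q => ENNReal.ofReal D * b q.1 q.2 := by
      ext q; simp [Set.indicator]
    rw [this]
    exact (hb.const_mul _).indicator (hbo.measurableSet.preimage measurable_snd)
  · intro x ω
    by_cases hω : ω ∈ Metric.ball u δ
    · rw [Set.indicator_of_mem hω]
      unfold Jt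
      rw [ENNReal.ofReal_sum_of_nonneg fun i _ => Js_nonneg _ _ _ _, hD,
        ENNReal.ofReal_sum_of_nonneg fun i _ => by have := hCη0 i; positivity, Finset.sum_mul]
      refine Finset.sum_le_sum fun i _ => ?_
      have h1 := Js_mul hbo (κ⁻¹ • eb i) (n+1) hη.contDiffOn (hAs x) ω hω
      have h2 : Js (κ⁻¹ • eb i) (n+1) η ω ≤ Cη i := 
        (Js_smul_le (eb i) κ⁻¹ (by positivity) (inv_le_one_of_one_le₀ hκ) _ _ _).trans (hCη i ω)
      have h3 : Js (κ⁻¹ • eb i) (n + 1) (fun ω => η ω * A x ω) ω ≤ (4 ^ (n+1) * Cη i) * Js (κ⁻¹ • eb i) (n+1) (A x) ω := by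
        refine h1.trans ?_
        rw [mul_assoc]
        have := Js_nonneg (κ⁻¹ • eb i) (n+1) (A x) ω
        gcongr
      calc _ ≤ ENNReal.ofReal ((4 ^ (n+1) * Cη i) * Js (κ⁻¹ • eb i) (n+1) (A x) ω) := ENNReal.ofReal_le_ofReal h3
        _ = ENNReal.ofReal (4 ^ (n+1) * Cη i) * ENNReal.ofReal (Js (κ⁻¹ • eb i) (n+1) (A x) ω) :=
          ENNReal.ofReal_mul (by have := hCη0 i; positivity)
        _ ≤ _ := by
          have := hAb x ω hω i
          gcongr
    · have h0 : Jt κ (n+1) (fun ω => η ω * A x ω) ω = 0 := by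
        unfold Jt
        refine Finset.sum_eq_zero fun i _ => Js_off_tsupport _ _ fun h => hω (hηs (hts x h))
      simp [h0]
  · intro x ω hω
    exact Set.indicator_of_notMem hω _
  · intro ω hω
    simp only [Set.indicator_of_mem hω]
    have : eLpNorm (fun x => ENNReal.ofReal D * b x ω) p volume ≤ ENNReal.ofReal D * eLpNorm (fun x => b x ω) p volume := by
      exact eLpNorm_le_nnreal_smul_eLpNorm_of_ae_le_mul' (c := D.toNNReal) (Filter.Eventually.of_forall fun x => le_rfl) p
    refine this.trans ?_
    rw [ENNReal.ofReal_mul hD0]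
    have := hbM ω hω
    gcongr

end Piece

section Piece2
variable {n : ℕ}

lemma lint_scale (l : ℝ) (hl : 0 < l) (f : En n → ℝ≥0∞) :
    ∫⁻ ω, f (l • ω) = ENNReal.ofReal ((l ^ n)⁻¹) * ∫⁻ ξ, f ξ := by
  have h := lintegral_map_equiv (μ := volume) f (MeasurableEquiv.smul₀ l hl.ne' : En n ≃ᵐ En n)
  rw [MeasurableEquiv.coe_smul₀, Measure.map_addHaar_smul _ hl.ne'] at h
  rw [← h, lintegral_smul_measure]
  simp [abs_of_pos hl]

lemma eLp_smul (l : ℝ) (hl : 0 ≤ l) (F : En n → ℂ) (r : ℝ≥0∞) :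
    eLpNorm (fun x => l • F x) r volume ≤ ENNReal.ofReal l * eLpNorm F r volume := by
  refine (eLpNorm_const_smul_le (c := l) (f := F)).trans (le_of_eq ?_)
  congr 1
  rw [Real.enorm_eq_ofReal hl]

lemma piece {u : En n} {δ : ℝ} (hδ : 0 < δ) {ψ : En n → En n → ℝ} {c C : ℝ} (hc : 0 < c)
    (hψ : PH (Metric.ball u δ) ψ (n+1) c C) (hψm : Measurable (fun q : En n × En n => ψ q.1 q.2))
    (p : ℝ≥0∞) (hp : 2 ≤ p) (r : ℝ≥0∞) (hr : r⁻¹ = p⁻¹ + 2⁻¹) :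
    ∃ K : ℝ, 0 ≤ K ∧ ∀ (l κ : ℝ), 0 < l → 1 ≤ κ →
    ∀ (A : En n → En n → ℂ) (b : En n → En n → ℝ≥0∞) (h : En n → ℂ) (M : ℝ) (E : Set (En n))
      (H : En n → En n → ℂ), 0 ≤ M →
    Measurable (fun q : En n × En n => A q.1 q.2) →
    Measurable (fun q : En n × En n => b q.1 q.2) → Measurable h → MeasurableSet E →
    (∀ x, ContDiffOn ℝ (⊤ : ℕ∞) (A x) (Metric.ball u δ)) →
    (∀ x, ∀ ω ∈ Metric.ball u δ, ∀ i, ENNReal.ofReal (Js (κ⁻¹ • eb i) (n+1) (A x) ω) ≤ b x ω) →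
    (∀ ω ∈ Metric.ball u δ, eLpNorm (fun x => b x ω) p volume ≤ ENNReal.ofReal M) →
    ∫⁻ ω, ‖h ω‖ₑ ^ 2 ≠ ∞ →
    (∀ ω, l • ω ∈ E → ω ∈ Metric.ball u (δ/2)) →
    (∀ x ω, l • ω ∈ E → H x (l • ω) = Complex.exp (Complex.I * ((l * ψ x ω : ℝ) : ℂ)) * A x ω) →
    eLpNorm (fun x => ∫ ξ in E, H x ξ * h ξ) r volume ≤
      ENNReal.ofReal (K * κ ^ ((n:ℝ)/2) * M) * (∫⁻ ω, ‖h ω‖ₑ ^ 2) ^ (1/2 : ℝ) := by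
  let g : ContDiffBump u := ⟨δ/2, 3*δ/4, by positivity, by linarith⟩
  set η : En n → ℂ := fun ω => ((g ω : ℝ) : ℂ) with hη
  have hη1 : ContDiff ℝ (⊤ : ℕ∞) η := Complex.ofRealCLM.contDiff.comp g.contDiff
  have hηts : tsupport η ⊆ Metric.closedBall u (3*δ/4) := by
    rw [← show tsupport g = Metric.closedBall u (3*δ/4) from g.tsupport_eq]
    refine closure_mono fun x hx => ?_
    simp only [Function.mem_support, hη, ne_eq, ofReal_eq_zero] at hx ⊢
    exact hx
  have hηc : HasCompactSupport η :=
    (isCompact_closedBall u (3*δ/4)).of_isClosed_subset (isClosed_tsupport _) hηts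
  have hηs : tsupport η ⊆ Metric.ball u δ :=
    hηts.trans (Metric.closedBall_subset_ball (by linarith))
  obtain ⟨K, hK0, hK⟩ := piece0 hδ hc hψ hψm p hp r hr hη1 hηc hηs
  refine ⟨K, hK0, ?_⟩
  intro l κ hl hκ A b h M E H hM hA hb hh hE hAs hAb hbM hH hEω hHE
  have hκ0 : 0 < κ := by linarith
  set h' : En n → ℂ := fun ω => E.indicator h (l • ω) with hh'
  have hm' : Measurable h' := (hh.indicator hE).comp (measurable_const_smul l)
  have hle : ∫⁻ ω, ‖h' ω‖ₑ ^ 2 ≤ ENNReal.ofReal ((l ^ n)⁻¹) * ∫⁻ ξ, ‖h ξ‖ₑ ^ 2 := by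
    rw [← lint_scale l hl]
    refine lintegral_mono fun ω => ?_
    gcongr
    by_cases hx : l • ω ∈ E <;> simp [hh', hx]
  have key : ∀ x, ∫ ξ in E, H x ξ * h ξ = ((l:ℝ)^n) • ∫ ω, Complex.exp (Complex.I * ((l * ψ x ω : ℝ) : ℂ)) * (η ω * A x ω) * h' ω := by
    intro x
    rw [← integral_indicator hE]
    have h1 := Measure.integral_comp_smul (volume : Measure (En n)) (E.indicator fun ξ => H x ξ * h ξ) l
    rw [finrank_euclideanSpace_fin, abs_of_pos (by positivity)] at h1
    have h2 : ∫ ξ, (E.indicator fun ξ => H x ξ * h ξ) ξ = (l^n) • ∫ ω, (E.indicator fun ξ => H x ξ * h ξ) (l • ω) := by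
      rw [h1, smul_smul, mul_inv_cancel₀ (by positivity), one_smul]
    rw [h2]
    congr 1
    refine integral_congr_ae (Filter.Eventually.of_forall fun ω => ?_)
    by_cases hx : l • ω ∈ E
    · have hg : η ω = 1 := by
        have : g ω = 1 := g.one_of_mem_closedBall (Metric.ball_subset_closedBall (hEω ω hx))
        simp [hη, this]
      simp only [Set.indicator_of_mem hx, hh', hg, one_mul, hHE x ω hx]
    · simp only [Set.indicator_of_notMem hx, hh', mul_zero]
  simp only [key]
  have hfin : ∫⁻ ω, ‖h' ω‖ₑ ^ 2 ≠ ∞ := ne_top_of_le_ne_top (ENNReal.mul_ne_top ENNReal.ofReal_ne_top hH) hle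
  have main := hK l κ hl hκ A b h' M hM hA hb hm' hAs hAb hbM hfin
  have e1 : eLpNorm (fun x => ((l:ℝ)^n) • ∫ ω, Complex.exp (Complex.I * ((l * ψ x ω : ℝ) : ℂ)) * (η ω * A x ω) * h' ω) r volume ≤ ENNReal.ofReal (l^n) * eLpNorm (fun x => ∫ ω, Complex.exp (Complex.I * ((l * ψ x ω : ℝ) : ℂ)) * (η ω * A x ω) * h' ω) r volume :=
    eLp_smul _ (by positivity) _ _
  refine e1.trans ?_
  calc ENNReal.ofReal (l^n) * eLpNorm (fun x => ∫ ω, Complex.exp (Complex.I * ((l * ψ x ω : ℝ) : ℂ)) * (η ω * A x ω) * h' ω) r volume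
      ≤ ENNReal.ofReal (l^n) * (ENNReal.ofReal (K * (κ / l) ^ ((n:ℝ)/2) * M) * (ENNReal.ofReal ((l ^ n)⁻¹) * ∫⁻ ξ, ‖h ξ‖ₑ ^ 2) ^ (1/2:ℝ)) := by
        refine mul_le_mul_right (main.trans ?_) _
        gcongr
    _ = ENNReal.ofReal (K * κ ^ ((n:ℝ)/2) * M) * (∫⁻ ω, ‖h ω‖ₑ ^ 2) ^ (1/2 : ℝ) := by
        rw [ENNReal.mul_rpow_of_nonneg _ _ (by norm_num), ENNReal.ofReal_rpow_of_pos (by positivity),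
          ← mul_assoc, ← mul_assoc, ← ENNReal.ofReal_mul (by positivity), ← ENNReal.ofReal_mul (by positivity)]
        congr 2
        have e2 : ((l^n)⁻¹) ^ (1/2:ℝ) = (l ^ ((n:ℝ)/2))⁻¹ := by
          rw [Real.inv_rpow (by positivity), ← Real.rpow_natCast l n, ← Real.rpow_mul hl.le]
          congr 2; ring
        have e3 : l ^ n = l ^ ((n:ℝ)/2) * l ^ ((n:ℝ)/2) := by
          rw [← Real.rpow_add hl, ← Real.rpow_natCast l n]; congr 1; ring
        rw [e2, e3, Real.div_rpow hκ0.le hl.le]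
        have : 0 < l ^ ((n:ℝ)/2) := by positivity
        field_simp

end Piece2

section RegSec
variable {n : ℕ}

def Reg (p : ℝ≥0∞) (m ρ : ℝ) (a : En n → En n → ℂ) : Prop :=
  (∀ x, ContDiff ℝ (⊤ : ℕ∞) (a x)) ∧
  (∀ i k, Measurable (fun q : En n × En n => (dv (eb i))^[k] (a q.1) q.2)) ∧
  ∀ i k, ∃ C : ℝ, 0 ≤ C ∧ ∀ ξ : En n, eLpNorm (fun x => (dv (eb i))^[k] (a x) ξ) p volume ≤
    ENNReal.ofReal (C * jb ξ (m - ρ * (k:ℝ)))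

lemma foldr_single (i : Fin n) (k : ℕ) (f : En n → ℂ) (L : List (Fin n)) (hL : L.Nodup) :
    L.foldr (fun j g => (pd j)^[(Pi.single i k : Fin n → ℕ) j] g) f = if i ∈ L then (dv (eb i))^[k] f else f := by
  induction L with
  | nil => simp
  | cons j L ih =>
    rw [List.nodup_cons] at hL
    rw [List.foldr_cons, ih hL.2]
    by_cases hj : j = i
    · subst hj
      simp only [Pi.single_eq_same, List.mem_cons, true_or, if_true, if_neg hL.1]
      rfl
    · simp [Pi.single_eq_of_ne hj, Ne.symm hj]

lemma mderiv_single (i : Fin n) (k : ℕ) (f : En n → ℂ) :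
    mderiv (Pi.single i k) f = (dv (eb i))^[k] f := by
  unfold mderiv
  rw [foldr_single i k f _ (List.nodup_finRange n), if_pos (List.mem_finRange i)]

lemma mdeg_single (i : Fin n) (k : ℕ) : mdeg (Pi.single i k : Fin n → ℕ) = k := by
  simp [mdeg]

lemma dvi_zero (v : En n) (k : ℕ) : (dv v)^[k] (0 : En n → ℂ) = 0 := by
  induction k with
  | zero => rfl
  | succ k ih =>
    rw [Function.iterate_succ_apply', ih]
    ext x; simp [dv]

lemma dvi_cont (v : En n) (k : ℕ) {f : En n → ℂ} (hf : ContDiff ℝ (⊤ : ℕ∞) f) :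
    Continuous ((dv v)^[k] f) := by
  rw [← continuousOn_univ]
  exact (dvi_contDiffOn isOpen_univ v k hf.contDiffOn).continuousOn

lemma regularize {p : ℝ≥0∞} {m ρ : ℝ} {a : En n → En n → ℂ} (ha : LpSm p m ρ a) :
    ∃ a', Reg p m ρ a' ∧ ∀ᵐ x ∂(volume : Measure (En n)), a' x = a x := by
  obtain ⟨ha1, ha2, ha3⟩ := ha
  have hm : ∀ i k ξ, AEStronglyMeasurable (fun x => (dv (eb i))^[k] (a x) ξ) (volume : Measure (En n)) := by
    intro i k ξ
    simpa only [mderiv_single] using ha2 (Pi.single i k) ξ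
  let D := TopologicalSpace.denseSeq (En n)
  have hae : ∀ᵐ x ∂(volume : Measure (En n)), ∀ i k N, (dv (eb i))^[k] (a x) (D N) = (hm i k (D N)).mk _ x := by
    rw [ae_all_iff]; intro i
    rw [ae_all_iff]; intro k
    rw [ae_all_iff]; intro N
    exact (hm i k (D N)).ae_eq_mk
  obtain ⟨S, hS, hSm, hS0⟩ : ∃ S : Set (En n), (∀ x ∈ S, ∀ i k N, (dv (eb i))^[k] (a x) (D N) = (hm i k (D N)).mk _ x) ∧
      MeasurableSet S ∧ ∀ᵐ x ∂(volume : Measure (En n)), x ∈ S := by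
    obtain ⟨t, ht1, ht2, ht3⟩ := exists_measurable_superset_of_null (ae_iff.1 hae)
    refine ⟨tᶜ, fun x hx => ?_, ht2.compl, ?_⟩
    · by_contra hc
      exact hx (ht1 hc)
    · rw [ae_iff]; simpa using ht3
  refine ⟨fun x => if x ∈ S then a x else 0, ⟨?_, ?_, ?_⟩, ?_⟩
  · intro x
    dsimp only
    split_ifs
    · exact ha1 x
    · exact contDiff_const
  · intro i k
    have hc : ∀ x, Continuous ((dv (eb i))^[k] (if x ∈ S then a x else 0)) := by
      intro x
      split_ifs
      · exact dvi_cont _ _ (ha1 x)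
      · rw [dvi_zero]; exact continuous_const
    have hD : ∀ N, Measurable fun x => (dv (eb i))^[k] (if x ∈ S then a x else 0) (D N) := by
      intro N
      have : (fun x => (dv (eb i))^[k] (if x ∈ S then a x else 0) (D N)) = S.indicator ((hm i k (D N)).mk _) := by
        ext x
        by_cases hx : x ∈ S
        · rw [if_pos hx, Set.indicator_of_mem hx, hS x hx]
        · rw [if_neg hx, Set.indicator_of_notMem hx, dvi_zero]; rfl
      rw [this]
      exact (hm i k (D N)).stronglyMeasurable_mk.measurable.indicator hSm
    have hξ : ∀ ξ, Measurable fun x => (dv (eb i))^[k] (if x ∈ S then a x else 0) ξ := by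
      intro ξ
      have : ξ ∈ closure (Set.range D) := TopologicalSpace.denseRange_denseSeq (En n) ξ
      obtain ⟨s, hs1, hs2⟩ := mem_closure_iff_seq_limit.1 this
      refine measurable_of_tendsto_metrizable (f := fun j x => (dv (eb i))^[k] (if x ∈ S then a x else 0) (s j)) (fun j => ?_) ?_
      · obtain ⟨N, hN⟩ := hs1 j
        rw [← hN]; exact hD N
      · rw [tendsto_pi_nhds]
        intro x
        exact ((hc x).tendsto ξ).comp hs2
    have := measurable_uncurry_of_continuous_of_measurable (u := fun (ξ x : En n) => (dv (eb i))^[k] (if x ∈ S then a x else 0) ξ) hc hξ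
    exact this.comp measurable_swap
  · intro i k
    obtain ⟨C, hC⟩ := ha3 (Pi.single i k)
    refine ⟨max C 0, le_max_right _ _, fun ξ => ?_⟩
    have h1 := hC ξ
    rw [mdeg_single] at h1
    simp only [mderiv_single] at h1
    refine le_trans ?_ (h1.trans (ENNReal.ofReal_le_ofReal ?_))
    · refine le_of_eq (eLpNorm_congr_ae ?_)
      filter_upwards [hS0] with x hx
      simp [hx]
    · have : 0 ≤ jb ξ (m - ρ * k) := by unfold jb; positivity
      gcongr
      exact le_max_left _ _
  · filter_upwards [hS0] with x hx
    simp [hx]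

end RegSec

section HighSec
variable {n : ℕ}

lemma eLp_cmul (D : ℝ) (F : En n → ℂ) (p : ℝ≥0∞) :
    eLpNorm (fun x => ENNReal.ofReal D * ‖F x‖ₑ) p volume ≤ ENNReal.ofReal D * eLpNorm F p volume :=
  eLpNorm_le_nnreal_smul_eLpNorm_of_ae_le_mul' (c := D.toNNReal) (Filter.Eventually.of_forall fun _ => le_rfl) p

lemma eLp_cmul2 (D : ℝ) (F : En n → ℝ≥0∞) (p : ℝ≥0∞) :
    eLpNorm (fun x => ENNReal.ofReal D * F x) p volume ≤ ENNReal.ofReal D * eLpNorm F p volume :=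
  eLpNorm_le_nnreal_smul_eLpNorm_of_ae_le_mul' (c := D.toNNReal) (Filter.Eventually.of_forall fun _ => le_rfl) p

lemma eLp_sum {ι : Type*} (s : Finset ι) (f : ι → En n → ℝ≥0∞) (hf : ∀ i ∈ s, Measurable (f i)) {p : ℝ≥0∞} (hp : 1 ≤ p) :
    eLpNorm (fun x => ∑ i ∈ s, f i x) p volume ≤ ∑ i ∈ s, eLpNorm (f i) p volume := by
  have := eLpNorm_sum_le (μ := (volume : Measure (En n))) (s := s) (f := f) (fun i hi => (hf i hi).aestronglyMeasurable) hp
  have h2 : (∑ i ∈ s, f i) = fun x => ∑ i ∈ s, f i x := by ext x; simp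
  rw [h2] at this
  exact this

lemma dvi_scale (v : En n) (l : ℝ) (k : ℕ) (f : En n → ℂ) :
    ∀ ω, (dv v)^[k] (fun ω => f (l • ω)) ω = (l : ℂ) ^ k * (dv v)^[k] f (l • ω) := by
  induction k with
  | zero => intro ω; simp
  | succ k ih =>
    intro ω
    rw [Function.iterate_succ_apply', Function.iterate_succ_apply', funext ih]
    have h1 := congrFun (fderiv_const_smul_field (𝕜 := ℝ) (R := ℂ) ((l:ℂ)^k) (f := fun ω => (dv v)^[k] f (l • ω))) ω
    have h2 : (((l:ℂ)^k) • fun ω => (dv v)^[k] f (l • ω)) = fun z => (l:ℂ)^k * (dv v)^[k] f (l • z) := by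
      ext z; simp
    rw [h2] at h1
    have h3 : fderiv ℝ (fun ω => (dv v)^[k] f (l • ω)) ω = l • fderiv ℝ ((dv v)^[k] f) (l • ω) := fderiv_comp_smul l
    unfold dv at *
    rw [h1, Pi.smul_apply, _root_.smul_apply, h3, _root_.smul_apply]
    simp only [smul_eq_mul, Complex.real_smul]
    ring

lemma Js_scale (v : En n) (κ l : ℝ) (hκ : 0 < κ) (hl : 0 ≤ l) (N : ℕ) (f : En n → ℂ) (ω : En n) :
    Js (κ⁻¹ • v) N (fun ω => f (l • ω)) ω = ∑ k ∈ Finset.range (N+1), (κ⁻¹ * l) ^ k * ‖(dv v)^[k] f (l • ω)‖ := by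
  unfold Js
  refine Finset.sum_congr rfl fun k _ => ?_
  rw [dv_smul_iter, dvi_scale, norm_mul, norm_mul, norm_pow, norm_pow, mul_pow, Complex.norm_real, Complex.norm_real,
    Real.norm_of_nonneg hl, Real.norm_of_nonneg (by positivity)]
  ring

lemma jb_scale (s l : ℝ) (hl : 1 ≤ l) (ω : En n) (h1 : 1/2 ≤ ‖ω‖) (h2 : ‖ω‖ ≤ 2) :
    jb (l • ω) s ≤ 5 ^ (|s|/2) * l ^ s := by
  have hl0 : 0 < l := by linarith
  unfold jb
  rw [norm_smul, Real.norm_of_nonneg hl0.le]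
  have hls : l ^ s = (l^2) ^ (s/2) := by
    rw [← Real.rpow_natCast l 2, ← Real.rpow_mul hl0.le]; congr 1; push_cast; ring
  have hω : ‖ω‖^2 ≤ 4 := by nlinarith [norm_nonneg ω]
  have hω' : 1/4 ≤ ‖ω‖^2 := by nlinarith [norm_nonneg ω]
  rw [hls]
  rcases le_total 0 s with hs | hs
  · rw [abs_of_nonneg hs, ← Real.mul_rpow (by norm_num) (by positivity)]
    refine Real.rpow_le_rpow (by positivity) ?_ (by positivity)
    rw [mul_pow]
    nlinarith [sq_nonneg l, one_le_pow₀ hl (n := 2)]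
  · rw [abs_of_nonpos hs]
    have h5 : (5:ℝ) ^ (-s/2) = (5⁻¹) ^ (s/2) := by
      rw [Real.inv_rpow (by norm_num), ← Real.rpow_neg (by norm_num)]; congr 1; ring
    rw [h5, ← Real.mul_rpow (by norm_num) (by positivity)]
    refine Real.rpow_le_rpow_of_nonpos (by positivity) ?_ (by linarith)
    rw [mul_pow]
    nlinarith [sq_nonneg l, one_le_pow₀ hl (n := 2)]

lemma phi_meas {φ : En n → En n → ℝ} (hφ : PhiClass 2 φ) :
    Measurable (fun q : En n × En n => φ q.1 q.2) := by
  obtain ⟨h1, h2, -⟩ := hφ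
  have h0 : ∀ x, φ x 0 = 0 := by
    intro x
    have := h2 x 0 2 (by norm_num)
    rw [smul_zero] at this
    linarith
  have hs : IsOpen {q : En n × En n | q.2 ≠ 0} := isOpen_ne_fun continuous_snd continuous_const
  have := ContinuousOn.measurable_piecewise (g := fun _ => 0) h1.continuousOn continuousOn_const hs.measurableSet
  convert this using 1
  ext q
  by_cases hq : q.2 = 0
  · rw [Set.piecewise_eq_of_notMem _ _ _ (by simpa using hq), hq, h0]
  · rw [Set.piecewise_eq_of_mem _ _ _ hq]

lemma exp_nonneg_aux {ρ l : ℝ} (hl : 0 < l) : (l ^ (1 - ρ))⁻¹ * l = l ^ ρ := by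
  rw [← Real.rpow_neg hl.le]
  nth_rewrite 2 [← Real.rpow_one l]
  rw [← Real.rpow_add hl]; congr 1; ring

lemma high {p : ℝ≥0∞} (hp : 2 ≤ p) {r : ℝ≥0∞} (hr : r⁻¹ = p⁻¹ + 2⁻¹) [NeZero n]
    {φ : En n → En n → ℝ} (hφ : PhiClass 2 φ)
    {m ρ : ℝ} (hρ1 : ρ ≤ 1) {a : En n → En n → ℂ} (ha : Reg p m ρ a)
    {u : En n} (hu : ‖u‖ = 1) {δ c C : ℝ} (hδ : 0 < δ) (hδ2 : δ ≤ 1/2) (hc : 0 < c) (hψ : PH (Metric.ball u δ) φ (n+1) c C) :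
    ∃ K : ℝ, 0 ≤ K ∧ ∀ l : ℝ, 1 ≤ l → ∀ (E : Set (En n)) (h : En n → ℂ), MeasurableSet E → Measurable h →
      ∫⁻ ω, ‖h ω‖ₑ ^ 2 ≠ ∞ → (∀ ω, l • ω ∈ E → ω ∈ Metric.ball u (δ/2)) →
      eLpNorm (fun x => ∫ ξ in E, (Complex.exp (Complex.I * (φ x ξ : ℂ)) * a x ξ) * h ξ) r volume ≤
      ENNReal.ofReal (K * l ^ ((n:ℝ)*(1-ρ)/2 + m)) * (∫⁻ ω, ‖h ω‖ₑ ^ 2) ^ (1/2 : ℝ) := by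
  obtain ⟨K, hK0, hK⟩ := piece hδ hc hψ (phi_meas hφ) p hp r hr
  obtain ⟨ha1, ha2, ha3⟩ := ha
  choose Ca hCa0 hCa using ha3
  have hp1 : 1 ≤ p := le_trans (by norm_num) hp
  set Q : ℝ := ∑ i : Fin n, ∑ k ∈ Finset.range (n+1+1), Ca i k * 5 ^ (|m - ρ * k|/2) with hQ
  have hQ0 : 0 ≤ Q := Finset.sum_nonneg fun i _ => Finset.sum_nonneg fun k _ => by have := hCa0 i k; positivity
  refine ⟨K * Q, by positivity, ?_⟩
  intro l hl E h hE hh hH hEω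
  have hl0 : 0 < l := by linarith
  have hκ : 1 ≤ l ^ (1 - ρ) := Real.one_le_rpow hl (by linarith)
  have hκ0 : 0 < l ^ (1 - ρ) := by linarith
  have hsm : Measurable (fun q : En n × En n => (q.1, l • q.2)) :=
    measurable_fst.prodMk (measurable_snd.const_smul l)
  have hterm : ∀ i k, Measurable (fun q : En n × En n => ENNReal.ofReal (((l ^ (1 - ρ))⁻¹ * l) ^ k) * ‖(dv (eb i))^[k] (a q.1) (l • q.2)‖ₑ) :=
    fun i k => ((ha2 i k).comp hsm).enorm.const_mul _
  have main := hK l (l ^ (1 - ρ)) hl0 hκ (fun x ω => a x (l • ω))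
    (fun x ω => ∑ i : Fin n, ∑ k ∈ Finset.range (n+1+1), ENNReal.ofReal (((l ^ (1 - ρ))⁻¹ * l) ^ k) * ‖(dv (eb i))^[k] (a x) (l • ω)‖ₑ)
    h (Q * l ^ m) E (fun x ξ => Complex.exp (Complex.I * (φ x ξ : ℂ)) * a x ξ) (by positivity)
    ((ha2 0 0).comp hsm) ?_ hh hE ?_ ?_ ?_ hH hEω ?_
  · refine main.trans (le_of_eq ?_)
    congr 2
    rw [Real.rpow_add hl0, ← Real.rpow_mul hl0.le]
    have : (1 - ρ) * ((n:ℝ)/2) = (n:ℝ)*(1-ρ)/2 := by ring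
    rw [this]; ring
  · exact Finset.measurable_sum _ fun i _ => Finset.measurable_sum _ fun k _ => hterm i k
  · intro x
    exact ((ha1 x).comp (contDiff_const_smul l)).contDiffOn
  · intro x ω hω i
    rw [Js_scale _ _ _ hκ0 hl0.le, ENNReal.ofReal_sum_of_nonneg fun k _ => by positivity]
    refine le_trans (le_of_eq ?_) (Finset.single_le_sum (f := fun i => ∑ k ∈ Finset.range (n+1+1), ENNReal.ofReal (((l ^ (1 - ρ))⁻¹ * l) ^ k) * ‖(dv (eb i))^[k] (a x) (l • ω)‖ₑ) (fun _ _ => zero_le) (Finset.mem_univ i))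
    refine Finset.sum_congr rfl fun k _ => ?_
    rw [ENNReal.ofReal_mul (by positivity), ofReal_norm]
  · intro ω hω
    obtain ⟨hω1, hω2, -⟩ := ball_ann hu hδ2 hω
    have hmx : ∀ i k, Measurable (fun x : En n => ENNReal.ofReal (((l ^ (1 - ρ))⁻¹ * l) ^ k) * ‖(dv (eb i))^[k] (a x) (l • ω)‖ₑ) :=
      fun i k => (hterm i k).comp (measurable_id.prodMk measurable_const)
    refine (eLp_sum _ _ (fun i _ => Finset.measurable_sum _ fun k _ => hmx i k) hp1).trans ?_
    rw [hQ, Finset.sum_mul, ENNReal.ofReal_sum_of_nonneg fun i _ => mul_nonneg (Finset.sum_nonneg fun k _ => by have := hCa0 i k; positivity) (by positivity)]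
    refine Finset.sum_le_sum fun i _ => ?_
    refine (eLp_sum _ _ (fun k _ => hmx i k) hp1).trans ?_
    rw [Finset.sum_mul, ENNReal.ofReal_sum_of_nonneg fun k _ => by have := hCa0 i k; positivity]
    refine Finset.sum_le_sum fun k _ => ?_
    refine (eLp_cmul _ _ _).trans ?_
    calc _ ≤ ENNReal.ofReal (((l ^ (1 - ρ))⁻¹ * l) ^ k) * ENNReal.ofReal (Ca i k * (5 ^ (|m - ρ * k|/2) * l ^ (m - ρ * k))) := by
          refine mul_le_mul_right ((hCa i k _).trans (ENNReal.ofReal_le_ofReal ?_)) _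
          exact mul_le_mul_of_nonneg_left (jb_scale _ l hl ω hω1 hω2) (hCa0 i k)
      _ = _ := by
          rw [← ENNReal.ofReal_mul (by positivity), exp_nonneg_aux hl0]
          congr 1
          have : l ^ m = l ^ (ρ * k) * l ^ (m - ρ * k) := by rw [← Real.rpow_add hl0]; congr 1; ring
          rw [this, ← Real.rpow_natCast (l ^ ρ) k, ← Real.rpow_mul hl0.le]
          ring
  · intro x ω _
    rw [hφ.2.1 x ω l hl0]

end HighSec

section LowSec
variable {n : ℕ}

def SA (a : En n → En n → ℂ) (x ξ : En n) : ℝ≥0∞ :=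
  ∑ i : Fin n, ∑ k ∈ Finset.range (n+1+1), ‖(dv (eb i))^[k] (a x) ξ‖ₑ

lemma SA_meas {p : ℝ≥0∞} {m ρ : ℝ} {a : En n → En n → ℂ} (ha : Reg p m ρ a) :
    Measurable (fun q : En n × En n => SA a q.1 q.2) := by
  unfold SA
  exact Finset.measurable_sum _ fun i _ => Finset.measurable_sum _ fun k _ => (ha.2.1 i k).enorm

lemma SA_term (a : En n → En n → ℂ) (x ξ : En n) (i : Fin n) :
    ∑ k ∈ Finset.range (n+1+1), ‖(dv (eb i))^[k] (a x) ξ‖ₑ ≤ SA a x ξ :=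
  Finset.single_le_sum (f := fun i => ∑ k ∈ Finset.range (n+1+1), ‖(dv (eb i))^[k] (a x) ξ‖ₑ)
    (fun _ _ => zero_le) (Finset.mem_univ i)

lemma jb_low (s : ℝ) (ξ : En n) (h2 : ‖ξ‖ ≤ 2) : jb ξ s ≤ 5 ^ (|s|/2) := by
  unfold jb
  have h5 : ‖ξ‖^2 ≤ 4 := by nlinarith [norm_nonneg ξ]
  calc (1 + ‖ξ‖^2) ^ (s/2) ≤ (1 + ‖ξ‖^2) ^ (|s|/2) :=
        Real.rpow_le_rpow_of_exponent_le (by nlinarith [sq_nonneg ‖ξ‖]) (by linarith [le_abs_self s])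
    _ ≤ _ := Real.rpow_le_rpow (by positivity) (by linarith) (by positivity)

lemma SA_norm {p : ℝ≥0∞} (hp : 1 ≤ p) {m ρ : ℝ} {a : En n → En n → ℂ} (ha : Reg p m ρ a) :
    ∃ M : ℝ, 0 ≤ M ∧ ∀ ξ, ‖ξ‖ ≤ 2 → eLpNorm (fun x => SA a x ξ) p volume ≤ ENNReal.ofReal M := by
  obtain ⟨ha1, ha2, ha3⟩ := ha
  choose Ca hCa0 hCa using ha3
  refine ⟨∑ i : Fin n, ∑ k ∈ Finset.range (n+1+1), Ca i k * 5 ^ (|m - ρ * k|/2),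
    Finset.sum_nonneg fun i _ => Finset.sum_nonneg fun k _ => by have := hCa0 i k; positivity, ?_⟩
  intro ξ hξ
  unfold SA
  have hmx : ∀ i k, Measurable (fun x : En n => ‖(dv (eb i))^[k] (a x) ξ‖ₑ) :=
    fun i k => ((ha2 i k).comp (measurable_id.prodMk measurable_const)).enorm
  refine (eLp_sum _ _ (fun i _ => Finset.measurable_sum _ fun k _ => hmx i k) hp).trans ?_
  rw [ENNReal.ofReal_sum_of_nonneg fun i _ => (Finset.sum_nonneg fun k _ => by have := hCa0 i k; positivity)]
  refine Finset.sum_le_sum fun i _ => ?_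
  refine (eLp_sum _ _ (fun k _ => hmx i k) hp).trans ?_
  rw [ENNReal.ofReal_sum_of_nonneg fun k _ => by have := hCa0 i k; positivity]
  refine Finset.sum_le_sum fun k _ => ?_
  rw [show eLpNorm (fun x => ‖(dv (eb i))^[k] (a x) ξ‖ₑ) p volume = eLpNorm (fun x => (dv (eb i))^[k] (a x) ξ) p volume from eLpNorm_enorm _]
  refine (hCa i k ξ).trans (ENNReal.ofReal_le_ofReal ?_)
  exact mul_le_mul_of_nonneg_left (jb_low _ _ hξ) (hCa0 i k)

lemma clm_enorm (L : En n →L[ℝ] ℂ) (z : En n) : ‖L z‖ₑ ≤ ENNReal.ofReal ‖z‖ * ∑ j, ‖L (eb j)‖ₑ := by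
  have h1 : L z = ∑ j, z j • L (eb j) := by
    have : z = ∑ j, z j • eb j := by
      ext i
      simp [eb, Finset.sum_apply, Pi.single_apply]
    conv_lhs => rw [this]
    simp
  rw [h1, Finset.mul_sum]
  refine (enorm_sum_le _ _).trans (Finset.sum_le_sum fun j _ => ?_)
  rw [enorm_smul]
  refine mul_le_mul_left ?_ _
  rw [← ofReal_norm]
  exact ENNReal.ofReal_le_ofReal (PiLp.norm_apply_le z j)

lemma ftc_bound {f : En n → ℂ} (hf : ContDiff ℝ (⊤ : ℕ∞) f) (z : En n) :
    ‖f z - f 0‖ₑ ≤ ENNReal.ofReal ‖z‖ * ∫⁻ t in Set.Icc (0:ℝ) 1, ∑ j, ‖dv (eb j) f (t • z)‖ₑ := by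
  have hd : Differentiable ℝ f := hf.differentiable (by simp)
  have hcf : Continuous fun t : ℝ => fderiv ℝ f (t • z) z :=
    ((hf.continuous_fderiv (by simp)).comp (continuous_id.smul continuous_const)).clm_apply continuous_const
  have h1 : ∫ t in (0:ℝ)..1, fderiv ℝ f (t • z) z = f ((1:ℝ) • z) - f ((0:ℝ) • z) := by
    refine intervalIntegral.integral_eq_sub_of_hasDerivAt (f := fun t : ℝ => f (t • z)) (fun t _ => ?_) (hcf.intervalIntegrable _ _)
    have := (hd (t • z)).hasFDerivAt.comp_hasDerivAt t ((hasDerivAt_id t).smul_const z)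
    simp only [id, one_smul] at this
    exact this
  rw [one_smul, zero_smul] at h1
  rw [← h1, intervalIntegral.integral_of_le zero_le_one, ← integral_Icc_eq_integral_Ioc]
  refine (enorm_integral_le_lintegral_enorm _).trans ?_
  rw [← lintegral_const_mul' _ _ ENNReal.ofReal_ne_top]
  exact lintegral_mono fun t => clm_enorm _ _

lemma avg_norm {p : ℝ≥0∞} (hp : 1 ≤ p) (b : En n → En n → ℝ≥0∞) (hb : Measurable (fun q : En n × En n => b q.1 q.2))
    (M : ℝ≥0∞) (hM : ∀ ξ, ‖ξ‖ ≤ 2 → eLpNorm (fun x => b x ξ) p volume ≤ M) (z : En n) (hz : ‖z‖ ≤ 2) :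
    eLpNorm (fun x => ∫⁻ t in Set.Icc (0:ℝ) 1, b x (t • z)) p volume ≤ M := by
  have hmt : Measurable fun t : ℝ => t • z := measurable_id.smul_const z
  have hν : IsProbabilityMeasure (Measure.map (fun t : ℝ => t • z) (volume.restrict (Set.Icc (0:ℝ) 1))) := by
    constructor
    rw [Measure.map_apply hmt MeasurableSet.univ]
    simp
  have h := mink b hb (Measure.map (fun t : ℝ => t • z) (volume.restrict (Set.Icc (0:ℝ) 1))) 1 one_pos p
    (by simpa using hp) M ?_
  · simp only [ENNReal.rpow_one, div_one, measure_univ, mul_one] at h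
    refine le_trans (le_of_eq ?_) h
    congr 1
    ext x
    have hbx : Measurable (b x) := hb.comp (measurable_const.prodMk measurable_id)
    rw [lintegral_map hbx hmt]
  · have hae : ∀ᵐ ξ ∂(Measure.map (fun t : ℝ => t • z) (volume.restrict (Set.Icc (0:ℝ) 1))), ‖ξ‖ ≤ 2 := by
      rw [ae_map_iff hmt.aemeasurable (measurableSet_le measurable_norm measurable_const)]
      filter_upwards [ae_restrict_mem measurableSet_Icc] with t ht
      rw [norm_smul, Real.norm_of_nonneg ht.1]
      nlinarith [ht.1, ht.2, norm_nonneg z]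
    filter_upwards [hae] with ξ hξ using hM ξ hξ

end LowSec

section LowSec2
variable {n : ℕ}

lemma Js_low1 (a : En n → En n → ℂ) (x ω : En n) (i : Fin n) (l : ℝ) (h0 : 0 ≤ l) (h1 : l ≤ 1) :
    ENNReal.ofReal (Js (eb i) (n+1) (fun ω => a x (l • ω)) ω) ≤ SA a x (l • ω) := by
  have h := Js_scale (eb i) 1 l one_pos h0 (n+1) (a x) ω
  rw [inv_one, one_smul, one_mul] at h
  rw [h, ENNReal.ofReal_sum_of_nonneg fun k _ => by positivity]
  refine (Finset.sum_le_sum fun k _ => ?_).trans (SA_term a x (l • ω) i)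
  rw [← ofReal_norm]
  refine ENNReal.ofReal_le_ofReal ?_
  exact mul_le_of_le_one_left (norm_nonneg _) (pow_le_one₀ h0 h1)

lemma dv_sub_const (v : En n) (f : En n → ℂ) (c : ℂ) : dv v (fun ω => f ω - c) = dv v f := by
  ext ω
  simp only [dv]
  rw [fderiv_sub_const]

lemma Js_low2 {a : En n → En n → ℂ} (x ω : En n) (ha : ContDiff ℝ (⊤ : ℕ∞) (a x)) (hω : ‖ω‖ ≤ 2)
    (i : Fin n) (l : ℝ) (h0 : 0 ≤ l) (h1 : l ≤ 1) :
    ENNReal.ofReal (Js (eb i) (n+1) (fun ω => a x (l • ω) - a x 0) ω) ≤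
      ENNReal.ofReal (2 * l) * (∫⁻ t in Set.Icc (0:ℝ) 1, SA a x (t • (l • ω))) + ENNReal.ofReal l * SA a x (l • ω) := by
  rw [Js_succ, ENNReal.ofReal_add (norm_nonneg _) (Js_nonneg _ _ _ _)]
  refine add_le_add ?_ ?_
  · rw [ofReal_norm]
    refine (ftc_bound ha (l • ω)).trans ?_
    refine mul_le_mul' (ENNReal.ofReal_le_ofReal ?_) (lintegral_mono fun t => ?_)
    · rw [norm_smul, Real.norm_of_nonneg h0]; nlinarith [norm_nonneg ω]
    · unfold SA
      refine Finset.sum_le_sum fun j _ => ?_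
      exact Finset.single_le_sum (f := fun k => ‖(dv (eb j))^[k] (a x) (t • (l • ω))‖ₑ) (fun _ _ => zero_le)
        (Finset.mem_range.2 (show 1 < n + 1 + 1 by omega))
  · rw [dv_sub_const]
    have e : Js (eb i) n (dv (eb i) (fun ω => a x (l • ω))) ω = ∑ k ∈ Finset.range (n+1), l ^ (k+1) * ‖(dv (eb i))^[k+1] (a x) (l • ω)‖ := by
      unfold Js
      refine Finset.sum_congr rfl fun k _ => ?_
      rw [← Function.iterate_succ_apply, dvi_scale, norm_mul, norm_pow, Complex.norm_real, Real.norm_of_nonneg h0]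
    rw [e, ENNReal.ofReal_sum_of_nonneg fun k _ => by positivity]
    have h2 : ∑ k ∈ Finset.range (n+1), ‖(dv (eb i))^[k+1] (a x) (l • ω)‖ₑ ≤ SA a x (l • ω) := by
      refine le_trans ?_ (SA_term a x (l • ω) i)
      rw [Finset.sum_range_succ' _ (n+1)]
      exact le_add_of_nonneg_right zero_le
    refine le_trans ?_ (mul_le_mul_right h2 _)
    rw [Finset.mul_sum]
    refine Finset.sum_le_sum fun k _ => ?_
    rw [← ofReal_norm, ← ENNReal.ofReal_mul h0]
    refine ENNReal.ofReal_le_ofReal ?_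
    gcongr
    rw [pow_succ]
    exact mul_le_of_le_one_left h0 (pow_le_one₀ h0 h1)

lemma Yg_cont {φ : En n → En n → ℝ} (hφ : PhiClass 2 φ) (hsnd : SNDcond φ) (u : En n) (hu : ‖u‖ = 1) :
    Continuous (Yg φ u) := by
  obtain ⟨B, C, hB, hC, h1, h2⟩ := Yg_bilip hφ hsnd u hu
  have : LipschitzWith C.toNNReal (Yg φ u) := by
    refine LipschitzWith.of_dist_le_mul fun x y => ?_
    rw [dist_eq_norm, dist_eq_norm, Real.coe_toNNReal _ hC]
    exact h2 x y
  exact this.continuous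

lemma lin_meas {Y : En n → En n} (hY : Continuous Y) : Measurable (fun q : En n × En n => (⟪Y q.1, q.2⟫ : ℝ)) :=
  ((hY.comp continuous_fst).inner continuous_snd).measurable

lemma Js_const (v : En n) (N : ℕ) (c : ℂ) (ω : En n) : Js v N (fun _ => c) ω = ‖c‖ := by
  cases N with
  | zero => rw [Js_zero]
  | succ N =>
    rw [Js_succ]
    have : dv v (fun _ => c) = fun _ => 0 := by ext; simp [dv]
    rw [this, Js_zero_fun, add_zero]

set_option maxHeartbeats 1000000 in
lemma low0 {p : ℝ≥0∞} (hp : 2 ≤ p) {r : ℝ≥0∞} (hr : r⁻¹ = p⁻¹ + 2⁻¹) [NeZero n]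
    {φ : En n → En n → ℝ} (hφ : PhiClass 2 φ) (hsnd : SNDcond φ)
    {m ρ : ℝ} {a : En n → En n → ℂ} (ha : Reg p m ρ a)
    {u : En n} (hu : ‖u‖ = 1) :
    ∃ K : ℝ, 0 ≤ K ∧ ∀ (E : Set (En n)) (h : En n → ℂ), MeasurableSet E → Measurable h →
      ∫⁻ ω, ‖h ω‖ₑ ^ 2 ≠ ∞ → (∀ ω ∈ E, ‖ω‖ < 1) →
      eLpNorm (fun x => ∫ ξ in E, (Complex.exp (Complex.I * ((⟪Yg φ u x, ξ⟫ : ℝ) : ℂ)) * a x 0) * h ξ) r volume ≤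
      ENNReal.ofReal K * (∫⁻ ω, ‖h ω‖ₑ ^ 2) ^ (1/2 : ℝ) := by
  obtain ⟨B, C, hB, hC, hY1, hY2⟩ := Yg_bilip hφ hsnd u hu
  have hn : (0 : ℝ) < n := by exact_mod_cast Nat.pos_of_ne_zero (NeZero.ne n)
  have hPH := PH_linear (Yg φ u) B C hB hC hY1 hY2 (Metric.ball 0 2) (n+1)
  obtain ⟨K, hK0, hK⟩ := piece (by norm_num) (by positivity) hPH (lin_meas (Yg_cont hφ hsnd u hu)) p hp r hr
  obtain ⟨M, hM0, hM⟩ := SA_norm (le_trans (by norm_num) hp) ha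
  have ham : Measurable (fun x => a x 0) := (ha.2.1 0 0).comp (measurable_id.prodMk measurable_const)
  refine ⟨K * M, by positivity, fun E h hE hh hH hEω => ?_⟩
  have main := hK 1 1 one_pos le_rfl (fun x _ => a x 0) (fun x _ => SA a x 0) h M E
    (fun x ξ => Complex.exp (Complex.I * ((⟪Yg φ u x, ξ⟫ : ℝ) : ℂ)) * a x 0) hM0 (ham.comp measurable_fst) ?_ hh hE
    (fun x => contDiffOn_const) ?_ (fun ω _ => hM 0 (by simp)) hH ?_ ?_
  · refine main.trans (le_of_eq ?_)
    simp
  · exact (SA_meas ha).comp (f := fun q : En n × En n => (q.1, (0 : En n))) (measurable_fst.prodMk measurable_const)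
  · intro x ω _ i
    rw [Js_const, ofReal_norm]
    refine le_trans ?_ (SA_term a x 0 i)
    exact Finset.single_le_sum (f := fun k => ‖(dv (eb i))^[k] (a x) 0‖ₑ) (fun _ _ => zero_le)
        (Finset.mem_range.2 (show 0 < n + 1 + 1 by omega))
  · intro ω hω
    rw [one_smul] at hω
    simpa using hEω ω hω
  · intro x ω _
    simp

set_option maxHeartbeats 2000000 in
lemma low {p : ℝ≥0∞} (hp : 2 ≤ p) {r : ℝ≥0∞} (hr : r⁻¹ = p⁻¹ + 2⁻¹) [NeZero n]
    {φ : En n → En n → ℝ} (hφ : PhiClass 2 φ) (hsnd : SNDcond φ)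
    {m ρ : ℝ} {a : En n → En n → ℂ} (ha : Reg p m ρ a)
    {u : En n} (hu : ‖u‖ = 1) {δ : ℝ} (hδ : 0 < δ) (hδ2 : δ ≤ 1/2) :
    ∃ K : ℝ, 0 ≤ K ∧ ∀ l : ℝ, 0 < l → l ≤ 1 → ∀ (E : Set (En n)) (h : En n → ℂ), MeasurableSet E → Measurable h →
      ∫⁻ ω, ‖h ω‖ₑ ^ 2 ≠ ∞ → (∀ ω, l • ω ∈ E → ω ∈ Metric.ball u (δ/2)) →
      eLpNorm (fun x => ∫ ξ in E, (Complex.exp (Complex.I * (φ x ξ : ℂ)) * a x ξ -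
        Complex.exp (Complex.I * ((⟪Yg φ u x, ξ⟫ : ℝ) : ℂ)) * a x 0) * h ξ) r volume ≤
      ENNReal.ofReal (K * l) * (∫⁻ ω, ‖h ω‖ₑ ^ 2) ^ (1/2 : ℝ) := by
  obtain ⟨B, C, hB, hC, hY1, hY2⟩ := Yg_bilip hφ hsnd u hu
  have hn : (0 : ℝ) < n := by exact_mod_cast Nat.pos_of_ne_zero (NeZero.ne n)
  have hPH := PH_linear (Yg φ u) B C hB hC hY1 hY2 (Metric.ball u δ) (n+1)
  have hYm := lin_meas (Yg_cont hφ hsnd u hu)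
  obtain ⟨K, hK0, hK⟩ := piece hδ (by positivity) hPH hYm p hp r hr
  have hp1 : 1 ≤ p := le_trans (by norm_num) hp
  obtain ⟨M, hM0, hM⟩ := SA_norm hp1 ha
  obtain ⟨Ct, hCt0, hCt⟩ := phase_theta hφ u hu (n+1)
  obtain ⟨C', hC'0, hC'⟩ := Js_exp (n := n) (n+1) Ct
  have hSm := SA_meas ha
  set D : ℝ := 4^(n+1) * C' + 1 with hD
  refine ⟨K * ((D + 2) * M), by positivity, ?_⟩
  intro l hl hl1 E h hE hh hH hEω
  have hsm : Measurable (fun q : En n × En n => (q.1, l • q.2)) :=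
    measurable_fst.prodMk (measurable_snd.const_smul l)
  have hθs : ∀ x, ContDiffOn ℝ (⊤ : ℕ∞) (fun ω => ((φ x ω - ⟪Yg φ u x, ω⟫ : ℝ) : ℂ)) (Metric.ball u δ) := by
    intro x
    refine Complex.ofRealCLM.contDiff.comp_contDiffOn (ContDiffOn.sub ?_ (inner_smooth _).contDiffOn)
    exact (slice_smooth (G := unc φ) hφ.1 x).mono fun ω hω => (ball_ann hu hδ2 hω).2.2
  have hes : ∀ x, ContDiffOn ℝ (⊤ : ℕ∞) (fun ω => Complex.exp (Complex.I * ((l * (φ x ω - ⟪Yg φ u x, ω⟫) : ℝ) : ℂ)) - 1) (Metric.ball u δ) := by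
    intro x
    refine ContDiffOn.sub (ContDiffOn.cexp (contDiffOn_const.mul ?_)) contDiffOn_const
    have : (fun ω => ((l * (φ x ω - ⟪Yg φ u x, ω⟫) : ℝ) : ℂ)) = fun ω => (l : ℂ) * ((φ x ω - ⟪Yg φ u x, ω⟫ : ℝ) : ℂ) := by
      ext ω; push_cast; ring
    rw [this]
    exact contDiffOn_const.mul (hθs x)
  have has : ∀ x, ContDiff ℝ (⊤ : ℕ∞) (fun ω => a x (l • ω)) := fun x => (ha.1 x).comp (contDiff_const_smul l)
  have ham : Measurable (fun q : En n × En n => a q.1 q.2) := ha.2.1 0 0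
  have ha0 : Measurable (fun q : En n × En n => a q.1 0) := ham.comp (measurable_fst.prodMk measurable_const)
  have hem : Measurable (fun q : En n × En n => Complex.exp (Complex.I * ((l * (φ q.1 q.2 - ⟪Yg φ u q.1, q.2⟫) : ℝ) : ℂ)) - 1) :=
    (((Complex.measurable_ofReal.comp (((phi_meas hφ).sub hYm).const_mul l)).const_mul _).cexp).sub_const 1
  have hI : Measurable (fun q : En n × En n => ∫⁻ t in Set.Icc (0:ℝ) 1, SA a q.1 (t • (l • q.2))) := by
    refine Measurable.lintegral_prod_right' (f := fun z : (En n × En n) × ℝ => SA a z.1.1 (z.2 • (l • z.1.2))) ?_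
    refine hSm.comp (f := fun z : (En n × En n) × ℝ => (z.1.1, z.2 • (l • z.1.2))) ?_
    exact (measurable_fst.comp measurable_fst).prodMk (measurable_snd.smul ((measurable_snd.comp measurable_fst).const_smul l))
  have main := hK l 1 hl le_rfl
    (fun x ω => (Complex.exp (Complex.I * ((l * (φ x ω - ⟪Yg φ u x, ω⟫) : ℝ) : ℂ)) - 1) * a x (l • ω) + (a x (l • ω) - a x 0))
    (fun x ω => ENNReal.ofReal (D * l) * SA a x (l • ω) + ENNReal.ofReal (2 * l) * (∫⁻ t in Set.Icc (0:ℝ) 1, SA a x (t • (l • ω))))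
    h ((D + 2) * M * l) E
    (fun x ξ => Complex.exp (Complex.I * (φ x ξ : ℂ)) * a x ξ -
        Complex.exp (Complex.I * ((⟪Yg φ u x, ξ⟫ : ℝ) : ℂ)) * a x 0) (by positivity)
    ((hem.mul (ham.comp hsm)).add ((ham.comp hsm).sub ha0)) ?_ hh hE ?_ ?_ ?_ hH hEω ?_
  · refine main.trans (le_of_eq ?_)
    congr 2
    rw [Real.one_rpow]; ring
  · exact ((hSm.comp hsm).const_mul _).add (hI.const_mul _)
  · intro x
    exact ((hes x).mul (has x).contDiffOn).add ((has x).sub contDiff_const).contDiffOn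
  · intro x ω hω i
    obtain ⟨hω1, hω2, -⟩ := ball_ann hu hδ2 hω
    rw [inv_one, one_smul]
    have hbo : IsOpen (Metric.ball u δ) := Metric.isOpen_ball
    have j1 := Js_add hbo (eb i) (n+1) ((hes x).mul (has x).contDiffOn) ((has x).sub (contDiff_const (c := a x 0))).contDiffOn ω hω
    have j2 := Js_mul hbo (eb i) (n+1) (hes x) (has x).contDiffOn ω hω
    have j3 := hC' (Metric.ball u δ) (eb i) (fun ω => φ x ω - ⟪Yg φ u x, ω⟫) l hbo (hθs x) hl.le hl1
      (fun ω hω => hCt x ω (Metric.ball_subset_ball hδ2 hω) i) ω hω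
    have j4 := Js_low1 a x ω i l hl.le hl1
    have j5 := Js_low2 x ω (ha.1 x) hω2 i l hl.le hl1
    have j0 := Js_nonneg (eb i) (n+1) (fun ω => a x (l • ω)) ω
    have j6 : ENNReal.ofReal (4^(n+1) * (Js (eb i) (n+1) (fun ω => Complex.exp (Complex.I * ((l * (φ x ω - ⟪Yg φ u x, ω⟫) : ℝ) : ℂ)) - 1) ω * Js (eb i) (n+1) (fun ω => a x (l • ω)) ω)) ≤ ENNReal.ofReal (4^(n+1) * C' * l) * SA a x (l • ω) := by
      refine le_trans (ENNReal.ofReal_le_ofReal (q := (4^(n+1) * C' * l) * Js (eb i) (n+1) (fun ω => a x (l • ω)) ω) ?_) ?_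
      · have := mul_le_mul_of_nonneg_right j3 j0
        have h4 : (0:ℝ) ≤ 4^(n+1) := by positivity
        calc _ ≤ (4:ℝ)^(n+1) * (C' * l * Js (eb i) (n+1) (fun ω => a x (l • ω)) ω) := mul_le_mul_of_nonneg_left this h4
          _ = _ := by ring
      · rw [ENNReal.ofReal_mul (by positivity)]
        exact mul_le_mul_right j4 _
    refine (ENNReal.ofReal_le_ofReal (j1.trans (add_le_add_left j2 _))).trans ?_
    rw [ENNReal.ofReal_add (by have := Js_nonneg (eb i) (n+1) (fun ω => Complex.exp (Complex.I * ((l * (φ x ω - ⟪Yg φ u x, ω⟫) : ℝ) : ℂ)) - 1) ω; positivity) (Js_nonneg _ _ _ _)]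
    refine (add_le_add j6 j5).trans (le_of_eq ?_)
    rw [hD, add_mul, one_mul, ENNReal.ofReal_add (by positivity) hl.le, add_mul]
    ring
  · intro ω hω
    obtain ⟨hω1, hω2, -⟩ := ball_ann hu hδ2 hω
    have hlω : ‖l • ω‖ ≤ 2 := by
      rw [norm_smul, Real.norm_of_nonneg hl.le]; nlinarith [norm_nonneg ω]
    have hpx : Measurable (fun x : En n => (x, ω)) := measurable_id.prodMk measurable_const
    have hm1 : Measurable (fun x : En n => ENNReal.ofReal (D * l) * SA a x (l • ω)) :=
      (hSm.comp (f := fun x : En n => (x, l • ω)) (measurable_id.prodMk measurable_const)).const_mul _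
    have hm2 : Measurable (fun x : En n => ENNReal.ofReal (2 * l) * (∫⁻ t in Set.Icc (0:ℝ) 1, SA a x (t • (l • ω)))) :=
      (hI.comp (f := fun x : En n => (x, ω)) hpx).const_mul _
    refine (eLpNorm_add_le hm1.aestronglyMeasurable hm2.aestronglyMeasurable hp1).trans ?_
    refine (add_le_add ((eLp_cmul2 _ _ _).trans (mul_le_mul_right (hM _ hlω) _))
      ((eLp_cmul2 _ _ _).trans (mul_le_mul_right (avg_norm hp1 (SA a) hSm _ hM _ hlω) _))).trans (le_of_eq ?_)
    rw [← ENNReal.ofReal_mul (by positivity), ← ENNReal.ofReal_mul (by positivity), ← ENNReal.ofReal_add (by positivity) (by positivity)]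
    congr 1; ring
  · intro x ω _
    have e1 : ((φ x (l • ω) : ℝ) : ℂ) = ((l * ⟪Yg φ u x, ω⟫ : ℝ) : ℂ) + ((l * (φ x ω - ⟪Yg φ u x, ω⟫) : ℝ) : ℂ) := by
      rw [hφ.2.1 x ω l hl, ← Complex.ofReal_add]; congr 1; ring
    have e2 : (⟪Yg φ u x, l • ω⟫ : ℝ) = l * ⟪Yg φ u x, ω⟫ := by rw [inner_smul_right]
    rw [e1, e2, mul_add, Complex.exp_add]
    ring

end LowSec2

section SumSec
variable {n : ℕ}

lemma eLp_tsum {ι : Type} [Countable ι] (f : ι → En n → ℝ≥0∞) (hf : ∀ i, Measurable (f i)) {r : ℝ≥0∞} (hr : 1 ≤ r)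
    (hr2 : r ≠ ∞) :
    eLpNorm (fun x => ∑' i, f i x) r volume ≤ ∑' i, eLpNorm (f i) r volume := by
  have hr0 : r ≠ 0 := by rintro rfl; simp at hr
  have hrp : 0 < r.toReal := ENNReal.toReal_pos hr0 hr2
  have e1 : eLpNorm (fun x => ∑' i, f i x) r volume = ⨆ s : Finset ι, eLpNorm (fun x => ∑ i ∈ s, f i x) r volume := by
    simp only [eLpNorm_eq_lintegral_rpow_enorm_toReal hr0 hr2, enorm_eq_self, ENNReal.tsum_eq_iSup_sum]
    have h1 : ∀ (g : Finset ι → ℝ≥0∞) (y : ℝ), 0 < y → (⨆ s, g s) ^ y = ⨆ s, (g s) ^ y := fun g y hy =>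
      (ENNReal.orderIsoRpow y hy).map_iSup g
    simp only [h1 _ _ hrp]
    rw [lintegral_iSup_directed, h1 _ _ (by positivity)]
    · intro s
      exact ((Finset.measurable_sum _ fun i _ => hf i).pow_const _).aemeasurable
    · intro s t
      refine ⟨s ∪ t, fun x => ?_, fun x => ?_⟩
      · exact ENNReal.rpow_le_rpow (Finset.sum_le_sum_of_subset Finset.subset_union_left) hrp.le
      · exact ENNReal.rpow_le_rpow (Finset.sum_le_sum_of_subset Finset.subset_union_right) hrp.le
  rw [e1]
  refine iSup_le fun s => ?_
  refine (eLp_sum s f (fun i _ => hf i) hr).trans ?_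
  exact ENNReal.sum_le_tsum s

lemma decomp {ι κ : Type} [Countable ι] [Fintype κ] (E : ι → Set (En n)) (hE : ∀ i, MeasurableSet (E i))
    (hd : Pairwise (Function.onFun Disjoint E)) (hu : ∀ᵐ ξ ∂(volume : Measure (En n)), ξ ∈ ⋃ i, E i)
    (lo : κ → Set (En n)) (hlo : ∀ k, MeasurableSet (lo k)) (g : En n → ℂ) (rr : κ → En n → ℂ) (h : En n → ℂ)
    (hrr : ∀ k, Integrable (fun ξ => rr k ξ * h ξ)) :
    ‖∫ ξ, g ξ * h ξ‖ₑ ≤ ∑' i, ‖∫ ξ in E i, (g ξ - ∑ k, (lo k).indicator (rr k) ξ) * h ξ‖ₑ +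
      ∑ k, ‖∫ ξ in lo k, rr k ξ * h ξ‖ₑ := by
  by_cases hg : Integrable (fun ξ => g ξ * h ξ)
  swap
  · rw [integral_undef hg]; simp
  have hk : ∀ k, Integrable (fun ξ => (lo k).indicator (rr k) ξ * h ξ) := by
    intro k
    have := (hrr k).indicator (hlo k)
    refine this.congr (Filter.Eventually.of_forall fun ξ => ?_)
    by_cases hx : ξ ∈ lo k <;> simp [hx]
  have hs : Integrable (fun ξ => ∑ k, (lo k).indicator (rr k) ξ * h ξ) := integrable_finsetSum _ fun k _ => hk k
  have hD : Integrable (fun ξ => (g ξ - ∑ k, (lo k).indicator (rr k) ξ) * h ξ) := by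
    refine (hg.sub hs).congr (Filter.Eventually.of_forall fun ξ => ?_)
    simp only [Pi.sub_apply, sub_mul, Finset.sum_mul]
  have e1 : ∫ ξ, g ξ * h ξ = (∫ ξ, (g ξ - ∑ k, (lo k).indicator (rr k) ξ) * h ξ) + ∑ k, ∫ ξ in lo k, rr k ξ * h ξ := by
    have : ∑ k, ∫ ξ in lo k, rr k ξ * h ξ = ∫ ξ, ∑ k, (lo k).indicator (rr k) ξ * h ξ := by
      rw [integral_finsetSum _ fun k _ => hk k]
      refine Finset.sum_congr rfl fun k _ => ?_
      rw [← integral_indicator (hlo k)]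
      congr 1; ext ξ
      by_cases hx : ξ ∈ lo k <;> simp [hx]
    rw [this, ← integral_add hD hs]
    congr 1; ext ξ
    rw [sub_mul, Finset.sum_mul]; ring
  have e2 : ∫ ξ, (g ξ - ∑ k, (lo k).indicator (rr k) ξ) * h ξ = ∑' i, ∫ ξ in E i, (g ξ - ∑ k, (lo k).indicator (rr k) ξ) * h ξ := by
    rw [← integral_iUnion hE hd hD.integrableOn]
    have : (volume : Measure (En n)).restrict (⋃ i, E i) = volume := by
      rw [Measure.restrict_eq_self_of_ae_mem hu]
    rw [this]
  rw [e1, e2]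
  refine (enorm_add_le _ _).trans (add_le_add ?_ (enorm_sum_le _ _))
  exact enorm_tsum_le_tsum_enorm

lemma disj_cover (N : ℕ) (U : Fin N → Set (En n)) (hU : ∀ i, MeasurableSet (U i)) :
    ∃ W : Fin N → Set (En n), (∀ i, MeasurableSet (W i)) ∧ Pairwise (Function.onFun Disjoint W) ∧
      (∀ z, (∃ i, z ∈ U i) → ∃ i, z ∈ W i) ∧ ∀ i, ∀ z ∈ W i, z ∈ U i := by
  refine ⟨disjointed U, fun i => ?_, disjoint_disjointed _, ?_,
    fun i z hz => disjointed_subset U i hz⟩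
  · rw [disjointed_apply, Finset.sup_set_eq_biUnion]
    exact (hU i).diff (Finset.measurableSet_biUnion _ fun j _ => hU j)
  intro z hz
  have h3 : z ∈ ⋃ i, U i := Set.mem_iUnion.2 hz
  rw [← iUnion_disjointed] at h3
  exact Set.mem_iUnion.1 h3

lemma cover (δ : En n → ℝ) (hδ : ∀ u, ‖u‖ = 1 → 0 < δ u) :
    ∃ (N : ℕ) (w : Fin N → En n) (W : Fin N → Set (En n)), (∀ i, MeasurableSet (W i)) ∧
      Pairwise (Function.onFun Disjoint W) ∧ (∀ z, 1 ≤ ‖z‖ → ‖z‖ ≤ 2 → ∃ i, z ∈ W i) ∧ (∀ i, 1 ≤ ‖w i‖ ∧ ‖w i‖ ≤ 2) ∧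
      ∀ i, ∀ z ∈ W i, ‖w i‖⁻¹ • z ∈ Metric.ball (‖w i‖⁻¹ • w i) (δ (‖w i‖⁻¹ • w i) / 2) := by
  obtain ⟨U, hUd⟩ : ∃ U : En n → Set (En n), U = fun x => (fun z => ‖x‖⁻¹ • z) ⁻¹' Metric.ball (‖x‖⁻¹ • x) (δ (‖x‖⁻¹ • x) / 2) := ⟨_, rfl⟩
  have hUm : ∀ x z, z ∈ U x ↔ ‖x‖⁻¹ • z ∈ Metric.ball (‖x‖⁻¹ • x) (δ (‖x‖⁻¹ • x) / 2) := by
    intro x z; rw [hUd]; rfl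
  have hUo : ∀ x, IsOpen (U x) := by
    intro x; rw [hUd]; exact Metric.isOpen_ball.preimage (continuous_const_smul _)
  have hK : IsCompact {z : En n | 1 ≤ ‖z‖ ∧ ‖z‖ ≤ 2} := by
    refine (isCompact_closedBall (0 : En n) 2).of_isClosed_subset ?_ ?_
    · exact (isClosed_le continuous_const continuous_norm).inter (isClosed_le continuous_norm continuous_const)
    · intro z hz; simpa using hz.2
  obtain ⟨t, ht1, ht2⟩ := hK.elim_nhds_subcover U (by
    intro x hx
    refine (hUo x).mem_nhds ?_
    have hx0 : ‖x‖ ≠ 0 := by have := hx.1; intro h; linarith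
    have : ‖‖x‖⁻¹ • x‖ = 1 := by rw [norm_smul, norm_inv, norm_norm, inv_mul_cancel₀ hx0]
    rw [hUm]
    exact Metric.mem_ball_self (half_pos (hδ _ this)))
  obtain ⟨e⟩ : Nonempty (t ≃ Fin t.card) := ⟨t.equivFin⟩
  obtain ⟨W, hW1, hW2, hW3, hW4⟩ := disj_cover t.card (fun i => U (e.symm i)) (fun i => (hUo _).measurableSet)
  refine ⟨t.card, fun i => (e.symm i : En n), W, hW1, hW2, ?_, fun i => ht1 _ (e.symm i).2,
    fun i z hz => (hUm _ _).1 (hW4 i z hz)⟩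
  intro z h1 h2
  have := ht2 ⟨h1, h2⟩
  simp only [Set.mem_iUnion] at this
  obtain ⟨x, hx, hz⟩ := this
  refine hW3 z ⟨e ⟨x, hx⟩, ?_⟩
  rw [Equiv.symm_apply_apply]
  exact hz

end SumSec

section MainSec
variable {n : ℕ}

def Ed {N : ℕ} (W : Fin N → Set (En n)) (z : ℤ × Fin N) : Set (En n) :=
  {ξ | ((2:ℝ) ^ z.1 ≤ ‖ξ‖ ∧ ‖ξ‖ < (2:ℝ) ^ (z.1 + 1)) ∧ ((2:ℝ) ^ z.1)⁻¹ • ξ ∈ W z.2}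

def Lo {N : ℕ} (W : Fin N → Set (En n)) (k : Fin N) : Set (En n) := ⋃ j : ℤ, ⋃ _ : j < 0, Ed W (j, k)

lemma Ed_meas {N : ℕ} {W : Fin N → Set (En n)} (hW : ∀ i, MeasurableSet (W i)) (z : ℤ × Fin N) : MeasurableSet (Ed W z) :=
  ((measurableSet_le measurable_const measurable_norm).inter (measurableSet_lt measurable_norm measurable_const)).inter
    ((hW z.2).preimage (measurable_const_smul _))

lemma Lo_meas {N : ℕ} {W : Fin N → Set (En n)} (hW : ∀ i, MeasurableSet (W i)) (k : Fin N) : MeasurableSet (Lo W k) :=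
  MeasurableSet.iUnion fun _ => MeasurableSet.iUnion fun _ => Ed_meas hW _

lemma Ed_uniq {N : ℕ} {W : Fin N → Set (En n)} (hW : Pairwise (Function.onFun Disjoint W)) {z z' : ℤ × Fin N} {ξ : En n}
    (h : ξ ∈ Ed W z) (h' : ξ ∈ Ed W z') : z = z' := by
  obtain ⟨j, i⟩ := z
  obtain ⟨j', i'⟩ := z'
  obtain ⟨⟨h1, h2⟩, h3⟩ := h
  obtain ⟨⟨h1', h2'⟩, h3'⟩ := h'
  have hj : j < j' + 1 := (zpow_lt_zpow_iff_right₀ (by norm_num : (1:ℝ) < 2)).1 (h1.trans_lt h2')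
  have hj' : j' < j + 1 := (zpow_lt_zpow_iff_right₀ (by norm_num : (1:ℝ) < 2)).1 (h1'.trans_lt h2)
  obtain rfl : j = j' := by omega
  have : i = i' := by
    by_contra hc
    exact Set.disjoint_left.1 (hW hc) h3 h3'
  rw [this]

lemma Ed_exists {N : ℕ} {W : Fin N → Set (En n)} (hW : ∀ z, 1 ≤ ‖z‖ → ‖z‖ ≤ 2 → ∃ i, z ∈ W i) {ξ : En n} (hξ : ξ ≠ 0) :
    ∃ z, ξ ∈ Ed W z := by
  obtain ⟨j, h1, h2⟩ := exists_mem_Ico_zpow (norm_pos_iff.2 hξ) (by norm_num : (1:ℝ) < 2)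
  have h0 : (0:ℝ) < 2 ^ j := by positivity
  obtain ⟨i, hi⟩ := hW (((2:ℝ) ^ j)⁻¹ • ξ) (by
      rw [norm_smul, Real.norm_of_nonneg (by positivity), inv_mul_eq_div, le_div_iff₀ h0, one_mul]; exact h1) (by
      rw [norm_smul, Real.norm_of_nonneg (by positivity), inv_mul_eq_div, div_le_iff₀ h0]
      rw [zpow_add_one₀ (by norm_num)] at h2; linarith)
  exact ⟨(j, i), ⟨h1, h2⟩, hi⟩

lemma Lo_iff {N : ℕ} {W : Fin N → Set (En n)} (hW : Pairwise (Function.onFun Disjoint W)) {z : ℤ × Fin N} {ξ : En n}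
    (h : ξ ∈ Ed W z) (k : Fin N) : ξ ∈ Lo W k ↔ z.1 < 0 ∧ k = z.2 := by
  unfold Lo
  simp only [Set.mem_iUnion]
  constructor
  · rintro ⟨j, hj, h'⟩
    obtain rfl := Ed_uniq hW h h'
    exact ⟨hj, rfl⟩
  · rintro ⟨hj, rfl⟩
    exact ⟨z.1, hj, h⟩

lemma Lo_norm {N : ℕ} {W : Fin N → Set (En n)} {k : Fin N} {ξ : En n} (h : ξ ∈ Lo W k) : ‖ξ‖ < 1 := by
  unfold Lo at h
  simp only [Set.mem_iUnion] at h
  obtain ⟨j, hj, ⟨_, h2⟩, _⟩ := h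
  refine h2.trans_le ?_
  exact zpow_le_one_of_nonpos₀ (by norm_num) (by simpa using by omega)

lemma sum_q {q : ℝ} (h0 : 0 ≤ q) (h1 : q < 1) (K : ℝ) (hK : 0 ≤ K) (N : ℕ) :
    ∑' z : ℤ × Fin N, ENNReal.ofReal (K * q ^ z.1.natAbs) ≠ ∞ := by
  have hs : Summable fun j : ℤ => K * q ^ j.natAbs := by
    refine Summable.mul_left _ ?_
    refine Summable.of_nat_of_neg ?_ ?_
    · simpa using summable_geometric_of_lt_one h0 h1
    · simpa using summable_geometric_of_lt_one h0 h1
  rw [ENNReal.tsum_prod']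
  simp only [tsum_fintype, Finset.sum_const, Finset.card_univ, Fintype.card_fin, nsmul_eq_mul]
  rw [ENNReal.tsum_mul_left]
  refine ENNReal.mul_ne_top (by simp) ?_
  rw [← ENNReal.ofReal_tsum_of_nonneg (fun j => by positivity) hs]
  exact ENNReal.ofReal_ne_top

lemma r_facts {p r : ℝ≥0∞} (hp : 2 ≤ p) (hr : r⁻¹ = p⁻¹ + 2⁻¹) : 1 ≤ r ∧ r ≠ ∞ := by
  constructor
  · rw [← ENNReal.inv_le_one, hr]
    calc p⁻¹ + 2⁻¹ ≤ 2⁻¹ + 2⁻¹ := by gcongr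
      _ = 1 := ENNReal.inv_two_add_inv_two
  · rintro rfl
    rw [ENNReal.inv_top] at hr
    have := (add_eq_zero.1 hr.symm).2
    simp at this

end MainSec

section MainB
variable {n : ℕ}

def GG (φ : En n → En n → ℝ) (a : En n → En n → ℂ) (x ξ : En n) : ℂ := Complex.exp (Complex.I * (φ x ξ : ℂ)) * a x ξ

def RR (φ : En n → En n → ℝ) (a : En n → En n → ℂ) (u x ξ : En n) : ℂ :=
  Complex.exp (Complex.I * ((⟪Yg φ u x, ξ⟫ : ℝ) : ℂ)) * a x 0

lemma cexp_meas {f : En n × En n → ℝ} (hf : Measurable f) : Measurable fun q => Complex.exp (Complex.I * (f q : ℂ)) :=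
  ((Complex.measurable_ofReal.comp hf).const_mul Complex.I).cexp

lemma Reg_meas [NeZero n] {p : ℝ≥0∞} {m ρ : ℝ} {a : En n → En n → ℂ} (ha : Reg p m ρ a) :
    Measurable (fun q : En n × En n => a q.1 q.2) := ha.2.1 0 0

lemma Reg_meas0 [NeZero n] {p : ℝ≥0∞} {m ρ : ℝ} {a : En n → En n → ℂ} (ha : Reg p m ρ a) :
    Measurable (fun q : En n × En n => a q.1 0) :=
  (Reg_meas ha).comp (f := fun q : En n × En n => (q.1, (0 : En n))) (measurable_fst.prodMk measurable_const)

lemma GG_meas [NeZero n] {p : ℝ≥0∞} {m ρ : ℝ} {a : En n → En n → ℂ} (ha : Reg p m ρ a) {φ : En n → En n → ℝ}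
    (hφ : PhiClass 2 φ) : Measurable (fun q : En n × En n => GG φ a q.1 q.2) :=
  (cexp_meas (phi_meas hφ)).mul (Reg_meas ha)

lemma RR_meas [NeZero n] {p : ℝ≥0∞} {m ρ : ℝ} {a : En n → En n → ℂ} (ha : Reg p m ρ a) {φ : En n → En n → ℝ}
    (hφ : PhiClass 2 φ) (hsnd : SNDcond φ) {u : En n} (hu : ‖u‖ = 1) :
    Measurable (fun q : En n × En n => RR φ a u q.1 q.2) :=
  (cexp_meas (lin_meas (Yg_cont hφ hsnd u hu))).mul (Reg_meas0 ha)

lemma int_meas {F : En n → En n → ℂ} (hF : Measurable (fun q : En n × En n => F q.1 q.2)) (E : Set (En n)) :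
    Measurable (fun x => ∫ ξ in E, F x ξ) :=
  (StronglyMeasurable.integral_prod_right' (ν := volume.restrict E) (f := fun q : En n × En n => F q.1 q.2)
    hF.stronglyMeasurable).measurable

lemma RR_int (φ : En n → En n → ℝ) (a : En n → En n → ℂ) (u x : En n) {h : En n → ℂ} (hh : Integrable h) :
    Integrable (fun ξ => RR φ a u x ξ * h ξ) := by
  refine hh.bdd_mul (c := ‖a x 0‖) ?_ ?_
  · refine Continuous.aestronglyMeasurable ?_
    unfold RR
    fun_prop
  · refine Filter.Eventually.of_forall fun ξ => ?_
    unfold RR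
    rw [norm_mul, mul_comm Complex.I, Complex.norm_exp_ofReal_mul_I, one_mul]

/-- The remaining function after removing the low frequency models. -/
def DD {N : ℕ} (φ : En n → En n → ℝ) (a : En n → En n → ℂ) (W : Fin N → Set (En n)) (u : Fin N → En n) (x ξ : En n) : ℂ :=
  GG φ a x ξ - ∑ k, (Lo W k).indicator (RR φ a (u k) x) ξ

lemma DD_meas [NeZero n] {p : ℝ≥0∞} {m ρ : ℝ} {a : En n → En n → ℂ} (ha : Reg p m ρ a) {φ : En n → En n → ℝ}
    (hφ : PhiClass 2 φ) (hsnd : SNDcond φ) {N : ℕ} {W : Fin N → Set (En n)} (hW : ∀ i, MeasurableSet (W i))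
    {u : Fin N → En n} (hu : ∀ k, ‖u k‖ = 1) :
    Measurable (fun q : En n × En n => DD φ a W u q.1 q.2) := by
  unfold DD
  refine (GG_meas ha hφ).sub (Finset.measurable_sum _ fun k _ => ?_)
  exact (RR_meas ha hφ hsnd (hu k)).indicator ((Lo_meas hW k).preimage measurable_snd)

lemma DD_neg {N : ℕ} (φ : En n → En n → ℝ) (a : En n → En n → ℂ) {W : Fin N → Set (En n)} (hW : Pairwise (Function.onFun Disjoint W))
    (u : Fin N → En n) {z : ℤ × Fin N} (hz : z.1 < 0) {ξ : En n} (h : ξ ∈ Ed W z) (x : En n) :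
    DD φ a W u x ξ = GG φ a x ξ - RR φ a (u z.2) x ξ := by
  unfold DD
  congr 1
  rw [Finset.sum_eq_single z.2]
  · exact Set.indicator_of_mem ((Lo_iff hW h _).2 ⟨hz, rfl⟩) _
  · intro k _ hk
    exact Set.indicator_of_notMem (fun hc => hk ((Lo_iff hW h _).1 hc).2) _
  · simp

lemma DD_pos {N : ℕ} (φ : En n → En n → ℝ) (a : En n → En n → ℂ) {W : Fin N → Set (En n)} (hW : Pairwise (Function.onFun Disjoint W))
    (u : Fin N → En n) {z : ℤ × Fin N} (hz : 0 ≤ z.1) {ξ : En n} (h : ξ ∈ Ed W z) (x : En n) :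
    DD φ a W u x ξ = GG φ a x ξ := by
  unfold DD
  rw [Finset.sum_eq_zero, sub_zero]
  intro k _
  exact Set.indicator_of_notMem (fun hc => absurd ((Lo_iff hW h _).1 hc).1 (not_lt.2 hz)) _

lemma scale_Ed {N : ℕ} {W : Fin N → Set (En n)} {w : Fin N → En n} {d : Fin N → ℝ} (hw : ∀ i, 1 ≤ ‖w i‖)
    (hWb : ∀ i, ∀ z ∈ W i, ‖w i‖⁻¹ • z ∈ Metric.ball (‖w i‖⁻¹ • w i) (d i)) (z : ℤ × Fin N) (ω : En n)
    (h : ((2:ℝ)^z.1 * ‖w z.2‖) • ω ∈ Ed W z) : ω ∈ Metric.ball (‖w z.2‖⁻¹ • w z.2) (d z.2) := by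
  have h3 := hWb _ _ h.2
  have h0 : (2:ℝ)^z.1 ≠ 0 := by positivity
  have h1 : ‖w z.2‖ ≠ 0 := by have := hw z.2; positivity
  rwa [smul_smul, smul_smul, show ‖w z.2‖⁻¹ * ((2:ℝ)^z.1)⁻¹ * ((2:ℝ)^z.1 * ‖w z.2‖) = 1 by field_simp, one_smul] at h3

end MainB

section MainC
variable {n : ℕ}

lemma num_pos {e q w : ℝ} (he : e < 0) (hq : (2:ℝ) ^ e ≤ q) (hw : 1 ≤ w) {j : ℤ} (hj : 0 ≤ j) :
    ((2:ℝ) ^ j * w) ^ e ≤ q ^ j.natAbs := by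
  obtain ⟨k, rfl⟩ := Int.eq_ofNat_of_zero_le hj
  simp only [zpow_natCast, Int.natAbs_natCast]
  calc ((2:ℝ) ^ k * w) ^ e ≤ ((2:ℝ) ^ k) ^ e := by
        refine Real.rpow_le_rpow_of_nonpos (by positivity) ?_ he.le
        exact le_mul_of_one_le_right (by positivity) hw
    _ = ((2:ℝ) ^ e) ^ k := by
        rw [← Real.rpow_natCast, ← Real.rpow_natCast, ← Real.rpow_mul (by norm_num), ← Real.rpow_mul (by norm_num), mul_comm]
    _ ≤ q ^ k := by gcongr

lemma num_neg {q w : ℝ} (hq : 1/2 ≤ q) (hw2 : w ≤ 2) {j : ℤ} (hj : j < 0) :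
    (2:ℝ) ^ j * w ≤ 2 * q ^ j.natAbs ∧ (2:ℝ) ^ j * w ≤ 1 := by
  have e : (2:ℝ) ^ j = (1/2) ^ j.natAbs := by
    obtain ⟨k, hk⟩ : ∃ k : ℕ, j = -(k:ℤ) := ⟨j.natAbs, by omega⟩
    rw [hk, zpow_neg, zpow_natCast, Int.natAbs_neg, Int.natAbs_natCast, one_div, inv_pow]
  have h1 : (2:ℝ) ^ j ≤ q ^ j.natAbs := by rw [e]; gcongr
  have h2 : (2:ℝ) ^ j ≤ 1/2 := by
    calc (2:ℝ) ^ j ≤ (2:ℝ) ^ (-1 : ℤ) := zpow_le_zpow_right₀ (by norm_num) (by omega)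
      _ = 1/2 := by norm_num
  have h0 : (0:ℝ) < 2 ^ j := by positivity
  constructor <;> nlinarith

set_option maxHeartbeats 1000000 in
lemma main_bound [NeZero n] {p : ℝ≥0∞} (hp : 2 ≤ p) {r : ℝ≥0∞} (hr : r⁻¹ = p⁻¹ + 2⁻¹)
    {φ : En n → En n → ℝ} (hφ : PhiClass 2 φ) (hsnd : SNDcond φ)
    {m ρ : ℝ} (hρ1 : ρ ≤ 1) (hm : m < (n:ℝ) * (ρ - 1) / 2) {a : En n → En n → ℂ} (ha : Reg p m ρ a) :
    ∃ K : ℝ, 0 ≤ K ∧ ∀ h : En n → ℂ, Measurable h → Integrable h → ∫⁻ ω, ‖h ω‖ₑ ^ 2 ≠ ∞ →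
      eLpNorm (fun x => ∫ ξ, GG φ a x ξ * h ξ) r volume ≤ ENNReal.ofReal K * (∫⁻ ω, ‖h ω‖ₑ ^ 2) ^ (1/2 : ℝ) := by
  obtain ⟨hr1, hr2⟩ := r_facts hp hr
  obtain ⟨e, he⟩ : ∃ e : ℝ, e = (n:ℝ)*(1-ρ)/2 + m := ⟨_, rfl⟩
  have he0 : e < 0 := by rw [he]; linarith
  have hph := fun u : En n => fun hu : ‖u‖ = 1 => phase_PH hφ hsnd u hu (n+1)
  choose! δ c C hδ hδ2 hc hPH using hph
  obtain ⟨N, w, W, hWm, hWd, hWc, hw, hWb⟩ := cover δ hδ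
  obtain ⟨u, hud⟩ : ∃ u : Fin N → En n, u = fun i => ‖w i‖⁻¹ • w i := ⟨_, rfl⟩
  have hu : ∀ i, ‖u i‖ = 1 := by
    intro i
    have := (hw i).1
    rw [hud]
    simp only [norm_smul, norm_inv, norm_norm]
    exact inv_mul_cancel₀ (by positivity)
  have hWb' : ∀ (z : ℤ × Fin N) (ω : En n), ((2:ℝ)^z.1 * ‖w z.2‖) • ω ∈ Ed W z → ω ∈ Metric.ball (u z.2) (δ (u z.2) / 2) := by
    intro z ω h
    have := scale_Ed (d := fun i => δ (u i) / 2) (fun i => (hw i).1) (by rw [hud]; exact hWb) z ω h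
    rw [hud] at this ⊢
    exact this
  have H1 := fun i => high hp hr hφ hρ1 ha (hu i) (hδ _ (hu i)) (hδ2 _ (hu i)) (hc _ (hu i)) (hPH _ (hu i))
  have H2 := fun i => low hp hr hφ hsnd ha (hu i) (hδ _ (hu i)) (hδ2 _ (hu i))
  have H3 := fun i => low0 hp hr hφ hsnd ha (hu i)
  rw [← he] at H1
  choose K1 hK1 H1 using H1
  choose K2 hK2 H2 using H2
  choose K3 hK3 H3 using H3
  obtain ⟨q, hq⟩ : ∃ q : ℝ, q = max ((2:ℝ)^e) (1/2) := ⟨_, rfl⟩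
  have hq1 : q < 1 := by
    rw [hq]
    exact max_lt (Real.rpow_lt_one_of_one_lt_of_neg (by norm_num) he0) (by norm_num)
  have hqa : (2:ℝ)^e ≤ q := hq ▸ le_max_left _ _
  have hqb : 1/2 ≤ q := hq ▸ le_max_right _ _
  have hq0 : 0 ≤ q := by linarith
  obtain ⟨K, hK⟩ : ∃ K : ℝ, K = ∑ i, (K1 i + 2 * K2 i) := ⟨_, rfl⟩
  have hKi : ∀ i, K1 i + 2 * K2 i ≤ K := by
    intro i
    rw [hK]
    exact Finset.single_le_sum (f := fun i => K1 i + 2 * K2 i) (fun i _ => by have := hK1 i; have := hK2 i; positivity) (Finset.mem_univ i)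
  have hK0 : 0 ≤ K := by
    rw [hK]; exact Finset.sum_nonneg fun i _ => by have := hK1 i; have := hK2 i; positivity
  have hS := sum_q hq0 hq1 K hK0 N
  obtain ⟨S, hSd⟩ : ∃ S, S = ∑' z : ℤ × Fin N, ENNReal.ofReal (K * q ^ z.1.natAbs) := ⟨_, rfl⟩
  rw [← hSd] at hS
  refine ⟨S.toReal + ∑ i, K3 i, add_nonneg ENNReal.toReal_nonneg (Finset.sum_nonneg fun i _ => hK3 i), ?_⟩
  intro h hh hhi hH
  obtain ⟨A, hA⟩ : ∃ A, A = (∫⁻ ω, ‖h ω‖ₑ ^ 2) ^ (1/2 : ℝ) := ⟨_, rfl⟩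
  have hDm := DD_meas ha hφ hsnd hWm hu
  have hmD : ∀ z, Measurable fun x => ‖∫ ξ in Ed W z, DD φ a W u x ξ * h ξ‖ₑ := fun z =>
    (int_meas (F := fun x ξ => DD φ a W u x ξ * h ξ) (hDm.mul (hh.comp measurable_snd)) _).enorm
  have hmR : ∀ k, Measurable fun x => ‖∫ ξ in Lo W k, RR φ a (u k) x ξ * h ξ‖ₑ := fun k =>
    (int_meas (F := fun x ξ => RR φ a (u k) x ξ * h ξ) ((RR_meas ha hφ hsnd (hu k)).mul (hh.comp measurable_snd)) _).enorm
  have hae : ∀ᵐ ξ ∂(volume : Measure (En n)), ξ ∈ ⋃ z, Ed W z := by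
    have : ∀ᵐ ξ ∂(volume : Measure (En n)), ξ ≠ 0 := by
      rw [ae_iff]; simp
    filter_upwards [this] with ξ hξ
    exact Set.mem_iUnion.2 (Ed_exists hWc hξ)
  have hpt : ∀ x, ‖∫ ξ, GG φ a x ξ * h ξ‖ₑ ≤ ∑' z, ‖∫ ξ in Ed W z, DD φ a W u x ξ * h ξ‖ₑ +
      ∑ k, ‖∫ ξ in Lo W k, RR φ a (u k) x ξ * h ξ‖ₑ := fun x =>
    decomp (Ed W) (Ed_meas hWm) (fun z z' hz => Set.disjoint_left.2 fun ξ h1 h2 => hz (Ed_uniq hWd h1 h2)) hae (Lo W)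
      (Lo_meas hWm) (GG φ a x) (fun k => RR φ a (u k) x) h (fun k => RR_int φ a (u k) x hhi)
  have hDz : ∀ z, eLpNorm (fun x => ‖∫ ξ in Ed W z, DD φ a W u x ξ * h ξ‖ₑ) r volume ≤ ENNReal.ofReal (K * q ^ z.1.natAbs) * A := by
    intro z
    have hw0 : 0 < ‖w z.2‖ := by linarith [(hw z.2).1]
    rw [eLpNorm_enorm, hA]
    have k1 := hK1 z.2
    have k2 := hK2 z.2
    have k3 := hKi z.2
    have hqz : 0 ≤ q ^ z.1.natAbs := by positivity
    rcases le_or_gt 0 z.1 with hz | hz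
    · have := H1 z.2 ((2:ℝ)^z.1 * ‖w z.2‖) (one_le_mul_of_one_le_of_one_le (one_le_zpow₀ (by norm_num) hz) (hw z.2).1) (Ed W z) h
        (Ed_meas hWm z) hh hH (hWb' z)
      have e1 : (fun x => ∫ ξ in Ed W z, DD φ a W u x ξ * h ξ) = fun x => ∫ ξ in Ed W z, (Complex.exp (Complex.I * (φ x ξ : ℂ)) * a x ξ) * h ξ := by
        funext x
        refine setIntegral_congr_fun (Ed_meas hWm z) fun ξ hξ => ?_
        simp only [DD_pos φ a hWd u hz hξ x]
        rfl
      rw [e1]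
      refine this.trans (mul_le_mul_left (ENNReal.ofReal_le_ofReal ?_) _)
      have := num_pos he0 hqa (hw z.2).1 hz
      calc K1 z.2 * ((2:ℝ)^z.1 * ‖w z.2‖)^e ≤ K1 z.2 * q ^ z.1.natAbs := by gcongr
        _ ≤ K * q ^ z.1.natAbs := by gcongr; linarith
    · obtain ⟨h1, h2⟩ := num_neg hqb (hw z.2).2 hz
      have := H2 z.2 ((2:ℝ)^z.1 * ‖w z.2‖) (by positivity) h2 (Ed W z) h
        (Ed_meas hWm z) hh hH (hWb' z)
      have e1 : (fun x => ∫ ξ in Ed W z, DD φ a W u x ξ * h ξ) = fun x => ∫ ξ in Ed W z, (Complex.exp (Complex.I * (φ x ξ : ℂ)) * a x ξ -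
        Complex.exp (Complex.I * ((⟪Yg φ (u z.2) x, ξ⟫ : ℝ) : ℂ)) * a x 0) * h ξ := by
        funext x
        refine setIntegral_congr_fun (Ed_meas hWm z) fun ξ hξ => ?_
        simp only [DD_neg φ a hWd u hz hξ x]
        rfl
      rw [e1]
      refine this.trans (mul_le_mul_left (ENNReal.ofReal_le_ofReal ?_) _)
      calc K2 z.2 * ((2:ℝ)^z.1 * ‖w z.2‖) ≤ K2 z.2 * (2 * q ^ z.1.natAbs) := by gcongr
        _ = (2 * K2 z.2) * q ^ z.1.natAbs := by ring
        _ ≤ K * q ^ z.1.natAbs := by gcongr; linarith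
  have hRk : ∀ k, eLpNorm (fun x => ‖∫ ξ in Lo W k, RR φ a (u k) x ξ * h ξ‖ₑ) r volume ≤ ENNReal.ofReal (K3 k) * A := by
    intro k
    rw [eLpNorm_enorm, hA]
    exact H3 k (Lo W k) h (Lo_meas hWm k) hh hH (fun ω hω => Lo_norm hω)
  rw [← hA]
  calc eLpNorm (fun x => ∫ ξ, GG φ a x ξ * h ξ) r volume
      ≤ eLpNorm ((fun x => ∑' z, ‖∫ ξ in Ed W z, DD φ a W u x ξ * h ξ‖ₑ) +
      fun x => ∑ k, ‖∫ ξ in Lo W k, RR φ a (u k) x ξ * h ξ‖ₑ) r volume := by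
        refine eLpNorm_mono_enorm fun x => ?_
        exact hpt x
    _ ≤ eLpNorm (fun x => ∑' z, ‖∫ ξ in Ed W z, DD φ a W u x ξ * h ξ‖ₑ) r volume +
      eLpNorm (fun x => ∑ k, ‖∫ ξ in Lo W k, RR φ a (u k) x ξ * h ξ‖ₑ) r volume :=
        eLpNorm_add_le (Measurable.tsum hmD).aestronglyMeasurable
          (Finset.measurable_sum _ fun k _ => hmR k).aestronglyMeasurable hr1
    _ ≤ ∑' z : ℤ × Fin N, ENNReal.ofReal (K * q ^ z.1.natAbs) * A + ∑ k, ENNReal.ofReal (K3 k) * A := by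
        refine add_le_add ((eLp_tsum _ hmD hr1 hr2).trans (ENNReal.tsum_le_tsum hDz)) ?_
        exact (eLp_sum _ _ (fun k _ => hmR k) hr1).trans (Finset.sum_le_sum fun k _ => hRk k)
    _ = ENNReal.ofReal (S.toReal + ∑ i, K3 i) * A := by
        rw [ENNReal.tsum_mul_right, ← Finset.sum_mul, ← add_mul, ← hSd,
          ENNReal.ofReal_add ENNReal.toReal_nonneg (Finset.sum_nonneg fun i _ => hK3 i), ENNReal.ofReal_toReal hS,
          ENNReal.ofReal_sum_of_nonneg fun i _ => hK3 i]

end MainC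

section FinalSec
variable {n : ℕ}

lemma ft_scale (f : 𝓢(En n, ℂ)) (ξ : En n) : ft f ξ = (FourierTransform.fourier f : 𝓢(En n, ℂ)) ((2 * Real.pi)⁻¹ • ξ) := by
  rw [SchwartzMap.fourier_coe, Real.fourier_eq']
  unfold ft
  refine integral_congr_ae (Filter.Eventually.of_forall fun y => ?_)
  simp only [smul_eq_mul]
  congr 2
  rw [real_inner_smul_right]
  have : (-2 * Real.pi * ((2 * Real.pi)⁻¹ * ⟪y, ξ⟫) : ℝ) = - ⟪y, ξ⟫ := by field_simp
  rw [this]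
  push_cast
  ring

lemma eLp_two (f : En n → ℂ) : eLpNorm f 2 volume = (∫⁻ x, ‖f x‖ₑ ^ 2) ^ (1/2:ℝ) := by
  rw [eLpNorm_eq_lintegral_rpow_enorm_toReal (by norm_num) (by norm_num)]
  simp

lemma planch (f : 𝓢(En n, ℂ)) :
    ∫⁻ ξ, ‖ft f ξ‖ₑ ^ 2 = ENNReal.ofReal ((2 * Real.pi) ^ n) * ∫⁻ x, ‖f x‖ₑ ^ 2 := by
  have h1 := lint_scale (n := n) (2 * Real.pi)⁻¹ (by positivity) (fun ξ => ‖(FourierTransform.fourier f : 𝓢(En n, ℂ)) ξ‖ₑ ^ 2)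
  simp only [ft_scale]
  rw [h1, inv_pow, inv_inv]
  congr 1
  have h2 := SchwartzMap.norm_fourier_toL2_eq f
  have e : ∀ g : 𝓢(En n, ℂ), ∫⁻ x, ‖g x‖ₑ ^ 2 = ENNReal.ofReal (‖g.toLp 2‖) ^ 2 := by
    intro g
    rw [SchwartzMap.norm_toLp, ENNReal.ofReal_toReal (g.memLp 2 volume).2.ne, eLp_two, ← ENNReal.rpow_natCast, ← ENNReal.rpow_mul]
    norm_num
  rw [e, e, h2]

lemma ft_int (f : 𝓢(En n, ℂ)) : Measurable (ft f) ∧ Integrable (ft f) := by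
  have : ft f = fun ξ => (FourierTransform.fourier f : 𝓢(En n, ℂ)) ((2 * Real.pi)⁻¹ • ξ) := funext (ft_scale f)
  rw [this]
  exact ⟨((FourierTransform.fourier f : 𝓢(En n, ℂ)).continuous.comp (continuous_const_smul _)).measurable,
    (FourierTransform.fourier f : 𝓢(En n, ℂ)).integrable.comp_smul (by positivity)⟩

lemma final_pos [NeZero n] {p : ℝ≥0∞} (hp : 2 ≤ p) {r : ℝ≥0∞} (hr : r⁻¹ = p⁻¹ + 2⁻¹)
    {φ : En n → En n → ℝ} (hφ : PhiClass 2 φ) (hsnd : SNDcond φ)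
    {m ρ : ℝ} (hρ1 : ρ ≤ 1) (hm : m < (n:ℝ) * (ρ - 1) / 2) {a : En n → En n → ℂ} (ha : LpSm p m ρ a) :
    ∃ C : ℝ, 0 < C ∧ ∀ f : 𝓢(En n, ℂ),
      eLpNorm (fio a φ (⇑f)) r volume ≤ ENNReal.ofReal C * eLpNorm (⇑f) 2 volume := by
  obtain ⟨a', ha', hae⟩ := regularize ha
  obtain ⟨K, hK0, hK⟩ := main_bound hp hr hφ hsnd hρ1 hm ha'
  obtain ⟨P, hP⟩ : ∃ P : ℝ, P = (2 * Real.pi) ^ n := ⟨_, rfl⟩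
  have hP0 : 0 < P := by rw [hP]; positivity
  have hq : 0 ≤ P⁻¹ * (K * P ^ (1/2:ℝ)) := by positivity
  refine ⟨P⁻¹ * (K * P ^ (1/2:ℝ)) + 1, by positivity, fun f => ?_⟩
  obtain ⟨hm1, hi1⟩ := ft_int f
  have hfin : ∫⁻ ξ, ‖f ξ‖ₑ ^ 2 ≠ ∞ := by
    intro hc
    have := (f.memLp 2 volume).2.ne
    rw [eLp_two, hc] at this
    simp at this
  have hfin2 : ∫⁻ ξ, ‖ft f ξ‖ₑ ^ 2 ≠ ∞ := by
    rw [planch]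
    exact ENNReal.mul_ne_top ENNReal.ofReal_ne_top hfin
  have h1 := hK (ft f) hm1 hi1 hfin2
  rw [planch, ENNReal.mul_rpow_of_nonneg _ _ (by norm_num), ← eLp_two, ← hP,
    ENNReal.ofReal_rpow_of_pos hP0, ← mul_assoc, ← ENNReal.ofReal_mul hK0] at h1
  have e1 : eLpNorm (fio a φ f) r volume = eLpNorm (fun x => P⁻¹ • ∫ ξ, GG φ a' x ξ * ft f ξ) r volume := by
    refine eLpNorm_congr_ae ?_
    filter_upwards [hae] with x hx
    unfold fio GG
    rw [hx, hP]
  rw [e1]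
  refine (eLp_smul _ (by positivity) _ _).trans ?_
  refine (mul_le_mul_right h1 _).trans ?_
  rw [← mul_assoc, ← ENNReal.ofReal_mul (by positivity)]
  exact mul_le_mul_left (ENNReal.ofReal_le_ofReal (by linarith)) _

lemma final_zero {p : ℝ≥0∞} {r : ℝ≥0∞} (hr : r⁻¹ = p⁻¹ + 2⁻¹)
    (φ : En 0 → En 0 → ℝ) (a : En 0 → En 0 → ℂ) :
    ∃ C : ℝ, 0 < C ∧ ∀ f : 𝓢(En 0, ℂ),
      eLpNorm (fio a φ (⇑f)) r volume ≤ ENNReal.ofReal C * eLpNorm (⇑f) 2 volume := by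
  have hr2 : r ≤ 2 := by
    rw [← ENNReal.inv_le_inv, hr]
    exact le_add_self
  have hv : (volume : Measure (En 0)) Set.univ = 1 := by
    have h1 := (EuclideanSpace.volume_preserving_symm_measurableEquiv_toLp (Fin 0)).map_eq
    have h2 : (volume : Measure (Fin 0 → ℝ)) Set.univ = 1 := by
      rw [volume_pi, Measure.pi_univ]; simp
    rw [← h1, Measure.map_apply (MeasurableEquiv.measurable _) MeasurableSet.univ, Set.preimage_univ] at h2
    exact h2
  have : IsProbabilityMeasure (volume : Measure (En 0)) := ⟨hv⟩
  refine ⟨‖a 0 0‖ + 1, by positivity, fun f => ?_⟩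
  have hb : ∀ x, ‖fio a φ f x‖ ≤ (‖a 0 0‖ + 1) * ‖f x‖ := by
    intro x
    have e1 : ∀ g : En 0 → ℂ, ∫ y, g y = g 0 := by
      intro g
      rw [integral_unique]
      simp [Measure.real, hv]
      exact congrArg g (Subsingleton.elim _ _)
    unfold fio ft
    simp only [e1]
    rw [Subsingleton.elim x 0]
    simp only [pow_zero, inv_one, one_smul, norm_mul, mul_comm Complex.I, Complex.norm_exp_ofReal_mul_I]
    simp
    nlinarith [norm_nonneg (f 0)]
  refine (eLpNorm_le_mul_eLpNorm_of_ae_le_mul (Filter.Eventually.of_forall hb) r).trans ?_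
  refine mul_le_mul_right ?_ _
  exact eLpNorm_le_eLpNorm_of_exponent_le hr2 f.continuous.aestronglyMeasurable

end FinalSec

/-- Theorem 4.7: `L²`-`L^r` boundedness of rough FIOs. -/
theorem statement6 {n : ℕ} (p : ℝ≥0∞) (hp : 2 ≤ p) (r : ℝ≥0∞) (hr : r⁻¹ = p⁻¹ + 2⁻¹)
    (φ : En n → En n → ℝ) (hφ : PhiClass 2 φ) (hsnd : SNDcond φ)
    (m ρ : ℝ) (hρ0 : 0 ≤ ρ) (hρ1 : ρ ≤ 1) (hm : m < (n : ℝ) * (ρ - 1) / 2)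
    (a : En n → En n → ℂ) (ha : LpSm p m ρ a) :
    ∃ C : ℝ, 0 < C ∧ ∀ f : 𝓢(En n, ℂ),
      eLpNorm (fio a φ (⇑f)) r volume ≤ ENNReal.ofReal C * eLpNorm (⇑f) 2 volume := by
  rcases Nat.eq_zero_or_pos n with rfl | h
  · exact final_zero hr φ a
  · have : NeZero n := ⟨h.ne'⟩
    exact final_pos hp hr hφ hsnd hρ1 hm ha
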